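/- Let N be a composite positive integer such that (i) 4 divides N or N is divisible by some prime p ≡ 3 (mod 4), and (ii) 9 divides N or N is divisible by some prime p ≡ 2 (mod 3). Then for every even integer k ≥ 2, the space M_k(Γ0(N)) is spanned by products of k/2 weight-two forms: every f ∈ M_k(Γ0(N)) is a ℂ-linear combination of functions of the form g_1·g_2⋯g_{k/2} where each g_i ∈ M_2(Γ0(N)). -/

import Mathlib

open ModularForm CongruenceSubgroup

namespace WeightTwo

open UpperHalfPlane Filter Topology Matrix.SpecialLinearGroup
open scoped MatrixGroups Manifold

noncomputable section

section

/-- Holomorphic forms of weight `k` on a subgroup `Γ` of `SL(2, ℤ)`, as functions. -/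
def MF (Γ : Subgroup SL(2, ℤ)) (k : ℤ) : Submodule ℂ (ℍ → ℂ) where
  carrier := {f | MDiff f ∧ (∀ γ ∈ Γ, f ∣[k] γ = f) ∧
    ∀ γ : SL(2, ℤ), IsBoundedAtImInfty (f ∣[k] γ)}
  add_mem' := by
    rintro f g ⟨hf, hf', hf''⟩ ⟨hg, hg', hg''⟩
    refine ⟨hf.add hg, fun γ hγ ↦ ?_, fun γ ↦ ?_⟩
    · rw [SlashAction.add_slash, hf' γ hγ, hg' γ hγ]
    · rw [SlashAction.add_slash]
      exact (hf'' γ).add (hg'' γ)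
  zero_mem' := by
    refine ⟨mdifferentiable_const, fun γ _ ↦ SlashAction.zero_slash _ _, fun γ ↦ ?_⟩
    rw [SlashAction.zero_slash]
    exact zero_form_isBoundedAtImInfty
  smul_mem' := by
    rintro c f ⟨hf, hf', hf''⟩
    refine ⟨hf.const_smul c, fun γ hγ ↦ ?_, fun γ ↦ ?_⟩
    · rw [SL_smul_slash, hf' γ hγ]
    · rw [SL_smul_slash]
      exact (hf'' γ).const_smul_left c

/-- Cusp forms of weight `k` on a subgroup `Γ` of `SL(2, ℤ)`, as functions. -/
def SF (Γ : Subgroup SL(2, ℤ)) (k : ℤ) : Submodule ℂ (ℍ → ℂ) where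
  carrier := {f | MDiff f ∧ (∀ γ ∈ Γ, f ∣[k] γ = f) ∧
    ∀ γ : SL(2, ℤ), IsZeroAtImInfty (f ∣[k] γ)}
  add_mem' := by
    rintro f g ⟨hf, hf', hf''⟩ ⟨hg, hg', hg''⟩
    refine ⟨hf.add hg, fun γ hγ ↦ ?_, fun γ ↦ ?_⟩
    · rw [SlashAction.add_slash, hf' γ hγ, hg' γ hγ]
    · rw [SlashAction.add_slash]
      exact (hf'' γ).add (hg'' γ)
  zero_mem' := by
    refine ⟨mdifferentiable_const, fun γ _ ↦ SlashAction.zero_slash _ _, fun γ ↦ ?_⟩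
    rw [SlashAction.zero_slash]
    exact zero_zeroAtFilter _
  smul_mem' := by
    rintro c f ⟨hf, hf', hf''⟩
    refine ⟨hf.const_smul c, fun γ hγ ↦ ?_, fun γ ↦ ?_⟩
    · rw [SL_smul_slash, hf' γ hγ]
    · rw [SL_smul_slash]
      exact (hf'' γ).smul c

variable {Γ : Subgroup SL(2, ℤ)} {k l : ℤ} {f g : ℍ → ℂ}

lemma SF_le_MF : SF Γ k ≤ MF Γ k := fun _ hf ↦
  ⟨hf.1, hf.2.1, fun γ ↦ (hf.2.2 γ).isBoundedAtImInfty⟩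

lemma MF_mono {Γ' : Subgroup SL(2, ℤ)} (h : Γ ≤ Γ') : MF Γ' k ≤ MF Γ k := fun _ hf ↦
  ⟨hf.1, fun γ hγ ↦ hf.2.1 γ (h hγ), hf.2.2⟩

lemma MF_top_le : MF ⊤ k ≤ MF Γ k := MF_mono le_top

lemma zero_of_bounded_mul {u v : ℍ → ℂ} (hu : IsBoundedAtImInfty u) (hv : IsZeroAtImInfty v) :
    IsZeroAtImInfty (u * v) := by
  have := Asymptotics.IsBigO.mul_isLittleO (f₁ := u) (g₁ := fun _ ↦ (1 : ℝ)) (f₂ := v)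
    (g₂ := fun _ ↦ (1 : ℝ)) hu ((Asymptotics.isLittleO_one_iff ℝ).mpr hv)
  change Tendsto (fun z ↦ u z * v z) atImInfty (𝓝 0)
  simpa using this

lemma mul_MF (hf : f ∈ MF Γ k) (hg : g ∈ MF Γ l) : f * g ∈ MF Γ (k + l) := by
  refine ⟨hf.1.mul hg.1, fun γ hγ ↦ ?_, fun γ ↦ ?_⟩
  · rw [mul_slash_SL2, hf.2.1 γ hγ, hg.2.1 γ hγ]
  · rw [mul_slash_SL2]
    exact (hf.2.2 γ).mul (hg.2.2 γ)

lemma mul_MF' {m : ℤ} (hf : f ∈ MF Γ k) (hg : g ∈ MF Γ l) (h : k + l = m) : f * g ∈ MF Γ m :=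
  h ▸ mul_MF hf hg

lemma mul_SF' {m : ℤ} (hf : f ∈ MF Γ k) (hg : g ∈ SF Γ l) (h : k + l = m) : f * g ∈ SF Γ m := by
  subst h
  refine ⟨hf.1.mul hg.1, fun γ hγ ↦ ?_, fun γ ↦ ?_⟩
  · rw [mul_slash_SL2, hf.2.1 γ hγ, hg.2.1 γ hγ]
  · rw [mul_slash_SL2]
    exact zero_of_bounded_mul (hf.2.2 γ) (hg.2.2 γ)

lemma mul_SF_MF {m : ℤ} (hf : f ∈ SF Γ k) (hg : g ∈ MF Γ l) (h : k + l = m) : f * g ∈ SF Γ m := by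
  rw [mul_comm]
  exact mul_SF' hg hf (by omega)

lemma one_MF : (1 : ℍ → ℂ) ∈ MF Γ 0 := by
  refine ⟨mdifferentiable_const, fun γ _ ↦ is_invariant_one γ, fun γ ↦ ?_⟩
  rw [is_invariant_one γ]
  exact const_boundedAtFilter _ (1 : ℂ)

lemma pow_MF (hf : f ∈ MF Γ k) (n : ℕ) : f ^ n ∈ MF Γ (n * k) := by
  induction n with
  | zero => simpa using one_MF
  | succ n ih => rw [pow_succ]; exact mul_MF' ih hf (by push_cast; ring)

lemma mdiff_slash (hf : MDiff f) (k : ℤ) (γ : SL(2, ℤ)) : MDiff (f ∣[k] γ) :=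
  MDifferentiable.slash hf k _

lemma denom_ne (γ : SL(2, ℤ)) (z : ℍ) : denom γ z ≠ 0 := denom_ne_zero _ z

lemma odd_MF (h1 : -1 ∈ Γ) (hk : Odd k) (hf : f ∈ MF Γ k) : f = 0 := by
  ext z
  have h := congrFun (hf.2.1 _ h1) z
  rw [SL_slash_apply] at h
  have h2 : denom ((-1 : SL(2, ℤ)) : GL (Fin 2) ℝ) z = -1 := by simp [denom]
  rw [h2, Odd.neg_one_zpow hk.neg] at h
  have h3 : (-1 : SL(2, ℤ)) • z = z := by
    rw [ModularGroup.SL_neg_smul, one_smul]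
  rw [h3] at h
  simp only [Pi.zero_apply]
  linear_combination (-1 / 2 : ℂ) * h

lemma slash_mul_apply (k l : ℤ) (γ : SL(2, ℤ)) (f g : ℍ → ℂ) (z : ℍ) :
    ((f * g) ∣[k + l] γ) z = (f ∣[k] γ) z * (g ∣[l] γ) z := by
  rw [mul_slash_SL2]; rfl

/-- `f` is bounded away from zero near `i∞`. -/
def NZ (f : ℍ → ℂ) : Prop := ∃ c > 0, ∀ᶠ z in atImInfty, c ≤ ‖f z‖

lemma NZ_of_tendsto {c : ℂ} (hc : c ≠ 0) (h : Tendsto f atImInfty (𝓝 c)) : NZ f := by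
  refine ⟨‖c‖ / 2, by positivity, ?_⟩
  have h1 := h.norm
  have : ‖c‖ / 2 < ‖c‖ := by have := norm_pos_iff.mpr hc; linarith
  filter_upwards [h1.eventually (lt_mem_nhds this)] with z hz using hz.le

lemma quot_isBigO {u v : ℍ → ℂ} (hv : NZ v) {φ : ℍ → ℂ} (h : ∀ z, φ z * v z = u z) :
    φ =O[atImInfty] u := by
  obtain ⟨c, hc, hcv⟩ := hv
  refine Asymptotics.IsBigO.of_bound c⁻¹ ?_
  filter_upwards [hcv] with z hz
  rw [← h z, norm_mul, inv_mul_eq_div, le_div_iff₀ hc]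
  gcongr

lemma mdiffAt_div {u v : ℍ → ℂ} {z : ℍ} (hu : MDiffAt u z) (hv : MDiffAt v z) (h : v z ≠ 0) :
    MDiffAt (fun z ↦ u z / v z) z := by
  rw [UpperHalfPlane.mdifferentiableAt_iff] at *
  exact hu.fun_div hv (by simpa using h)

/-- The quotient of two proportional pairs without common zeros. -/
lemma exists_quot_fun {u v f g : ℍ → ℂ} (hu : MDiff u) (hv : MDiff v) (hf : MDiff f)
    (hg : MDiff g) (h : u * f = v * g) (h0 : ∀ z, u z ≠ 0 ∨ v z ≠ 0) :
    ∃ φ : ℍ → ℂ, MDiff φ ∧ f = φ * v ∧ g = φ * u := by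
  classical
  have hz : ∀ z, u z * f z = v z * g z := fun z ↦ congrFun h z
  refine ⟨fun z ↦ if v z = 0 then g z / u z else f z / v z, fun z ↦ ?_, ?_, ?_⟩
  · rcases eq_or_ne (v z) 0 with hvz | hvz
    · have huz : u z ≠ 0 := (h0 z).resolve_right (by simpa using hvz)
      have h2 : MDiffAt (fun z ↦ g z / u z) z :=
        mdiffAt_div (hg z) (hu z) huz
      refine h2.congr_of_eventuallyEq ?_
      filter_upwards [(hu z).continuousAt.eventually_ne huz] with w hw
      split_ifs with h3
      · rfl
      · rw [div_eq_div_iff h3 hw]; linear_combination hz w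
    · have h2 : MDiffAt (fun z ↦ f z / v z) z :=
        mdiffAt_div (hf z) (hv z) hvz
      refine h2.congr_of_eventuallyEq ?_
      filter_upwards [(hv z).continuousAt.eventually_ne hvz] with w hw
      simp [hw]
  · ext z
    simp only [Pi.mul_apply]
    split_ifs with h3
    · have huz : u z ≠ 0 := (h0 z).resolve_right (by simpa using h3)
      have := hz z
      rw [h3, zero_mul] at this
      rw [h3, mul_zero]
      exact (mul_eq_zero.mp this).resolve_left huz
    · field_simp
  · ext z
    simp only [Pi.mul_apply]
    split_ifs with h3
    · have huz : u z ≠ 0 := (h0 z).resolve_right (by simpa using h3)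
      field_simp
    · rw [div_mul_eq_mul_div, eq_div_iff h3]; linear_combination -hz z

lemma quot_slash {u v f g φ : ℍ → ℂ} {a b m : ℤ} (hu : u ∈ MF Γ a) (hv : v ∈ MF Γ b)
    (hf : f ∈ MF Γ (m + b)) (hg : g ∈ MF Γ (m + a)) (h0 : ∀ z, u z ≠ 0 ∨ v z ≠ 0)
    (h1 : f = φ * v) (h2 : g = φ * u) {γ : SL(2, ℤ)} (hγ : γ ∈ Γ) : φ ∣[m] γ = φ := by
  ext z
  have e1 := slash_mul_apply m b γ φ v z
  have e2 := slash_mul_apply m a γ φ u z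
  rw [← h1, hf.2.1 γ hγ, hv.2.1 γ hγ, h1, Pi.mul_apply] at e1
  rw [← h2, hg.2.1 γ hγ, hu.2.1 γ hγ, h2, Pi.mul_apply] at e2
  rcases h0 z with h | h
  · exact (mul_right_cancel₀ h e2).symm
  · exact (mul_right_cancel₀ h e1).symm

lemma exists_quot_MF {u v f g : ℍ → ℂ} {a b m p q : ℤ} (hu : u ∈ MF Γ a) (hv : v ∈ MF Γ b)
    (hf : f ∈ MF Γ p) (hg : g ∈ MF Γ q) (hp : p = m + b) (hq : q = m + a)
    (h : u * f = v * g) (h0 : ∀ z, u z ≠ 0 ∨ v z ≠ 0)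
    (hinf : ∀ γ : SL(2, ℤ), NZ (u ∣[a] γ) ∨ NZ (v ∣[b] γ)) :
    ∃ φ ∈ MF Γ m, f = φ * v ∧ g = φ * u := by
  subst hp hq
  obtain ⟨φ, hφ, h1, h2⟩ := exists_quot_fun hu.1 hv.1 hf.1 hg.1 h h0
  refine ⟨φ, ⟨hφ, fun γ hγ ↦ quot_slash hu hv hf hg h0 h1 h2 hγ, fun γ ↦ ?_⟩, h1, h2⟩
  rcases hinf γ with h3 | h3
  · refine (quot_isBigO h3 fun z ↦ ?_).trans (hg.2.2 γ)
    rw [h2]; exact (slash_mul_apply m a γ φ u z).symm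
  · refine (quot_isBigO h3 fun z ↦ ?_).trans (hf.2.2 γ)
    rw [h1]; exact (slash_mul_apply m b γ φ v z).symm

lemma exists_quot_SF {u v f g : ℍ → ℂ} {a b m p q : ℤ} (hu : u ∈ MF Γ a) (hv : v ∈ MF Γ b)
    (hf : f ∈ SF Γ p) (hg : g ∈ SF Γ q) (hp : p = m + b) (hq : q = m + a)
    (h : u * f = v * g) (h0 : ∀ z, u z ≠ 0 ∨ v z ≠ 0)
    (hinf : ∀ γ : SL(2, ℤ), NZ (u ∣[a] γ) ∨ NZ (v ∣[b] γ)) :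
    ∃ φ ∈ SF Γ m, f = φ * v ∧ g = φ * u := by
  subst hp hq
  obtain ⟨φ, hφ, h1, h2⟩ := exists_quot_fun hu.1 hv.1 hf.1 hg.1 h h0
  refine ⟨φ, ⟨hφ, fun γ hγ ↦ quot_slash hu hv (SF_le_MF hf) (SF_le_MF hg) h0 h1 h2 hγ,
    fun γ ↦ ?_⟩, h1, h2⟩
  rcases hinf γ with h3 | h3
  · refine (quot_isBigO h3 fun z ↦ ?_).trans_tendsto (hg.2.2 γ)
    rw [h2]; exact (slash_mul_apply m a γ φ u z).symm
  · refine (quot_isBigO h3 fun z ↦ ?_).trans_tendsto (hf.2.2 γ)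
    rw [h1]; exact (slash_mul_apply m b γ φ v z).symm

lemma mul_cancel_MF {u x y : ℍ → ℂ} (hu : MDiff u) (hx : MDiff x) (hy : MDiff y) (h0 : u ≠ 0)
    (h : u * x = u * y) : x = y := by
  have : u * (x - y) = 0 := by rw [mul_sub, h, sub_self]
  exact sub_eq_zero.mp (((UpperHalfPlane.mul_eq_zero_iff hu (hx.sub hy)).mp this).resolve_left h0)

end

section

variable {Γ : Subgroup SL(2, ℤ)} {k l : ℤ} {f g : ℍ → ℂ}

lemma coe_mem_MF {𝒢 : Subgroup (GL (Fin 2) ℝ)} [𝒢.IsArithmetic] (h : 𝒢 = Γ.map (mapGL ℝ))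
    (F : ModularForm 𝒢 k) : (F : ℍ → ℂ) ∈ MF Γ k := by
  refine ⟨F.holo', fun γ hγ ↦ ?_, fun γ ↦ ?_⟩
  · exact F.slash_action_eq' _ (h ▸ ⟨γ, hγ, rfl⟩)
  · have hc : IsCusp (mapGL ℝ γ • OnePoint.infty) 𝒮ℒ := isCusp_SL2Z_iff'.mpr ⟨γ, rfl⟩
    exact (OnePoint.isBoundedAt_iff_forall_SL2Z hc).mp
      (F.bdd_at_cusps' ((Subgroup.IsArithmetic.isCusp_iff_isCusp_SL2Z 𝒢).mpr hc)) γ rfl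

lemma exists_form {𝒢 : Subgroup (GL (Fin 2) ℝ)} [𝒢.IsArithmetic] (h : 𝒢 = Γ.map (mapGL ℝ))
    (hf : f ∈ MF Γ k) : ∃ F : ModularForm 𝒢 k, (F : ℍ → ℂ) = f := by
  refine ⟨⟨⟨f, fun g hg ↦ ?_⟩, hf.1, fun {c} hc ↦ ?_⟩, rfl⟩
  · rw [h] at hg
    obtain ⟨γ, hγ, rfl⟩ := hg
    exact hf.2.1 γ hγ
  · have hc' := (Subgroup.IsArithmetic.isCusp_iff_isCusp_SL2Z 𝒢).mp hc
    exact (OnePoint.isBoundedAt_iff_forall_SL2Z hc').mpr fun γ _ ↦ hf.2.2 γ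

lemma coe_mem_SF {𝒢 : Subgroup (GL (Fin 2) ℝ)} [𝒢.IsArithmetic] (h : 𝒢 = Γ.map (mapGL ℝ))
    (F : CuspForm 𝒢 k) : (F : ℍ → ℂ) ∈ SF Γ k := by
  refine ⟨F.holo', fun γ hγ ↦ ?_, fun γ ↦ ?_⟩
  · exact F.slash_action_eq' _ (h ▸ ⟨γ, hγ, rfl⟩)
  · have hc : IsCusp (mapGL ℝ γ • OnePoint.infty) 𝒮ℒ := isCusp_SL2Z_iff'.mpr ⟨γ, rfl⟩
    exact (OnePoint.isZeroAt_iff_forall_SL2Z hc).mp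
      (F.zero_at_cusps' ((Subgroup.IsArithmetic.isCusp_iff_isCusp_SL2Z 𝒢).mpr hc)) γ rfl

lemma SL_eq_map : 𝒮ℒ = (⊤ : Subgroup SL(2, ℤ)).map (mapGL ℝ) := MonoidHom.range_eq_map _

lemma MF_neg [Γ.FiniteIndex] (hk : k < 0) (hf : f ∈ MF Γ k) : f = 0 := by
  obtain ⟨F, rfl⟩ := exists_form (𝒢 := Γ.map (mapGL ℝ)) rfl hf
  rw [ModularForm.isZero_of_neg_weight hk F]; rfl

lemma MF_zero [Γ.FiniteIndex] (hf : f ∈ MF Γ 0) : ∃ c : ℂ, f = fun _ ↦ c := by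
  obtain ⟨F, rfl⟩ := exists_form (𝒢 := Γ.map (mapGL ℝ)) rfl hf
  exact ModularForm.eq_const_of_weight_zero F

/-- Level one forms, as functions. -/
def topEquiv (k : ℤ) : ModularForm 𝒮ℒ k ≃ₗ[ℂ] MF ⊤ k :=
  LinearEquiv.ofBijective
    { toFun := fun F ↦ ⟨F, coe_mem_MF SL_eq_map F⟩
      map_add' := fun _ _ ↦ rfl
      map_smul' := fun _ _ ↦ rfl }
    ⟨fun F G h ↦ DFunLike.coe_injective (congrArg Subtype.val h), fun f ↦ by
      obtain ⟨F, hF⟩ := exists_form SL_eq_map f.2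
      exact ⟨F, Subtype.ext hF⟩⟩

instance : FiniteDimensional ℂ (MF ⊤ k) := Module.Finite.equiv (topEquiv k)

lemma finrank_top_nat (k : ℕ) (hk : Even k) :
    Module.finrank ℂ (MF ⊤ k) = if k ≡ 2 [MOD 12] then k / 12 else k / 12 + 1 := by
  rw [← (topEquiv k).finrank_eq]
  apply Module.finrank_eq_of_rank_eq
  rw [ModularForm.dimension_level_one k hk]

lemma MF_top_neg (hk : k < 0) (hf : f ∈ MF ⊤ k) : f = 0 := MF_neg hk hf

lemma finrank_top_neg (hk : k < 0) : Module.finrank ℂ (MF ⊤ k) = 0 := by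
  rw [Submodule.finrank_eq_zero, Submodule.eq_bot_iff]
  exact fun f hf ↦ MF_top_neg hk hf

lemma MF_top_odd (hk : Odd k) (hf : f ∈ MF ⊤ k) : f = 0 := odd_MF (Subgroup.mem_top _) hk hf

/-! ### Values at infinity -/

lemma exists_T_pow_mem [Γ.FiniteIndex] (γ : SL(2, ℤ)) :
    ∃ n : ℕ, 0 < n ∧ γ * ModularGroup.T ^ n * γ⁻¹ ∈ Γ := by
  obtain ⟨n, hn, -, h⟩ := Subgroup.exists_pow_mem_of_index_ne_zero (H := Γ)
    Subgroup.FiniteIndex.index_ne_zero (γ * ModularGroup.T * γ⁻¹)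
  refine ⟨n, hn, ?_⟩
  rwa [conj_pow] at h

lemma slash_T_pow (k : ℤ) (n : ℕ) (z : ℍ) :
    (f ∣[k] (ModularGroup.T ^ n)) z = f ((n : ℝ) +ᵥ z) := by
  rw [SL_slash_apply]
  have h1 : denom ((ModularGroup.T ^ n : SL(2, ℤ)) : GL (Fin 2) ℝ) z = 1 := by
    have := ModularGroup.coe_T_zpow n
    rw [zpow_natCast] at this
    rw [ModularGroup.denom_apply, this]
    simp
  rw [h1, one_zpow, mul_one]
  congr 1
  have := UpperHalfPlane.modular_T_zpow_smul z n
  simpa using this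

lemma periodic_of_vadd {h : ℝ} (hf : ∀ z : ℍ, f (h +ᵥ z) = f z) :
    Function.Periodic (f ∘ ofComplex) h := by
  intro w
  simp only [Function.comp_apply]
  by_cases hw : 0 < w.im
  · have h2 : 0 < (w + h).im := by simpa using hw
    rw [ofComplex_apply_of_im_pos hw, ofComplex_apply_of_im_pos h2, ← hf ⟨w, hw⟩]
    congr 1
    ext
    simp [add_comm]
  · rw [ofComplex_apply_of_im_nonpos (by simpa using hw),
      ofComplex_apply_of_im_nonpos (by simpa using hw)]

lemma tendsto_valueAtInfty {h : ℝ} (hh : 0 < h) (hper : ∀ z : ℍ, f (h +ᵥ z) = f z)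
    (hf : MDiff f) (hb : IsBoundedAtImInfty f) :
    Tendsto f atImInfty (𝓝 (valueAtInfty f)) := by
  have h1 := exp_decay_sub_atImInfty hh (periodic_of_vadd hper) hf hb
  have h2 : Tendsto (fun τ : ℍ ↦ Real.exp (-2 * Real.pi * τ.im / h)) atImInfty (𝓝 0) := by
    refine Real.tendsto_exp_atBot.comp ?_
    have : Tendsto (fun τ : ℍ ↦ (2 * Real.pi / h) * τ.im) atImInfty atTop :=
      tendsto_comap.const_mul_atTop (by positivity)
    refine (tendsto_neg_atTop_atBot.comp this).congr fun τ ↦ ?_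
    simp only [Function.comp_apply]; ring
  have h3 := h1.trans_tendsto h2
  simpa using h3.add_const (valueAtInfty f)

lemma slash_periodic [Γ.FiniteIndex] (hf : ∀ γ ∈ Γ, f ∣[k] γ = f) (γ : SL(2, ℤ)) :
    ∃ n : ℕ, 0 < n ∧ ∀ z : ℍ, (f ∣[k] γ) ((n : ℝ) +ᵥ z) = (f ∣[k] γ) z := by
  obtain ⟨n, hn, h⟩ := exists_T_pow_mem (Γ := Γ) γ
  refine ⟨n, hn, fun z ↦ ?_⟩
  rw [← slash_T_pow (f := f ∣[k] γ) k n z, ← SlashAction.slash_mul]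
  have : γ * ModularGroup.T ^ n = (γ * ModularGroup.T ^ n * γ⁻¹) * γ := by group
  rw [this, SlashAction.slash_mul, hf _ h]

lemma tendsto_slash [Γ.FiniteIndex] (hf : f ∈ MF Γ k) (γ : SL(2, ℤ)) :
    Tendsto (f ∣[k] γ) atImInfty (𝓝 (valueAtInfty (f ∣[k] γ))) := by
  obtain ⟨n, hn, h⟩ := slash_periodic hf.2.1 γ
  exact tendsto_valueAtInfty (by exact_mod_cast hn) h (mdiff_slash hf.1 k γ) (hf.2.2 γ)

lemma tendsto_MF [Γ.FiniteIndex] (hf : f ∈ MF Γ k) :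
    Tendsto f atImInfty (𝓝 (valueAtInfty f)) := by
  simpa using tendsto_slash hf 1

lemma val_eq {c : ℂ} (h : Tendsto f atImInfty (𝓝 c)) : valueAtInfty f = c := h.limUnder_eq

lemma mem_SF_iff [Γ.FiniteIndex] (hf : f ∈ MF Γ k) :
    f ∈ SF Γ k ↔ ∀ γ : SL(2, ℤ), valueAtInfty (f ∣[k] γ) = 0 := by
  refine ⟨fun h γ ↦ (h.2.2 γ).valueAtInfty_eq_zero, fun h ↦ ⟨hf.1, hf.2.1, fun γ ↦ ?_⟩⟩
  have := tendsto_slash hf γ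
  rwa [h γ] at this

/-- Eisenstein series of weight four, as a function. -/
def E4 : ℍ → ℂ := (E₄ : ModularForm 𝒮ℒ 4)

/-- Eisenstein series of weight six, as a function. -/
def E6 : ℍ → ℂ := (E₆ : ModularForm 𝒮ℒ 6)

/-- The discriminant function. -/
def Dl : ℍ → ℂ := discriminant

lemma E4_mem : E4 ∈ MF ⊤ 4 := coe_mem_MF SL_eq_map E₄
lemma E6_mem : E6 ∈ MF ⊤ 6 := coe_mem_MF SL_eq_map E₆
lemma Dl_memS : Dl ∈ SF ⊤ 12 := coe_mem_SF SL_eq_map CuspForm.discriminant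
lemma Dl_mem : Dl ∈ MF ⊤ 12 := SF_le_MF Dl_memS
lemma E4_mem' : E4 ∈ MF Γ 4 := MF_top_le E4_mem
lemma E6_mem' : E6 ∈ MF Γ 6 := MF_top_le E6_mem
lemma Dl_ne (z : ℍ) : Dl z ≠ 0 := discriminant_ne_zero z
lemma Dl_eq (z : ℍ) : 1728 * Dl z = E4 z ^ 3 - E6 z ^ 2 := by
  simp only [Dl, E4, E6, discriminant_eq_E₄_cube_sub_E₆_sq]; ring

lemma E_val {k : ℕ} (hk : 3 ≤ k) (hk2 : Even k) : valueAtInfty (ModularForm.E hk) = 1 := by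
  rw [← EisensteinSeries.E_qExpansion_coeff_zero hk hk2]
  exact (qExpansion_coeff_zero one_pos (ModularFormClass.analyticAt_cuspFunction_zero _ one_pos
    one_mem_strictPeriods_SL) (SlashInvariantFormClass.periodic_comp_ofComplex _
    one_mem_strictPeriods_SL)).symm

lemma E4_tendsto : Tendsto E4 atImInfty (𝓝 1) := by
  have := tendsto_MF E4_mem
  rwa [E4, E_val _ ⟨2, rfl⟩] at this

lemma E6_tendsto : Tendsto E6 atImInfty (𝓝 1) := by
  have := tendsto_MF E6_mem
  rwa [E6, E_val _ ⟨3, rfl⟩] at this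

lemma slash_top (hf : f ∈ MF ⊤ k) (γ : SL(2, ℤ)) : f ∣[k] γ = f := hf.2.1 γ trivial

lemma ne_of_tendsto {c : ℂ} (hc : c ≠ 0) (h : Tendsto f atImInfty (𝓝 c)) : f ≠ 0 := by
  rintro rfl
  exact hc (tendsto_nhds_unique h tendsto_const_nhds)

lemma E4_ne : E4 ≠ 0 := ne_of_tendsto one_ne_zero E4_tendsto
lemma E6_ne : E6 ≠ 0 := ne_of_tendsto one_ne_zero E6_tendsto

/-- A product of Eisenstein series. -/
def EE (x y : ℕ) : ℍ → ℂ := E4 ^ x * E6 ^ y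

lemma EE_mem {x y : ℕ} (h : 4 * x + 6 * y = k) : EE x y ∈ MF ⊤ k :=
  mul_MF' (pow_MF E4_mem x) (pow_MF E6_mem y) (by linarith)

lemma EE_tendsto (x y : ℕ) : Tendsto (EE x y) atImInfty (𝓝 1) := by
  have := (E4_tendsto.pow x).mul (E6_tendsto.pow y)
  simp only [one_pow, one_mul] at this
  exact this

lemma NZ_E4 (γ : SL(2, ℤ)) : NZ (E4 ∣[(4 : ℤ)] γ) := by
  rw [slash_top E4_mem]; exact NZ_of_tendsto one_ne_zero E4_tendsto

lemma E4_E6_ne (z : ℍ) : E4 z ≠ 0 ∨ E6 z ≠ 0 := by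
  by_contra! h
  have := Dl_eq z
  rw [h.1, h.2] at this
  exact Dl_ne z (by simpa using this)

/-- `f / Δ` is a form when `f = O(Δ)` at all cusps. -/
lemma exists_div_Dl {m : ℤ} (hf : f ∈ MF Γ k) (hm : k = m + 12)
    (hO : ∀ γ : SL(2, ℤ), (f ∣[k] γ) =O[atImInfty] Dl) : ∃ g ∈ MF Γ m, f = g * Dl := by
  subst hm
  have h1 : Dl ∈ MF Γ 12 := MF_top_le Dl_mem
  obtain ⟨φ, hφ, h3, h4⟩ := exists_quot_fun (u := Dl) (v := Dl) h1.1 h1.1 hf.1 hf.1 rfl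
    (fun z ↦ Or.inl (Dl_ne z))
  refine ⟨φ, ⟨hφ, fun γ hγ ↦ quot_slash h1 h1 hf hf (fun z ↦ Or.inl (Dl_ne z)) h3 h4 hγ,
    fun γ ↦ ?_⟩, h3⟩
  obtain ⟨c, hc⟩ := (hO γ).bound
  refine Asymptotics.IsBigO.of_bound c ?_
  filter_upwards [hc] with z hz
  rw [h3, mul_slash_SL2, slash_top Dl_mem] at hz
  have : 0 < ‖Dl z‖ := norm_pos_iff.mpr (Dl_ne z)
  simp only [Pi.mul_apply, norm_mul] at hz
  simpa using le_of_mul_le_mul_right hz this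

lemma exp_O_Dl : (fun τ : ℍ ↦ Real.exp (-2 * Real.pi * τ.im)) =O[atImInfty] Dl :=
  exp_isBigO_discriminant

lemma vadd_one_top (hf : f ∈ MF ⊤ k) (z : ℍ) : f ((1 : ℝ) +ᵥ z) = f z := by
  have := slash_T_pow (f := f) k 1 z
  rw [slash_top hf] at this
  simpa using this.symm

lemma sub_val_O_Dl (hper : ∀ z : ℍ, f ((1 : ℝ) +ᵥ z) = f z) (hf : MDiff f)
    (hb : IsBoundedAtImInfty f) : (fun z ↦ f z - valueAtInfty f) =O[atImInfty] Dl := by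
  have h1 := exp_decay_sub_atImInfty one_pos (by exact_mod_cast periodic_of_vadd hper) hf hb
  simp only [div_one] at h1
  exact h1.trans exp_O_Dl

lemma exists_div_Dl_top {m : ℤ} (hf : f ∈ MF ⊤ k) (hm : k = m + 12) (h0 : valueAtInfty f = 0) :
    ∃ g ∈ MF ⊤ m, f = g * Dl := by
  refine exists_div_Dl hf hm fun γ ↦ ?_
  rw [slash_top hf]
  have := sub_val_O_Dl (vadd_one_top hf) hf.1 (by simpa using hf.2.2 1)
  simpa [h0] using this

lemma top_decomp {m : ℤ} {x y : ℕ} (hk : 4 * x + 6 * y = k) (hm : k = m + 12) (hf : f ∈ MF ⊤ k) :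
    ∃ g ∈ MF ⊤ m, f = valueAtInfty f • EE x y + g * Dl := by
  have h1 : f - valueAtInfty f • EE x y ∈ MF ⊤ k :=
    Submodule.sub_mem _ hf (Submodule.smul_mem _ _ (EE_mem hk))
  have h2 : Tendsto (f - valueAtInfty f • EE x y) atImInfty (𝓝 0) := by
    have := (tendsto_MF hf).sub ((EE_tendsto x y).const_smul (valueAtInfty f))
    rwa [smul_eq_mul, mul_one, sub_self] at this
  obtain ⟨g, hg, h⟩ := exists_div_Dl_top h1 hm (val_eq h2)
  exact ⟨g, hg, by rw [← h]; abel⟩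

lemma top_small {x y : ℕ} (hk : 4 * x + 6 * y = k) (hk' : k < 12) (hf : f ∈ MF ⊤ k) :
    f = valueAtInfty f • EE x y := by
  obtain ⟨g, hg, h⟩ := top_decomp (m := k - 12) hk (by ring) hf
  rw [MF_top_neg (by omega) hg] at h
  simpa using h

lemma MF_top_two (hf : f ∈ MF ⊤ 2) : f = 0 := by
  have h := finrank_top_nat 2 ⟨1, rfl⟩
  norm_num [Nat.ModEq] at h
  exact (Submodule.eq_bot_iff _).mp h f hf

/-- A level-one form is a constant times a power of `E6` plus a multiple of `E4`. -/
lemma top_mod_E4 (n : ℕ) : ∀ f ∈ MF ⊤ (n : ℤ), ∃ β ∈ MF ⊤ ((n : ℤ) - 4), ∃ (c : ℂ) (m : ℕ),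
    f = E4 * β + c • E6 ^ m ∧ (c ≠ 0 → n = 6 * m) := by
  induction n using Nat.strong_induction_on with
  | _ n ih =>
  intro f hf
  rcases Nat.even_or_odd n with hn | hn
  swap
  · exact ⟨0, zero_mem _, 0, 0, by rw [MF_top_odd (by exact_mod_cast hn) hf]; simp, by simp⟩
  rcases eq_or_ne n 2 with rfl | hn2
  · exact ⟨0, zero_mem _, 0, 0, by rw [MF_top_two hf]; simp, by simp⟩
  have hxy : ∃ x y : ℕ, 4 * x + 6 * y = n ∧ (x = 0 ∨ ∃ x', x = x' + 1) := by
    obtain ⟨r, rfl⟩ := hn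
    rcases Nat.even_or_odd' r with ⟨s, rfl | rfl⟩
    · exact ⟨s, 0, by omega, by cases s <;> simp⟩
    · exact ⟨s - 1, 1, by omega, by cases (s - 1) <;> simp⟩
  obtain ⟨x, y, hxy, hx⟩ := hxy
  obtain ⟨g, hg, hfg⟩ := top_decomp (m := (n : ℤ) - 12) (x := x) (y := y)
    (by exact_mod_cast hxy) (by ring) hf
  have key1 : ∃ β ∈ MF ⊤ ((n : ℤ) - 4), ∃ (c : ℂ) (m : ℕ),
      EE x y = E4 * β + c • E6 ^ m ∧ (c ≠ 0 → n = 6 * m) := by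
    rcases hx with rfl | ⟨x', rfl⟩
    · exact ⟨0, zero_mem _, 1, y, by simp [EE], by omega⟩
    · refine ⟨EE x' y, EE_mem (by omega), 0, 0, ?_, by simp⟩
      simp only [EE, pow_succ]; ring_nf; simp
  have hD : Dl = (1 / 1728 : ℂ) • (E4 ^ 3 - E6 ^ 2) := by
    ext z
    have := Dl_eq z
    simp only [Pi.smul_apply, Pi.sub_apply, Pi.pow_apply, smul_eq_mul]
    linear_combination (1 / 1728 : ℂ) * this
  have key2 : ∃ β ∈ MF ⊤ ((n : ℤ) - 4), ∃ (c : ℂ) (m : ℕ),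
      g * Dl = E4 * β + c • E6 ^ m ∧ (c ≠ 0 → n = 6 * m) := by
    rcases lt_or_ge n 12 with h12 | h12
    · exact ⟨0, zero_mem _, 0, 0, by rw [MF_top_neg (by omega) hg]; simp, by simp⟩
    · obtain ⟨n', rfl⟩ := Nat.exists_eq_add_of_le h12
      obtain ⟨β, hβ, c, m, h1, h2⟩ := ih n' (by omega) g (by convert hg using 2; push_cast; ring)
      refine ⟨(1 / 1728 : ℂ) • (E4 ^ 2 * g - E6 ^ 2 * β), Submodule.smul_mem _ _
        (Submodule.sub_mem _ (mul_MF' (pow_MF E4_mem 2) hg (by push_cast; ring))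
        (mul_MF' (pow_MF E6_mem 2) hβ (by push_cast; ring))), -(1 / 1728) * c, m + 2, ?_, ?_⟩
      · rw [hD]
        have h1' := fun z ↦ congrFun h1 z
        ext z
        have := h1' z
        simp only [Pi.add_apply, Pi.mul_apply, Pi.smul_apply, Pi.sub_apply, Pi.pow_apply,
          smul_eq_mul] at this ⊢
        linear_combination (-(1 / 1728 : ℂ)) * E6 z ^ 2 * this
      · intro hc
        have := h2 (by rintro rfl; simp at hc)
        omega
  generalize valueAtInfty f = v at hfg
  obtain ⟨β₁, hβ₁, c₁, m₁, h1, h1'⟩ := key1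
  obtain ⟨β₂, hβ₂, c₂, m₂, h2, h2'⟩ := key2
  refine ⟨v • β₁ + β₂, Submodule.add_mem _ (Submodule.smul_mem _ _ hβ₁) hβ₂, ?_⟩
  by_cases hc₁ : c₁ = 0
  · refine ⟨c₂, m₂, ?_, h2'⟩
    rw [hc₁, zero_smul, add_zero] at h1
    rw [hfg, h1, h2]
    ext z; simp; ring
  · by_cases hc₂ : c₂ = 0
    · refine ⟨v * c₁, m₁, ?_, fun h ↦ h1' hc₁⟩
      rw [hc₂, zero_smul, add_zero] at h2
      rw [hfg, h1, h2]
      ext z; simp; ring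
    · obtain rfl : m₁ = m₂ := by have := h1' hc₁; have := h2' hc₂; omega
      refine ⟨v * c₁ + c₂, m₁, ?_, fun h ↦ h1' hc₁⟩
      rw [hfg, h1, h2]
      ext z; simp; ring

end

section

variable {Γ : Subgroup SL(2, ℤ)} {k l : ℤ} {f g : ℍ → ℂ}

/-! ### Components and traces -/

/-- Left cosets. -/
abbrev Cos (Γ : Subgroup SL(2, ℤ)) := SL(2, ℤ) ⧸ Γ

instance [Γ.FiniteIndex] : Fintype (Cos Γ) := Fintype.ofFinite _

instance : DecidableEq (Cos Γ) := Classical.decEq _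

/-- The translates of a form, indexed by cosets. -/
def comp (k : ℤ) (f : ℍ → ℂ) (j : Cos Γ) : ℍ → ℂ := f ∣[k] (j.out)⁻¹

lemma comp_mk (hf : f ∈ MF Γ k) (h : SL(2, ℤ)) : comp k f (h : Cos Γ) = f ∣[k] h⁻¹ := by
  obtain ⟨γ, hγ⟩ := QuotientGroup.mk_out_eq_mul Γ h
  rw [comp, hγ, mul_inv_rev, SlashAction.slash_mul, hf.2.1 _ (inv_mem γ.2)]

lemma comp_one (hf : f ∈ MF Γ k) : comp k f ((1 : SL(2, ℤ)) : Cos Γ) = f := by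
  rw [comp_mk hf]; simp

lemma comp_slash (hf : f ∈ MF Γ k) (j : Cos Γ) (h : SL(2, ℤ)) :
    comp k f j ∣[k] h = comp k f (h⁻¹ • j) := by
  induction j using QuotientGroup.induction_on with
  | H x =>
    rw [comp_mk hf, ← SlashAction.slash_mul]
    rw [MulAction.Quotient.smul_coe, smul_eq_mul, comp_mk hf]
    congr 1; group

lemma comp_mul (f g : ℍ → ℂ) (j : Cos Γ) : comp (k + l) (f * g) j = comp k f j * comp l g j :=
  mul_slash_SL2 k l _ f g

lemma comp_mul' {m : ℤ} (h : k + l = m) (f g : ℍ → ℂ) (j : Cos Γ) :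
    comp m (f * g) j = comp k f j * comp l g j := by
  subst h; exact comp_mul f g j

lemma comp_add (f g : ℍ → ℂ) (j : Cos Γ) : comp k (f + g) j = comp k f j + comp k g j :=
  SlashAction.add_slash _ _ _ _

lemma comp_zero (j : Cos Γ) : comp k 0 j = 0 := SlashAction.zero_slash _ _

lemma comp_smul (c : ℂ) (f : ℍ → ℂ) (j : Cos Γ) : comp k (c • f) j = c • comp k f j :=
  SL_smul_slash _ _ _ _

lemma comp_sum {ι : Type*} (s : Finset ι) (F : ι → ℍ → ℂ) (j : Cos Γ) :
    comp k (∑ i ∈ s, F i) j = ∑ i ∈ s, comp k (F i) j :=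
  SlashAction.sum_slash _ _

lemma comp_top (hf : f ∈ MF ⊤ k) (j : Cos Γ) : comp k f j = f := slash_top hf _

lemma comp_mdiff (hf : MDiff f) (j : Cos Γ) : MDiff (comp k f j) := mdiff_slash hf _ _

lemma comp_pow (f : ℍ → ℂ) (n : ℕ) (j : Cos Γ) : comp (n * k) (f ^ n) j = comp k f j ^ n := by
  induction n with
  | zero => simpa [Pi.one_def] using comp_top (Γ := Γ) one_MF j
  | succ n ih =>
    rw [pow_succ, pow_succ, comp_mul' (k := n * k) (l := k) (by push_cast; ring), ih]

lemma comp_bdd (hf : f ∈ MF Γ k) (j : Cos Γ) : IsBoundedAtImInfty (comp k f j) := hf.2.2 _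

lemma eq_zero_of_power_sums {J : Type*} [Fintype J] {v x : J → ℂ} (hv : Function.Injective v)
    (h : ∀ n < Fintype.card J, ∑ j, x j * v j ^ n = 0) : x = 0 := by
  let e := Fintype.equivFin J
  have h1 : x ∘ e.symm = 0 := by
    refine Matrix.eq_zero_of_forall_pow_sum_mul_pow_eq_zero (f := v ∘ e.symm)
      (hv.comp e.symm.injective) fun i ↦ ?_
    rw [← h i i.2]
    exact e.symm.sum_comp (fun j ↦ x j * v j ^ (i : ℕ))
  ext j
  simpa using congrFun h1 (e j)

variable [Γ.FiniteIndex]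

/-- The trace to level one. -/
def tr (Γ : Subgroup SL(2, ℤ)) [Γ.FiniteIndex] (k : ℤ) (f : ℍ → ℂ) : ℍ → ℂ :=
  ∑ j : Cos Γ, comp k f j

lemma tr_slash (hf : f ∈ MF Γ k) (h : SL(2, ℤ)) : tr Γ k f ∣[k] h = tr Γ k f := by
  rw [tr, SlashAction.sum_slash]
  simp_rw [comp_slash hf]
  exact Equiv.sum_comp (MulAction.toPerm h⁻¹) (fun j : Cos Γ ↦ comp k f j)

lemma tr_mem (hf : f ∈ MF Γ k) : tr Γ k f ∈ MF ⊤ k := by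
  refine ⟨?_, fun γ _ ↦ tr_slash hf γ, fun γ ↦ ?_⟩
  · exact MDifferentiable.sum fun j _ ↦ comp_mdiff hf.1 j
  · rw [tr_slash hf, tr, IsBoundedAtImInfty, BoundedAtFilter, Finset.sum_fn]
    exact .fun_sum fun j _ ↦ hf.2.2 _

lemma tr_memS (hf : f ∈ SF Γ k) : tr Γ k f ∈ SF ⊤ k := by
  refine ⟨(tr_mem (SF_le_MF hf)).1, fun γ _ ↦ tr_slash (SF_le_MF hf) γ, fun γ ↦ ?_⟩
  rw [tr_slash (SF_le_MF hf), tr, IsZeroAtImInfty, ZeroAtFilter, Finset.sum_fn,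
    show (0 : ℂ) = ∑ c : Cos Γ, 0 by simp]
  exact tendsto_finsetSum _ fun j _ ↦ hf.2.2 _

lemma tr_add (f g : ℍ → ℂ) : tr Γ k (f + g) = tr Γ k f + tr Γ k g := by
  simp [tr, comp_add, Finset.sum_add_distrib]

lemma tr_smul (c : ℂ) (f : ℍ → ℂ) : tr Γ k (c • f) = c • tr Γ k f := by
  simp [tr, comp_smul, Finset.smul_sum]

lemma tr_sum {ι : Type*} (s : Finset ι) (F : ι → ℍ → ℂ) :
    tr Γ k (∑ i ∈ s, F i) = ∑ i ∈ s, tr Γ k (F i) := by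
  simp_rw [tr, comp_sum]
  exact Finset.sum_comm

lemma tr_mul_top {m : ℤ} (h : k + l = m) (hf : f ∈ MF ⊤ k) : tr Γ m (f * g) = f * tr Γ l g := by
  simp_rw [tr, comp_mul' h, comp_top hf, Finset.mul_sum]

/-! ### Separating forms -/

/-- The product of the differences of the components of `g`. -/
def disc (Γ : Subgroup SL(2, ℤ)) [Γ.FiniteIndex] (g : ℍ → ℂ) : ℍ → ℂ :=
  ∏ p ∈ (Finset.univ : Finset (Cos Γ)).offDiag, (comp 4 g p.1 - comp 4 g p.2)

/-- A weight four form whose components are pairwise distinct. -/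
def Sep (Γ : Subgroup SL(2, ℤ)) (g : ℍ → ℂ) : Prop :=
  g ∈ MF Γ 4 ∧ Function.Injective fun j : Cos Γ ↦ comp 4 g j

lemma disc_mdiff (hg : MDiff g) : MDiff (disc Γ g) :=
  MDifferentiable.prod fun p _ ↦ (comp_mdiff hg p.1).sub (comp_mdiff hg p.2)

lemma disc_ne (hg : Sep Γ g) : disc Γ g ≠ 0 := by
  rw [disc, Ne, UpperHalfPlane.prod_eq_zero_iff fun p _ ↦
    (comp_mdiff hg.1.1 p.1).sub (comp_mdiff hg.1.1 p.2)]
  rintro ⟨p, hp, h⟩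
  exact (Finset.mem_offDiag.mp hp).2.2 (hg.2 (sub_eq_zero.mp h))

lemma inj_of_disc {z : ℍ} (h : disc Γ g z ≠ 0) :
    Function.Injective fun j : Cos Γ ↦ comp 4 g j z := by
  intro a b hab
  by_contra hne
  apply h
  rw [disc, Finset.prod_apply]
  exact Finset.prod_eq_zero (i := (a, b)) (by simpa using hne) (sub_eq_zero.mpr hab)

lemma exists_inj (hg : Sep Γ g) : ∃ z : ℍ, Function.Injective fun j : Cos Γ ↦ comp 4 g j z := by
  obtain ⟨z, hz⟩ := Function.ne_iff.mp (disc_ne hg)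
  exact ⟨z, inj_of_disc hz⟩

/-- A form is determined by the traces of its products with powers of a separating form. -/
lemma eq_zero_of_tr (hg : Sep Γ g) (hf : f ∈ MF Γ k)
    (h : ∀ n < Fintype.card (Cos Γ), tr Γ (k + n * 4) (f * g ^ n) = 0) : f = 0 := by
  have h1 : disc Γ g * f = 0 := by
    ext z
    by_cases hz : disc Γ g z = 0
    · simp [hz]
    have := eq_zero_of_power_sums (x := fun j ↦ comp k f j z) (inj_of_disc hz) fun n hn ↦ by
      have := congrFun (h n hn) z
      simpa [tr, comp_mul, comp_pow] using this
    have h2 := congrFun this ((1 : SL(2, ℤ)) : Cos Γ)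
    rw [comp_one hf] at h2
    simp at h2
    simp [h2]
  exact ((mul_eq_zero_iff (disc_mdiff hg.1.1) hf.1).mp h1).resolve_left (disc_ne hg)

end

section

variable {Γ : Subgroup SL(2, ℤ)} {k l : ℤ} {f g : ℍ → ℂ}

/-! ### Freeness over the ring of level one forms -/

lemma finrank_top_le (hk : 0 ≤ k) : 12 * (Module.finrank ℂ (MF ⊤ k) : ℤ) ≤ k + 12 := by
  lift k to ℕ using hk
  rcases Nat.even_or_odd k with h | h
  · rw [finrank_top_nat k h]
    split_ifs <;> omega
  · have : MF ⊤ (k : ℤ) = ⊥ :=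
      (Submodule.eq_bot_iff _).mpr fun f hf ↦ MF_top_odd (by exact_mod_cast h) hf
    rw [this, finrank_bot]
    omega

lemma le_finrank_top (hk : Even k) : k - 2 ≤ 12 * (Module.finrank ℂ (MF ⊤ k) : ℤ) := by
  rcases lt_or_ge k 0 with h | h
  · omega
  · lift k to ℕ using h
    rw [finrank_top_nat k (by exact_mod_cast hk)]
    split_ifs with h
    · have : k % 12 = 2 := h
      omega
    · omega

lemma top_mod_E4' (hf : f ∈ MF ⊤ k) : ∃ β ∈ MF ⊤ (k - 4), ∃ (c : ℂ) (m : ℕ),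
    f = E4 * β + c • E6 ^ m ∧ (c ≠ 0 → k = 6 * m) := by
  rcases lt_or_ge k 0 with h | h
  · exact ⟨0, zero_mem _, 0, 0, by rw [MF_top_neg h hf]; simp, by simp⟩
  · lift k to ℕ using h
    obtain ⟨β, hβ, c, m, h1, h2⟩ := top_mod_E4 k f hf
    exact ⟨β, hβ, c, m, h1, fun hc ↦ by exact_mod_cast h2 hc⟩

/-- The combination map attached to a family of forms. -/
def lin {ι : Type*} [Fintype ι] {a : ι → ℤ} {e : ι → ℍ → ℂ} (he : ∀ i, e i ∈ MF Γ (a i)) (k : ℤ) :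
    (Π i, MF ⊤ (k - a i)) →ₗ[ℂ] MF Γ k where
  toFun α := ⟨∑ i, (α i : ℍ → ℂ) * e i, Submodule.sum_mem _ fun i _ ↦
    mul_MF' (MF_top_le (α i).2) (he i) (by ring)⟩
  map_add' α β := by
    ext1
    simp [add_mul, Finset.sum_add_distrib]
  map_smul' c α := by
    ext1
    simp [Finset.smul_sum]

/-- Homogeneous free bases of the forms for `Γ` over the forms of level one. -/
structure FB (Γ : Subgroup SL(2, ℤ)) {ι : Type*} [Fintype ι] (a : ι → ℤ) (e : ι → ℍ → ℂ) :
    Prop where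
  mem : ∀ i, e i ∈ MF Γ (a i)
  gen : ∀ {k : ℤ} {f : ℍ → ℂ}, f ∈ MF Γ k →
    ∃ α : ι → ℍ → ℂ, (∀ i, α i ∈ MF ⊤ (k - a i)) ∧ f = ∑ i, α i * e i
  indep : ∀ {k : ℤ} {α : ι → ℍ → ℂ}, (∀ i, α i ∈ MF ⊤ (k - a i)) → ∑ i, α i * e i = 0 →
    ∀ i, α i = 0

/-- Independence modulo the ideal of positive weight level one forms. -/
structure Indep (Γ : Subgroup SL(2, ℤ)) (n : ℕ) (a : Fin n → ℤ) (e : Fin n → ℍ → ℂ) : Prop where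
  mem : ∀ i, e i ∈ MF Γ (a i)
  indep : ∀ (k : ℤ) (c : Fin n → ℂ), ∀ x ∈ MF Γ (k - 4), ∀ y ∈ MF Γ (k - 6),
    (∀ i, c i ≠ 0 → a i = k) → ∑ i, c i • e i = E4 * x + E6 * y → c = 0

/-- `E6 ^ m` is regular modulo `E4`. -/
lemma regular_E6 {x y : ℍ → ℂ} {m : ℕ} (hx : x ∈ MF Γ k) (hy : y ∈ MF Γ l)
    (hl : l = k + 6 * m - 4) (h : E6 ^ m * x = E4 * y) : ∃ z ∈ MF Γ (k - 4), x = E4 * z := by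
  obtain ⟨φ, hφ, h1, h2⟩ := exists_quot_MF (m := k - 4) (pow_MF (Γ := Γ) E6_mem' m) E4_mem' hx hy
    (by ring) (by rw [hl]; ring) h (fun z ↦ by
      rcases E4_E6_ne z with h | h
      · exact Or.inr h
      · exact Or.inl (pow_ne_zero m h)) fun γ ↦ Or.inr (NZ_E4 γ)
  exact ⟨φ, hφ, by rw [h1, mul_comm]⟩

lemma Indep.ne {n : ℕ} {a : Fin n → ℤ} {e : Fin n → ℍ → ℂ} (h : Indep Γ n a e) (i : Fin n) :
    e i ≠ 0 := by
  intro hi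
  have := h.indep (a i) (Pi.single i 1) 0 (zero_mem _) 0 (zero_mem _) (fun j hj ↦ by
    by_contra hne
    exact hj (Pi.single_eq_of_ne (by rintro rfl; exact hne rfl) _)) (by
    simp only [mul_zero, add_zero]
    refine Finset.sum_eq_zero fun j _ ↦ ?_
    rcases eq_or_ne j i with rfl | hne
    · simp [hi]
    · simp [hne])
  simpa using congrFun this i

/-- The matrix of components of a family of forms. -/
def FM {ι : Type*} (a : ι → ℤ) (e : ι → ℍ → ℂ) (z : ℍ) : Matrix ι (Cos Γ) ℂ :=
  fun i j ↦ comp (a i) (e i) j z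

lemma comp_comb {ι : Type*} [Fintype ι] {a : ι → ℤ} {e α : ι → ℍ → ℂ}
    (hα : ∀ i, α i ∈ MF ⊤ (k - a i)) (j : Cos Γ) (z : ℍ) :
    comp k (∑ i, α i * e i) j z = ∑ i, α i z * FM (Γ := Γ) a e z i j := by
  rw [comp_sum, Finset.sum_apply]
  refine Finset.sum_congr rfl fun i _ ↦ ?_
  rw [comp_mul' (k := k - a i) (l := a i) (by ring), comp_top (hα i)]
  rfl

variable [Γ.FiniteIndex]

lemma Indep.nonneg {n : ℕ} {a : Fin n → ℤ} {e : Fin n → ℍ → ℂ} (h : Indep Γ n a e) (i : Fin n) :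
    0 ≤ a i := by
  by_contra! hneg
  exact h.ne i (MF_neg hneg (h.mem i))

lemma Indep.top_indep {n : ℕ} {a : Fin n → ℤ} {e : Fin n → ℍ → ℂ} (h : Indep Γ n a e) {k : ℤ}
    {α : Fin n → ℍ → ℂ} (hα : ∀ i, α i ∈ MF ⊤ (k - a i)) (h0 : ∑ i, α i * e i = 0) :
    ∀ i, α i = 0 := by
  obtain ⟨K, hK⟩ : ∃ K : ℕ, k < K := ⟨(k + 1).toNat, by omega⟩
  induction K generalizing k α with
  | zero => exact fun i ↦ MF_top_neg (by have := h.nonneg i; simp at hK; omega) (hα i)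
  | succ K ih =>
  choose β hβ c m h1 h2 using fun i ↦ top_mod_E4' (hα i)
  have hc : ∀ i, c i = 0 := by
    by_contra! hne
    obtain ⟨i0, hi0, hmin⟩ := Set.exists_min_image {i | c i ≠ 0} m (Set.toFinite _) hne
    have hi0' := h2 i0 hi0
    have hmem : ∀ i (t : ℕ) (w : ℤ), (c i ≠ 0 → w = 6 * t + a i) →
        c i • (E6 ^ t * e i) ∈ MF Γ w := by
      intro i t w hw
      by_cases hci : c i = 0
      · simp [hci]
      · exact Submodule.smul_mem _ _ (mul_MF' (pow_MF E6_mem' t) (h.mem i)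
          (by rw [hw hci]; ring))
    have hX : ∑ i, c i • (E6 ^ (m i - m i0) * e i) ∈ MF Γ (a i0) :=
      Submodule.sum_mem _ fun i _ ↦ hmem i _ _ fun hci ↦ by
        have := h2 i hci; have := hmin i hci; omega
    obtain ⟨z, hz, hz'⟩ := regular_E6 (m := m i0) hX (y := -∑ i, β i * e i) (l := k - 4)
      (neg_mem (Submodule.sum_mem _ fun i _ ↦ mul_MF' (MF_top_le (hβ i)) (h.mem i) (by ring)))
      (by omega) (by
        rw [mul_neg, eq_neg_iff_add_eq_zero, Finset.mul_sum, Finset.mul_sum,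
          ← Finset.sum_add_distrib, ← h0]
        refine Finset.sum_congr rfl fun i _ ↦ ?_
        by_cases hci : c i = 0
        · rw [h1 i, hci]; simp [mul_assoc]
        · rw [h1 i]
          have : E6 ^ (m i) = E6 ^ (m i0) * E6 ^ (m i - m i0) := by
            rw [← pow_add, Nat.add_sub_cancel' (hmin i hci)]
          rw [this]
          ext w; simp; ring)
    have := h.indep (a i0) (fun i ↦ if m i = m i0 then c i else 0) z hz
      (-∑ i, (if m i = m i0 then 0 else c i • (E6 ^ (m i - m i0 - 1) * e i)))
      (neg_mem (Submodule.sum_mem _ fun i _ ↦ by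
        split_ifs with hm
        · exact zero_mem _
        · exact hmem i _ _ fun hci ↦ by
            have := h2 i hci; have := hmin i hci; omega))
      (fun i hi ↦ by
        have : m i = m i0 ∧ c i ≠ 0 := by simpa using hi
        have h3 := h2 i this.2
        rw [this.1] at h3
        omega)
      (by
        rw [← hz', mul_neg, ← sub_eq_add_neg, Finset.mul_sum, ← Finset.sum_sub_distrib]
        refine Finset.sum_congr rfl fun i _ ↦ ?_
        by_cases hci : c i = 0
        · simp [hci]
        split_ifs with hm
        · simp [hm]
        · have : m i - m i0 = (m i - m i0 - 1) + 1 := by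
            have := hmin i hci; omega
          conv_rhs => rw [this]
          ext w; simp; ring)
    have h3 := congrFun this i0
    simp only [if_true] at h3
    exact hi0 h3
  have h1' : ∀ i, α i = E4 * β i := fun i ↦ by rw [h1 i, hc i]; simp
  have := ih (k := k - 4) (α := β) (fun i ↦ by convert hβ i using 1; ring_nf) (by
    have h3 : E4 * ∑ i, β i * e i = 0 := by
      rw [← h0, Finset.mul_sum]
      exact Finset.sum_congr rfl fun i _ ↦ by rw [h1' i, mul_assoc]
    refine ((mul_eq_zero_iff E4_mem.1 ?_).mp h3).resolve_left E4_ne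
    exact MDifferentiable.sum fun i _ ↦ (hβ i).1.mul (h.mem i).1) (by push_cast at hK; omega)
  intro i
  rw [h1' i, this i, mul_zero]

lemma Indep.lin_inj {n : ℕ} {a : Fin n → ℤ} {e : Fin n → ℍ → ℂ} (h : Indep Γ n a e) (k : ℤ) :
    Function.Injective (lin h.mem k) := by
  rw [injective_iff_map_eq_zero]
  intro α hα
  ext1 i
  ext1
  exact h.top_indep (α := fun i ↦ α i) (fun i ↦ (α i).2) (congrArg Subtype.val hα) i

/-- The map recording traces of products with powers of `g`. -/
def trMap (hg : g ∈ MF Γ 4) (k : ℤ) :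
    MF Γ k →ₗ[ℂ] Π n : Fin (Fintype.card (Cos Γ)), MF ⊤ (k + (n : ℕ) * 4) where
  toFun f n := ⟨tr Γ (k + (n : ℕ) * 4) (f * g ^ (n : ℕ)), tr_mem (mul_MF f.2 (pow_MF hg _))⟩
  map_add' x y := by
    ext1 n; ext1
    simp [add_mul, tr_add]
  map_smul' c x := by
    ext1 n; ext1
    simp [tr_smul]

lemma trMap_inj (hg : Sep Γ g) (k : ℤ) : Function.Injective (trMap hg.1 k) := by
  rw [injective_iff_map_eq_zero]
  intro f hf
  ext1
  exact eq_zero_of_tr hg f.2 fun n hn ↦ congrArg Subtype.val (congrFun hf ⟨n, hn⟩)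

lemma finite_MF (hg : Sep Γ g) (k : ℤ) : FiniteDimensional ℂ (MF Γ k) :=
  Module.Finite.of_injective _ (trMap_inj hg k)

lemma Indep.le_card {n : ℕ} {a : Fin n → ℤ} {e : Fin n → ℍ → ℂ} (h : Indep Γ n a e)
    (h1 : -1 ∈ Γ) (hg : Sep Γ g) : n ≤ Fintype.card (Cos Γ) := by
  have key : ∀ K : ℕ, ∑ i, Module.finrank ℂ (MF ⊤ ((12 * K : ℤ) - a i)) ≤
      ∑ i : Fin (Fintype.card (Cos Γ)), Module.finrank ℂ (MF ⊤ ((12 * K : ℤ) + (i : ℕ) * 4)) := by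
    intro K
    rw [← Module.finrank_pi_fintype, ← Module.finrank_pi_fintype]
    have := finite_MF hg
    exact (LinearMap.finrank_le_finrank_of_injective (h.lin_inj _)).trans
      (LinearMap.finrank_le_finrank_of_injective (trMap_inj hg _))
  have ev : ∀ i, Even (a i) := fun i ↦ by
    rw [← Int.not_odd_iff_even]
    exact fun hodd ↦ h.ne i (odd_MF h1 hodd (h.mem i))
  set μ := Fintype.card (Cos Γ)
  have key2 : ∀ K : ℕ, n * (12 * K : ℤ) - ∑ i, (a i + 2) ≤
      μ * (12 * K : ℤ) + ∑ i : Fin μ, (((i : ℕ) * 4 : ℤ) + 12) := by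
    intro K
    have h2 : ∑ i, ((12 * K : ℤ) - a i - 2) ≤
        ∑ i, 12 * (Module.finrank ℂ (MF ⊤ ((12 * K : ℤ) - a i)) : ℤ) :=
      Finset.sum_le_sum fun i _ ↦ le_finrank_top (Even.sub ⟨6 * K, by ring⟩ (ev i))
    have h3 : ∑ i : Fin μ, 12 * (Module.finrank ℂ (MF ⊤ ((12 * K : ℤ) + (i : ℕ) * 4)) : ℤ) ≤
        ∑ i : Fin μ, ((12 * K : ℤ) + (i : ℕ) * 4 + 12) :=
      Finset.sum_le_sum fun i _ ↦ finrank_top_le (by positivity)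
    have h4 := key K
    rw [← Finset.mul_sum] at h2 h3
    zify at h4
    simp only [Finset.sum_sub_distrib, Finset.sum_add_distrib, Finset.sum_const,
      Finset.card_univ, Fintype.card_fin, nsmul_eq_mul] at h2 h3 ⊢
    linarith
  by_contra! hlt
  set C := ∑ i : Fin μ, (((i : ℕ) * 4 : ℤ) + 12) + ∑ i, (a i + 2)
  have h5 := key2 (C.toNat + 1)
  have h6 : (μ : ℤ) + 1 ≤ n := by exact_mod_cast hlt
  push_cast at h5
  have h7 : C ≤ C.toNat := Int.self_le_toNat C
  nlinarith

lemma Indep.gen {n : ℕ} {a : Fin n → ℤ} {e : Fin n → ℍ → ℂ} (h : Indep Γ n a e)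
    (hmax : ¬ ∃ a' e', Indep Γ (n + 1) a' e') {k : ℤ} {f : ℍ → ℂ} (hf : f ∈ MF Γ k) :
    ∃ α : Fin n → ℍ → ℂ, (∀ i, α i ∈ MF ⊤ (k - a i)) ∧ f = ∑ i, α i * e i := by
  obtain ⟨K, hK⟩ : ∃ K : ℕ, k < K := ⟨(k + 1).toNat, by omega⟩
  induction K generalizing k f with
  | zero => exact ⟨0, fun i ↦ zero_mem _, by rw [MF_neg (by simpa using hK) hf]; simp⟩
  | succ K ih =>
  have h1 : ¬ Indep Γ (n + 1) (Fin.cons k a) (Fin.cons f e) := fun h ↦ hmax ⟨_, _, h⟩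
  obtain ⟨k', c, x, hx, y, hy, hc, hs, hne⟩ : ∃ (k' : ℤ) (c : Fin (n + 1) → ℂ),
      ∃ x ∈ MF Γ (k' - 4), ∃ y ∈ MF Γ (k' - 6), (∀ i, c i ≠ 0 → (Fin.cons k a : _ → ℤ) i = k') ∧
      ∑ i, c i • (Fin.cons f e : _ → ℍ → ℂ) i = E4 * x + E6 * y ∧ c ≠ 0 := by
    by_contra! hcon
    exact h1 ⟨Fin.cases hf h.mem, hcon⟩
  rw [Fin.sum_univ_succ] at hs
  simp only [Fin.cons_zero, Fin.cons_succ] at hs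
  have hc0 : c 0 ≠ 0 := by
    intro hc0
    have h2 := h.indep k' (fun i ↦ c i.succ) x hx y hy (fun i hi ↦ by simpa using hc i.succ hi)
      (by simpa [hc0] using hs)
    apply hne
    ext i
    induction i using Fin.cases with
    | zero => exact hc0
    | succ i => exact congrFun h2 i
  obtain rfl : k = k' := by simpa using hc 0 hc0
  obtain ⟨β, hβ, rfl⟩ := ih hx (by push_cast at hK; omega)
  obtain ⟨δ, hδ, rfl⟩ := ih hy (by push_cast at hK; omega)
  refine ⟨fun i ↦ (c 0)⁻¹ • (E4 * β i + E6 * δ i - fun _ ↦ c i.succ), fun i ↦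
    Submodule.smul_mem _ _ (Submodule.sub_mem _ (Submodule.add_mem _
      (mul_MF' E4_mem (hβ i) (by ring)) (mul_MF' E6_mem (hδ i) (by ring))) ?_), ?_⟩
  · by_cases hci : c i.succ = 0
    · rw [hci]; exact zero_mem _
    · have h3 : k - a i = 0 := by
        have := hc i.succ hci
        rw [Fin.cons_succ] at this
        omega
      rw [h3]
      have := Submodule.smul_mem _ (c i.succ) (one_MF (Γ := ⊤))
      convert this using 1
      ext; simp
  · have h2 : f = (c 0)⁻¹ • (c 0 • f) := by rw [smul_smul, inv_mul_cancel₀ hc0, one_smul]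
    rw [h2, eq_sub_of_add_eq hs, Finset.mul_sum, Finset.mul_sum, ← Finset.sum_add_distrib,
      ← Finset.sum_sub_distrib, Finset.smul_sum]
    refine Finset.sum_congr rfl fun i _ ↦ ?_
    ext w; simp; ring

lemma FM_inj {ι : Type*} [Fintype ι] {a : ι → ℤ} {e : ι → ℍ → ℂ}
    (hgen : ∀ {k : ℤ} {f : ℍ → ℂ}, f ∈ MF Γ k →
      ∃ α : ι → ℍ → ℂ, (∀ i, α i ∈ MF ⊤ (k - a i)) ∧ f = ∑ i, α i * e i) (hg : Sep Γ g) {z : ℍ}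
    (hz : Function.Injective fun j : Cos Γ ↦ comp 4 g j z) {c : Cos Γ → ℂ}
    (hc : (FM a e z).mulVec c = 0) : c = 0 := by
  refine eq_zero_of_power_sums hz fun n _ ↦ ?_
  obtain ⟨α, hα, h⟩ := hgen (pow_MF hg.1 n)
  have : ∀ j : Cos Γ, comp 4 g j z ^ n = ∑ i, α i z * FM (Γ := Γ) a e z i j := fun j ↦ by
    rw [← comp_comb hα, ← h, comp_pow]; rfl
  simp_rw [this, Finset.mul_sum]
  rw [Finset.sum_comm]
  refine Finset.sum_eq_zero fun i _ ↦ ?_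
  have := congrFun hc i
  simp only [Matrix.mulVec, dotProduct, Pi.zero_apply] at this
  rw [← mul_zero (α i z), ← this, Finset.mul_sum]
  exact Finset.sum_congr rfl fun j _ ↦ by ring

theorem exists_FB (h1 : -1 ∈ Γ) (hg : Sep Γ g) :
    ∃ (a : Cos Γ → ℤ) (e : Cos Γ → ℍ → ℂ), FB Γ a e ∧ (∀ i, e i ≠ 0) := by
  obtain ⟨n, ⟨a, e, h⟩, hmax⟩ : ∃ n : ℕ, (∃ a e, Indep Γ n a e) ∧
      ¬ ∃ a e, Indep Γ (n + 1) a e := by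
    by_contra! hcon
    have : ∀ n : ℕ, ∃ a e, Indep Γ n a e := by
      intro n
      induction n with
      | zero => exact ⟨Fin.elim0, Fin.elim0, fun i ↦ i.elim0, fun _ _ _ _ _ _ _ _ ↦
          Subsingleton.elim _ _⟩
      | succ n ih =>
        obtain ⟨a, e, h⟩ := ih
        exact hcon n ⟨a, e, h⟩
    obtain ⟨a, e, h⟩ := this (Fintype.card (Cos Γ) + 1)
    exact absurd (h.le_card h1 hg) (by omega)
  have hn : n = Fintype.card (Cos Γ) := by
    refine le_antisymm (h.le_card h1 hg) ?_
    obtain ⟨z, hz⟩ := exists_inj hg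
    have hinj : Function.Injective (Matrix.mulVecLin (FM (Γ := Γ) a e z)) := by
      rw [injective_iff_map_eq_zero]
      exact fun c hc ↦ FM_inj (h.gen hmax) hg hz hc
    simpa using LinearMap.finrank_le_finrank_of_injective hinj
  let q : Cos Γ ≃ Fin n := (Fintype.equivFin _).trans (finCongr hn.symm)
  refine ⟨a ∘ q, e ∘ q, ⟨fun i ↦ h.mem _, fun {k f} hf ↦ ?_, fun {k α} hα h0 i ↦ ?_⟩,
    fun i ↦ h.ne _⟩
  · obtain ⟨α, hα, h2⟩ := h.gen hmax hf
    exact ⟨α ∘ q, fun i ↦ hα _, by rw [h2]; exact (q.sum_comp fun i ↦ α i * e i).symm⟩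
  · have := h.top_indep (α := α ∘ q.symm) (k := k) (fun i ↦ by simpa using hα (q.symm i)) (by
      rw [← h0, ← q.sum_comp]; simp) (q i)
    simpa using this

end

section

open Derivative

variable {Γ : Subgroup SL(2, ℤ)} {k l : ℤ} {f g : ℍ → ℂ}

/-! ### Invertibility of the matrix of components -/

lemma deriv_bdd (hf : MDiff f) (hb : IsBoundedAtImInfty f) :
    IsBoundedAtImInfty (normalizedDerivOfComplex f) := by
  rw [isBoundedAtImInfty_iff] at hb ⊢
  obtain ⟨M, A, h⟩ := hb
  refine ⟨‖(2 * Real.pi * Complex.I : ℂ)⁻¹‖ * (M / 1), max A 0 + 2, fun z hz ↦ ?_⟩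
  rw [normalizedDerivOfComplex, norm_mul]
  gcongr
  have hA : A ≤ max A 0 := le_max_left _ _
  have hA0 : 0 ≤ max A 0 := le_max_right _ _
  have him : ∀ w ∈ Metric.closedBall (z : ℂ) 1, max A 0 + 1 ≤ w.im := by
    intro w hw
    rw [mem_closedBall_iff_norm] at hw
    have h1 := (Complex.abs_im_le_norm (w - z)).trans hw
    have h2 := (abs_le.mp h1).1
    simp only [Complex.sub_im, coe_im] at h2
    linarith
  have hd : DifferentiableOn ℂ (f ∘ ofComplex) (Metric.closedBall (z : ℂ) 1) := by
    refine (UpperHalfPlane.mdifferentiable_iff.mp hf).mono fun w hw ↦ ?_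
    have := him w hw
    exact lt_of_lt_of_le (by linarith) this
  refine Complex.norm_deriv_le_of_forall_mem_sphere_norm_le one_pos
    (hd.diffContOnCl_ball subset_rfl) fun w hw ↦ ?_
  have h1 := him w (Metric.sphere_subset_closedBall hw)
  have h0 : 0 < w.im := by linarith
  rw [Function.comp_apply, ofComplex_apply_of_im_pos h0]
  exact h _ (by change A ≤ w.im; linarith)

lemma serre_bdd (hf : MDiff f) (hb : IsBoundedAtImInfty f) :
    IsBoundedAtImInfty (serreDerivative k f) := by
  rw [serreDerivative_eq]
  have h1 := deriv_bdd hf hb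
  have h2 : IsBoundedAtImInfty (EisensteinSeries.E2 * f) :=
    EisensteinSeries.isBoundedAtImInfty_E2.mul hb
  have h3 := h1.sub (Asymptotics.IsBigO.const_mul_left h2 ((k : ℂ) * 12⁻¹))
  refine h3.congr_left fun z ↦ ?_
  simp [mul_assoc]

lemma serre_mem (hf : f ∈ MF Γ k) : serreDerivative k f ∈ MF Γ (k + 2) := by
  refine ⟨serreDerivative_mdifferentiable _ hf.1, fun γ hγ ↦ ?_, fun γ ↦ ?_⟩
  · rw [serreDerivative_slash_equivariant hf.1, hf.2.1 γ hγ]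
  · rw [serreDerivative_slash_equivariant hf.1]
    exact serre_bdd (mdiff_slash hf.1 _ _) (hf.2.2 γ)

lemma comp_serre (hf : MDiff f) (j : Cos Γ) :
    comp (k + 2) (serreDerivative k f) j = serreDerivative k (comp k f j) :=
  serreDerivative_slash_equivariant hf

lemma hasDerivAt_serre (k : ℂ) (hf : MDiff f) (z : ℍ) : HasDerivAt (f ∘ ofComplex)
    (2 * Real.pi * Complex.I * (serreDerivative k f z + k * 12⁻¹ * EisensteinSeries.E2 z * f z))
    (z : ℂ) := by
  have h1 : DifferentiableAt ℂ (f ∘ ofComplex) z := UpperHalfPlane.mdifferentiableAt_iff.mp (hf z)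
  have h2 : 2 * Real.pi * Complex.I *
      (serreDerivative k f z + k * 12⁻¹ * EisensteinSeries.E2 z * f z) =
      deriv (f ∘ ofComplex) z := by
    rw [serreDerivative_apply, sub_add_cancel, normalizedDerivOfComplex, ← mul_assoc,
      mul_inv_cancel₀ Complex.two_pi_I_ne_zero, one_mul]
  rw [h2]
  exact h1.hasDerivAt

/-- A solution of a homogeneous linear system on the upper half plane vanishing at a point
vanishes identically. -/
lemma linear_system_zero {ι : Type*} [Fintype ι] {G : ι → ℍ → ℂ} {M : ι → ι → ℍ → ℂ}
    (hM : ∀ i l, Continuous (M i l))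
    (hG : ∀ i z, HasDerivAt (G i ∘ ofComplex) (∑ l, M i l z * G l z) (z : ℂ)) {z₀ : ℍ}
    (h0 : ∀ i, G i z₀ = 0) (z₁ : ℍ) (i : ι) : G i z₁ = 0 := by
  let p : ℝ → ℂ := fun t ↦ z₀ + t * (z₁ - z₀)
  have him : ∀ t ∈ Set.Icc (0 : ℝ) 1, 0 < (p t).im := by
    intro t ht
    simp only [p, Complex.add_im, coe_im, Complex.mul_im, Complex.ofReal_re, Complex.sub_im,
      Complex.ofReal_im, zero_mul, add_zero]
    rcases eq_or_lt_of_le ht.1 with h | h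
    · rw [← h]; simpa using z₀.im_pos
    · nlinarith [mul_pos h z₁.im_pos, mul_nonneg (sub_nonneg.mpr ht.2) z₀.im_pos.le]
  have hp : Continuous p := by fun_prop
  have hpc : ContinuousOn (fun t ↦ ofComplex (p t)) (Set.Icc 0 1) := by
    intro t ht
    exact ((contMDiffAt_ofComplex (n := 0) (him t ht)).continuousAt.comp
      hp.continuousAt).continuousWithinAt
  have hofp : ∀ t ∈ Set.Icc (0 : ℝ) 1, ((ofComplex (p t) : ℍ) : ℂ) = p t := fun t ht ↦ by
    rw [ofComplex_apply_of_im_pos (him t ht)]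
  have hcont : ContinuousOn (fun t ↦ ‖(z₁ - z₀ : ℂ)‖ * ∑ i, ∑ l, ‖M i l (ofComplex (p t))‖)
      (Set.Icc 0 1) := by
    refine continuousOn_const.mul (continuousOn_finsetSum _ fun i _ ↦
      continuousOn_finsetSum _ fun l _ ↦ ?_)
    exact ((hM i l).comp_continuousOn hpc).norm
  obtain ⟨K, hK⟩ := isCompact_Icc.exists_bound_of_continuousOn hcont
  have hder : ∀ t ∈ Set.Icc (0 : ℝ) 1, HasDerivAt (fun t i ↦ G i (ofComplex (p t)))
      (fun i ↦ (z₁ - z₀ : ℂ) * ∑ l, M i l (ofComplex (p t)) * G l (ofComplex (p t))) t := by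
    intro t ht
    rw [hasDerivAt_pi]
    intro i
    have h1 := hG i (ofComplex (p t))
    rw [hofp t ht] at h1
    have h2 : HasDerivAt p (z₁ - z₀ : ℂ) t := by
      have := ((hasDerivAt_id t).ofReal_comp.mul_const (z₁ - z₀ : ℂ)).const_add (z₀ : ℂ)
      simpa [p] using this
    rw [mul_comm]
    exact h1.comp t h2
  have := eq_zero_of_abs_deriv_le_mul_abs_self_of_eq_zero_right (a := 0) (b := 1) (K := K)
    (f := fun t i ↦ G i (ofComplex (p t)))
    (fun t ht ↦ (hder t ht).continuousAt.continuousWithinAt)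
    (fun t ht ↦ (hder t (Set.Ico_subset_Icc_self ht)).hasDerivWithinAt)
    (by ext i; simpa [p] using h0 i) (fun t ht ↦ by
      have hk := (le_abs_self _).trans (hK t (Set.Ico_subset_Icc_self ht))
      have hk0 : 0 ≤ K := (norm_nonneg _).trans (hK t (Set.Ico_subset_Icc_self ht))
      rw [pi_norm_le_iff_of_nonneg (by positivity)]
      intro i
      set v : ι → ℂ := fun i ↦ G i (ofComplex (p t))
      calc ‖(z₁ - z₀ : ℂ) * ∑ l, M i l (ofComplex (p t)) * v l‖
          ≤ ‖(z₁ - z₀ : ℂ)‖ * ∑ l, ‖M i l (ofComplex (p t))‖ * ‖v‖ := by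
            rw [norm_mul]
            gcongr
            refine (norm_sum_le _ _).trans (Finset.sum_le_sum fun l _ ↦ ?_)
            rw [norm_mul]
            gcongr
            exact norm_le_pi_norm v l
        _ ≤ ‖(z₁ - z₀ : ℂ)‖ * (∑ i, ∑ l, ‖M i l (ofComplex (p t))‖) * ‖v‖ := by
            rw [← Finset.sum_mul, ← mul_assoc]
            refine mul_le_mul_of_nonneg_right (mul_le_mul_of_nonneg_left ?_ (norm_nonneg _))
              (norm_nonneg _)
            exact Finset.single_le_sum
              (f := fun i ↦ ∑ l, ‖M i l (ofComplex (p t))‖)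
              (fun i _ ↦ Finset.sum_nonneg fun l _ ↦ norm_nonneg _) (Finset.mem_univ i)
        _ ≤ K * ‖v‖ := by gcongr) 1 (by simp)
  have h2 := congrFun this i
  simpa [p] using h2

variable [Γ.FiniteIndex]

theorem FB.mulVec_inj {ι : Type*} [Fintype ι] [DecidableEq ι] {a : ι → ℤ} {e : ι → ℍ → ℂ}
    (h : FB Γ a e) (hg : Sep Γ g) {z : ℍ} {c : Cos Γ → ℂ} (hc : (FM a e z).mulVec c = 0) :
    c = 0 := by
  obtain ⟨w, hw⟩ := exists_inj hg
  refine FM_inj h.gen hg hw ?_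
  choose α hα hα' using fun i ↦ h.gen (serre_mem (h.mem i))
  let M : ι → ι → ℍ → ℂ := fun i l z ↦ 2 * Real.pi * Complex.I *
    (α i l z + if l = i then (a i : ℂ) * 12⁻¹ * EisensteinSeries.E2 z else 0)
  ext i
  refine linear_system_zero (G := fun i z ↦ (FM a e z).mulVec c i) (M := M) ?_ ?_
    (z₀ := z) (fun i ↦ congrFun hc i) w i
  · intro i l
    refine continuous_const.mul ((hα i l).1.continuous.add ?_)
    split_ifs
    · exact continuous_const.mul E2_mdifferentiable.continuous
    · exact continuous_const
  · intro i z
    have h1 : ∀ j : Cos Γ, HasDerivAt (comp (a i) (e i) j ∘ ofComplex)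
        (∑ l, M i l z * FM (Γ := Γ) a e z l j) (z : ℂ) := by
      intro j
      have h3 := hasDerivAt_serre (a i : ℂ) (comp_mdiff (k := a i) (h.mem i).1 j) z
      rw [← comp_serre (h.mem i).1, hα' i, comp_comb (hα i)] at h3
      have h4 : ∑ l, M i l z * FM (Γ := Γ) a e z l j = 2 * Real.pi * Complex.I *
          (∑ l, α i l z * FM (Γ := Γ) a e z l j +
            a i * 12⁻¹ * EisensteinSeries.E2 z * comp (a i) (e i) j z) := by
        simp only [M, mul_add, add_mul, Finset.sum_add_distrib, Finset.mul_sum]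
        congr 1
        · exact Finset.sum_congr rfl fun l _ ↦ by ring
        · simp [FM, mul_assoc]
      rw [h4]
      exact h3
    have h2 : HasDerivAt (fun w ↦ ∑ j, (comp (a i) (e i) j ∘ ofComplex) w * c j)
        (∑ j, (∑ l, M i l z * FM (Γ := Γ) a e z l j) * c j) (z : ℂ) :=
      HasDerivAt.fun_sum fun j _ ↦ (h1 j).mul_const (c j)
    have h3 : ∑ l, M i l z * (FM a e z).mulVec c l =
        ∑ j, (∑ l, M i l z * FM (Γ := Γ) a e z l j) * c j := by
      simp only [Matrix.mulVec, dotProduct, Finset.mul_sum, Finset.sum_mul]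
      rw [Finset.sum_comm]
      exact Finset.sum_congr rfl fun j _ ↦ Finset.sum_congr rfl fun l _ ↦ by ring
    rw [h3]
    exact h2

theorem FB.isUnit_det {a : Cos Γ → ℤ} {e : Cos Γ → ℍ → ℂ} (h : FB Γ a e) (hg : Sep Γ g) (z : ℍ) :
    IsUnit (FM (Γ := Γ) a e z).det := by
  rw [isUnit_iff_ne_zero, Ne, ← Matrix.exists_mulVec_eq_zero_iff]
  rintro ⟨c, hc, h0⟩
  exact hc (h.mulVec_inj hg h0)

end

section

variable {Γ : Subgroup SL(2, ℤ)} {k l : ℤ} {f g : ℍ → ℂ}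

/-! ### Spectral projectors of a matrix of finite order -/

/-- The exponential `exp (2 π i r z)`. -/
def X (r : ℝ) (z : ℍ) : ℂ := Complex.exp (2 * Real.pi * Complex.I * r * z)

lemma X_add (r s : ℝ) (z : ℍ) : X r z * X s z = X (r + s) z := by
  rw [X, X, X, ← Complex.exp_add]; congr 1; push_cast; ring

lemma X_vadd (r : ℝ) (z : ℍ) :
    X r ((1 : ℝ) +ᵥ z) = Complex.exp (2 * Real.pi * Complex.I * r) * X r z := by
  rw [X, X, ← Complex.exp_add, UpperHalfPlane.coe_vadd]; congr 1; push_cast; ring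

lemma norm_X (r : ℝ) (z : ℍ) : ‖X r z‖ = Real.exp (-2 * Real.pi * r * z.im) := by
  rw [X, Complex.norm_exp]
  congr 1
  simp

lemma X_mdiff (r : ℝ) : MDiff (X r) := by
  rw [UpperHalfPlane.mdifferentiable_iff]
  have : DifferentiableOn ℂ (fun w ↦ Complex.exp (2 * Real.pi * Complex.I * r * w)) {z | 0 < z.im} :=
    by fun_prop
  refine this.congr fun w hw ↦ ?_
  rw [Function.comp_apply, ofComplex_apply_of_im_pos hw]
  rfl

lemma X_zero_iff {r : ℝ} (hr : 0 < r) : IsZeroAtImInfty (X r) := by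
  rw [IsZeroAtImInfty, ZeroAtFilter, tendsto_zero_iff_norm_tendsto_zero]
  simp_rw [norm_X]
  refine Real.tendsto_exp_atBot.comp ?_
  have : Tendsto (fun τ : ℍ ↦ (2 * Real.pi * r) * τ.im) atImInfty atTop :=
    tendsto_comap.const_mul_atTop (by positivity)
  refine (tendsto_neg_atTop_atBot.comp this).congr fun τ ↦ ?_
  simp only [Function.comp_apply]; ring

lemma X_bdd {r : ℝ} (hr : 0 ≤ r) : IsBoundedAtImInfty (X r) := by
  refine Asymptotics.IsBigO.of_bound 1 (Eventually.of_forall fun z ↦ ?_)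
  rw [norm_X]
  have : 0 ≤ 2 * Real.pi * r * z.im := by have := z.im_pos; positivity
  simp only [Pi.one_apply, norm_one, mul_one]
  exact Real.exp_le_one_iff.mpr (by linarith)

lemma sum_root {N : ℕ} {z : ℂ} (hz : z ^ N = 1) (h1 : z ≠ 1) :
    ∑ n ∈ Finset.range N, z ^ n = 0 := by
  have := mul_geom_sum z N
  rw [hz, sub_self] at this
  exact (mul_eq_zero.mp this).resolve_left (sub_ne_zero.mpr h1)

/-- The projector on the eigenspace of `P` for the eigenvalue `ζ ^ n`. -/
def proj {J : Type*} [Fintype J] [DecidableEq J] (P : Matrix J J ℂ) (ζ : ℂ) (N n : ℕ) :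
    Matrix J J ℂ := (N : ℂ)⁻¹ • ∑ m ∈ Finset.range N, ((ζ ^ n)⁻¹ • P) ^ m

section proj

variable {J : Type*} [Fintype J] [DecidableEq J] {P : Matrix J J ℂ} {ζ : ℂ} {N : ℕ}

lemma mul_proj (hP : P ^ N = 1) (hζ : IsPrimitiveRoot ζ N) (hN : N ≠ 0) (n : ℕ) :
    P * proj P ζ N n = ζ ^ n • proj P ζ N n := by
  have h0 : ζ ^ n ≠ 0 := pow_ne_zero _ (hζ.ne_zero hN)
  have h1 : ((ζ ^ n)⁻¹ • P) ^ N = 1 := by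
    rw [smul_pow, hP, inv_pow, ← pow_mul, mul_comm, pow_mul, hζ.pow_eq_one]; simp
  have h2 := mul_geom_sum ((ζ ^ n)⁻¹ • P) N
  rw [h1, sub_self, sub_mul, one_mul, sub_eq_zero, smul_mul_assoc] at h2
  rw [proj, mul_smul_comm, smul_comm]
  congr 1
  rw [← h2, smul_smul, mul_inv_cancel₀ h0, one_smul, h2]

lemma pow_mul_proj (hP : P ^ N = 1) (hζ : IsPrimitiveRoot ζ N) (hN : N ≠ 0) (n m : ℕ) :
    P ^ m * proj P ζ N n = ζ ^ (n * m) • proj P ζ N n := by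
  induction m with
  | zero => simp
  | succ m ih => rw [pow_succ, mul_assoc, mul_proj hP hζ hN, mul_smul_comm, ih, smul_smul, mul_add,
      pow_add, mul_one, mul_comm]

lemma proj_mul_proj (hP : P ^ N = 1) (hζ : IsPrimitiveRoot ζ N) (hN : N ≠ 0) {n m : ℕ}
    (hn : n < N) (hm : m < N) :
    proj P ζ N n * proj P ζ N m = if n = m then proj P ζ N m else 0 := by
  have h0 : ζ ≠ 0 := hζ.ne_zero hN
  conv_lhs => rw [proj]
  simp_rw [smul_mul_assoc, Finset.sum_mul, smul_pow, smul_mul_assoc, pow_mul_proj hP hζ hN,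
    smul_smul, pow_mul, ← mul_pow]
  rw [← Finset.sum_smul]
  split_ifs with h
  · subst h
    rw [inv_mul_cancel₀ (pow_ne_zero _ h0)]
    simp [hN, smul_smul]
  · rw [sum_root]
    · simp
    · rw [mul_pow, inv_pow, ← pow_mul, ← pow_mul, mul_comm n, mul_comm m, pow_mul, pow_mul,
        hζ.pow_eq_one]; simp
    · intro h1
      rw [inv_mul_eq_one₀ (pow_ne_zero _ h0)] at h1
      exact h (hζ.pow_inj hn hm h1)

lemma sum_proj (hζ : IsPrimitiveRoot ζ N) (hN : N ≠ 0) :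
    ∑ n ∈ Finset.range N, proj P ζ N n = 1 := by
  simp_rw [proj, ← Finset.smul_sum]
  rw [Finset.sum_comm]
  simp_rw [smul_pow, ← Finset.sum_smul]
  rw [Finset.sum_eq_single 0]
  · simp [smul_smul, hN]
  · intro m hm hm0
    have : ∀ n, ((ζ ^ n)⁻¹) ^ m = ((ζ ^ m)⁻¹) ^ n := fun n ↦ by
      rw [inv_pow, inv_pow, ← pow_mul, ← pow_mul, mul_comm]
    simp_rw [this]
    rw [sum_root, zero_smul]
    · rw [inv_pow, ← pow_mul, mul_comm, pow_mul, hζ.pow_eq_one]; simp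
    · rw [Ne, inv_eq_one, hζ.pow_eq_one_iff_dvd]
      exact fun h ↦ hm0 (Nat.eq_zero_of_dvd_of_lt h (Finset.mem_range.mp hm))
  · simp [hN]

/-- The matrix function `∑ q ^ (s n / N) Π_n`. -/
def QM (P : Matrix J J ℂ) (ζ : ℂ) (N : ℕ) (s : ℝ) (z : ℍ) : Matrix J J ℂ :=
  ∑ n ∈ Finset.range N, X (s * (n / N)) z • proj P ζ N n

lemma QM_mul_QM (hP : P ^ N = 1) (hζ : IsPrimitiveRoot ζ N) (hN : N ≠ 0) (s : ℝ) (z : ℍ) :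
    QM P ζ N s z * QM P ζ N (-s) z = 1 := by
  rw [QM, QM, Finset.sum_mul, ← sum_proj (P := P) hζ hN]
  refine Finset.sum_congr rfl fun n hn ↦ ?_
  rw [Finset.mul_sum, Finset.sum_eq_single n]
  · rw [smul_mul_smul_comm, X_add, proj_mul_proj hP hζ hN (by simpa using hn) (by simpa using hn)]
    simp [X]
  · intro m hm hmn
    rw [smul_mul_smul_comm, proj_mul_proj hP hζ hN (by simpa using hn) (by simpa using hm),
      if_neg hmn.symm, smul_zero]
  · exact fun h ↦ absurd hn h

lemma QM_vadd (hP : P ^ N = 1) (hN : N ≠ 0)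
    (hζ : IsPrimitiveRoot (Complex.exp (2 * Real.pi * Complex.I / N)) N) (z : ℍ) :
    P * QM P (Complex.exp (2 * Real.pi * Complex.I / N)) N (-1) ((1 : ℝ) +ᵥ z) =
      QM P (Complex.exp (2 * Real.pi * Complex.I / N)) N (-1) z := by
  rw [QM, QM, Finset.mul_sum]
  refine Finset.sum_congr rfl fun n _ ↦ ?_
  rw [mul_smul_comm, mul_proj hP hζ hN, smul_smul, X_vadd, mul_right_comm, ← Complex.exp_nat_mul,
    ← Complex.exp_add]
  have : (2 * Real.pi * Complex.I * ((-1 * ((n : ℝ) / (N : ℝ)) : ℝ) : ℂ) +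
      n * (2 * Real.pi * Complex.I / N)) = 0 := by push_cast; ring
  rw [this, Complex.exp_zero, one_mul]

lemma QM_apply (s : ℝ) (z : ℍ) (i j : J) : QM P ζ N s z i j =
    ∑ n ∈ Finset.range N, X (s * (n / N)) z * proj P ζ N n i j := by
  simp [QM, Matrix.sum_apply]

lemma QM_mdiff (s : ℝ) (i j : J) : MDiff fun z ↦ QM P ζ N s z i j := by
  simp_rw [QM_apply]
  have := MDifferentiable.sum (t := Finset.range N)
    (f := fun n z ↦ X (s * (n / N)) z * proj P ζ N n i j) (I := modelWithCornersSelf ℂ ℂ)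
    fun n _ ↦ (X_mdiff (s * (n / N))).mul mdifferentiable_const
  convert this using 1
  ext z; simp

lemma QM_bdd (i j : J) : IsBoundedAtImInfty fun z ↦ QM P ζ N 1 z i j := by
  simp_rw [QM_apply]
  refine Asymptotics.IsBigO.fun_sum fun n _ ↦ ?_
  have := X_bdd (r := 1 * ((n : ℝ) / N)) (by positivity)
  exact this.mul (Asymptotics.isBigO_refl (fun _ : ℍ ↦ proj P ζ N n i j) atImInfty |>.trans
    (Asymptotics.isBigO_const_const _ one_ne_zero _))

lemma X_QM_zero (i j : J) : IsZeroAtImInfty fun z ↦ X 1 z * QM P ζ N (-1) z i j := by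
  simp_rw [QM_apply, Finset.mul_sum, ← mul_assoc, X_add]
  rw [IsZeroAtImInfty, ZeroAtFilter, show (0 : ℂ) = ∑ n ∈ Finset.range N, 0 by simp]
  refine tendsto_finsetSum _ fun n hn ↦ ?_
  have hn : (n : ℝ) < N := by exact_mod_cast Finset.mem_range.mp hn
  have hN : (0 : ℝ) < N := by linarith [(Nat.cast_nonneg n : (0 : ℝ) ≤ n)]
  have := (X_zero_iff (r := 1 + -1 * ((n : ℝ) / N)) (by
    rw [neg_one_mul, ← sub_eq_add_neg, sub_pos, div_lt_one hN]; exact hn)).mul_const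
    (proj P ζ N n i j)
  rwa [zero_mul] at this

end proj

lemma Dl_O_X : Dl =O[atImInfty] X 1 := by
  have h1 : IsZeroAtImInfty Dl := by simpa using Dl_memS.2.2 1
  have := h1.exp_decay_atImInfty one_pos (by exact_mod_cast periodic_of_vadd (vadd_one_top Dl_mem))
    Dl_mem.1 h1.isBoundedAtImInfty
  refine this.trans (Asymptotics.IsBigO.of_bound 1 (Eventually.of_forall fun z ↦ ?_))
  rw [norm_X]; simp

end

section

variable {Γ : Subgroup SL(2, ℤ)} {k l : ℤ} {f g : ℍ → ℂ}

/-! ### The dual basis -/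

lemma mdiff_fsum {ι : Type} (s : Finset ι) {F : ι → ℍ → ℂ} (hF : ∀ i ∈ s, MDiff (F i)) :
    MDiff fun z ↦ ∑ i ∈ s, F i z := by
  have := MDifferentiable.sum (t := s) (f := F) (I := modelWithCornersSelf ℂ ℂ) hF
  convert this using 1
  ext z; simp

lemma mdiff_mul_matrix {ι ν : Type*} {κ : Type} [Fintype κ] {A : ℍ → Matrix ι κ ℂ} {B : ℍ → Matrix κ ν ℂ}
    (hA : ∀ i j, MDiff fun z ↦ A z i j) (hB : ∀ i j, MDiff fun z ↦ B z i j) (i : ι) (j : ν) :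
    MDiff fun z ↦ (A z * B z) i j := by
  simp_rw [Matrix.mul_apply]
  exact mdiff_fsum _ fun l _ ↦ (hA i l).mul (hB l j)

lemma mdiff_det {ι : Type} [Fintype ι] [DecidableEq ι] {A : ℍ → Matrix ι ι ℂ}
    (hA : ∀ i j, MDiff fun z ↦ A z i j) : MDiff fun z ↦ (A z).det := by
  simp_rw [Matrix.det_apply']
  refine mdiff_fsum _ fun σ _ ↦ ?_
  refine MDifferentiable.mul mdifferentiable_const ?_
  have := MDifferentiable.prod (t := Finset.univ) (f := fun i z ↦ A z (σ i) i)
    (I := modelWithCornersSelf ℂ ℂ) fun i _ ↦ hA (σ i) i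
  convert this using 1
  ext z; simp

lemma mdiff_inv {ι : Type} [Fintype ι] [DecidableEq ι] {A : ℍ → Matrix ι ι ℂ}
    (hA : ∀ i j, MDiff fun z ↦ A z i j) (h0 : ∀ z, IsUnit (A z).det) (i j : ι) :
    MDiff fun z ↦ (A z)⁻¹ i j := by
  simp_rw [Matrix.inv_def, Matrix.smul_apply, Ring.inverse_eq_inv', Matrix.adjugate_apply,
    smul_eq_mul]
  have h1 : MDiff fun z ↦ ((A z).updateRow j (Pi.single i 1)).det := by
    refine mdiff_det fun k l ↦ ?_
    by_cases hk : k = j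
    · subst hk; simp only [Matrix.updateRow_self]; exact mdifferentiable_const
    · simp only [Matrix.updateRow_ne hk]; exact hA k l
  have h2 := mdiff_det hA
  rw [UpperHalfPlane.mdifferentiable_iff] at h1 h2 ⊢
  refine DifferentiableOn.mul (DifferentiableOn.inv h2 fun w hw ↦ (h0 _).ne_zero) h1

lemma tendsto_inv {ι : Type*} [Fintype ι] [DecidableEq ι] {A : ℍ → Matrix ι ι ℂ} {B : Matrix ι ι ℂ}
    {φ : Filter ℍ} (hA : ∀ i j, Tendsto (fun z ↦ A z i j) φ (𝓝 (B i j))) (h0 : B.det ≠ 0)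
    (i j : ι) : Tendsto (fun z ↦ (A z)⁻¹ i j) φ (𝓝 (B⁻¹ i j)) := by
  have h1 : Tendsto A φ (𝓝 B) := tendsto_pi_nhds.mpr fun i ↦ tendsto_pi_nhds.mpr (hA i)
  have h2 : Tendsto (fun z ↦ (A z).det) φ (𝓝 B.det) :=
    ((continuous_id.matrix_det).tendsto B).comp h1
  have h3 : Tendsto (fun z ↦ (A z).adjugate i j) φ (𝓝 (B.adjugate i j)) :=
    ((continuous_id.matrix_adjugate.matrix_elem i j).tendsto B).comp h1
  simp_rw [Matrix.inv_def, Matrix.smul_apply, Ring.inverse_eq_inv', smul_eq_mul]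
  exact (h2.inv₀ h0).mul h3

lemma bdd_of_X_zero (hper : ∀ z : ℍ, f ((1 : ℝ) +ᵥ z) = f z) (hf : MDiff f)
    (h0 : IsZeroAtImInfty fun z ↦ X 1 z * f z) : IsBoundedAtImInfty f := by
  have hX : ∀ z, X 1 ((1 : ℝ) +ᵥ z) = X 1 z := fun z ↦ by
    rw [X_vadd]; simp
  have h1 := h0.exp_decay_atImInfty one_pos (by
    exact_mod_cast periodic_of_vadd (f := fun z ↦ X 1 z * f z) fun z ↦ by rw [hX, hper])
    ((X_mdiff 1).mul hf) h0.isBoundedAtImInfty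
  rw [Asymptotics.isBigO_iff] at h1
  obtain ⟨c, hc⟩ := h1
  refine Asymptotics.IsBigO.of_bound c (hc.mono fun z hz ↦ ?_)
  rw [norm_mul, norm_X] at hz
  have e : ‖Real.exp (-2 * Real.pi * z.im / 1)‖ = Real.exp (-2 * Real.pi * 1 * z.im) := by
    rw [Real.norm_of_nonneg (Real.exp_pos _).le]; congr 1; ring
  rw [e, mul_comm] at hz
  simpa using le_of_mul_le_mul_right hz (Real.exp_pos _)

lemma FM_smul {ι : Type*} {a : ι → ℤ} {e : ι → ℍ → ℂ} (he : ∀ i, e i ∈ MF Γ (a i))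
    (γ : SL(2, ℤ)) (z : ℍ) (i : ι) (j : Cos Γ) :
    FM (Γ := Γ) a e (γ • z) i j = denom γ z ^ (a i) * FM (Γ := Γ) a e z i (γ⁻¹ • j) := by
  rw [FM, FM, ← comp_slash (he i), SL_slash_apply, mul_left_comm, zpow_neg,
    mul_inv_cancel₀ (zpow_ne_zero _ (denom_ne γ z)), mul_one]

variable [Γ.FiniteIndex]

/-- The permutation matrix of the translation on cosets. -/
def PT (Γ : Subgroup SL(2, ℤ)) [Γ.FiniteIndex] : Matrix (Cos Γ) (Cos Γ) ℂ :=
  (MulAction.toPerm ModularGroup.T : Equiv.Perm (Cos Γ)).permMatrix ℂ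

/-- The order of the translation on cosets. -/
def NT (Γ : Subgroup SL(2, ℤ)) [Γ.FiniteIndex] : ℕ :=
  orderOf (MulAction.toPerm ModularGroup.T : Equiv.Perm (Cos Γ))⁻¹

lemma NT_ne : NT Γ ≠ 0 := (orderOf_pos _).ne'

lemma PT_pow : PT Γ ^ NT Γ = 1 := by
  have : PT Γ = Matrix.permMatrixHom (MulAction.toPerm ModularGroup.T : Equiv.Perm (Cos Γ))⁻¹ := by
    change _ = Equiv.Perm.permMatrix ℂ _⁻¹
    rw [inv_inv, PT]
  rw [this, ← map_pow, NT, pow_orderOf_eq_one, map_one]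

/-- `FM` made periodic. -/
def BM (Γ : Subgroup SL(2, ℤ)) [Γ.FiniteIndex] {ι : Type*} (a : ι → ℤ) (e : ι → ℍ → ℂ) (z : ℍ) :
    Matrix ι (Cos Γ) ℂ :=
  FM (Γ := Γ) a e z * QM (PT Γ) (Complex.exp (2 * Real.pi * Complex.I / NT Γ)) (NT Γ) (-1) z

section

variable {ι : Type*} {a : ι → ℤ} {e : ι → ℍ → ℂ}

lemma FM_vadd (he : ∀ i, e i ∈ MF Γ (a i)) (z : ℍ) :
    FM (Γ := Γ) a e ((1 : ℝ) +ᵥ z) = FM (Γ := Γ) a e z * PT Γ := by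
  ext i j
  have h1 : (FM (Γ := Γ) a e z * PT Γ) i = (FM (Γ := Γ) a e z i) ∘ (MulAction.toPerm ModularGroup.T).symm := by
    rw [← Matrix.vecMul_permMatrix]; rfl
  rw [h1, Function.comp_apply]
  have h2 := slash_T_pow (f := comp (a i) (e i) j) (a i) 1 z
  rw [pow_one, comp_slash (he i), Nat.cast_one] at h2
  exact h2.symm

lemma BM_mul : (BM Γ a e z) * QM (PT Γ) (Complex.exp (2 * Real.pi * Complex.I / NT Γ)) (NT Γ) 1 z
    = FM (Γ := Γ) a e z := by
  have := QM_mul_QM PT_pow (Complex.isPrimitiveRoot_exp _ (NT_ne (Γ := Γ))) NT_ne (-1) z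
  rw [neg_neg] at this
  rw [BM, Matrix.mul_assoc, this, Matrix.mul_one]

lemma BM_vadd (he : ∀ i, e i ∈ MF Γ (a i)) (z : ℍ) : BM Γ a e ((1 : ℝ) +ᵥ z) = BM Γ a e z := by
  rw [BM, FM_vadd he, Matrix.mul_assoc, QM_vadd PT_pow NT_ne (Complex.isPrimitiveRoot_exp _ NT_ne)]
  rfl

lemma BM_mdiff (he : ∀ i, e i ∈ MF Γ (a i)) (i : ι) (j : Cos Γ) : MDiff fun z ↦ BM Γ a e z i j :=
  mdiff_mul_matrix (fun i j ↦ comp_mdiff (he i).1 j) (fun i j ↦ QM_mdiff (-1) i j) i j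

lemma BM_bdd (he : ∀ i, e i ∈ MF Γ (a i)) (i : ι) (j : Cos Γ) :
    IsBoundedAtImInfty fun z ↦ BM Γ a e z i j := by
  refine bdd_of_X_zero (fun z ↦ by rw [BM_vadd he]) (BM_mdiff he i j) ?_
  have : ∀ z, X 1 z * BM Γ a e z i j = ∑ c, FM (Γ := Γ) a e z i c * (X 1 z *
      QM (PT Γ) (Complex.exp (2 * Real.pi * Complex.I / NT Γ)) (NT Γ) (-1) z c j) := fun z ↦ by
    rw [BM, Matrix.mul_apply, Finset.mul_sum]
    exact Finset.sum_congr rfl fun c _ ↦ by ring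
  simp_rw [this]
  rw [IsZeroAtImInfty, ZeroAtFilter, show (0 : ℂ) = ∑ c : Cos Γ, 0 by simp]
  refine tendsto_finsetSum _ fun c _ ↦ ?_
  exact zero_of_bounded_mul (comp_bdd (he i) c) (X_QM_zero c j)

end

variable {a : Cos Γ → ℤ} {e : Cos Γ → ℍ → ℂ}

/-- The limit of `BM` at infinity. -/
def BL (Γ : Subgroup SL(2, ℤ)) [Γ.FiniteIndex] (a : Cos Γ → ℤ) (e : Cos Γ → ℍ → ℂ) :
    Matrix (Cos Γ) (Cos Γ) ℂ :=
  fun i j ↦ valueAtInfty fun z ↦ BM Γ a e z i j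

lemma BM_tendsto (he : ∀ i, e i ∈ MF Γ (a i)) (i j : Cos Γ) :
    Tendsto (fun z ↦ BM Γ a e z i j) atImInfty (𝓝 (BL Γ a e i j)) :=
  tendsto_valueAtInfty one_pos (fun z ↦ by rw [BM_vadd he]) (BM_mdiff he i j) (BM_bdd he i j)

lemma FB.BL_det (h : FB Γ a e) (hev : ∀ i, Even (a i)) : (BL Γ a e).det ≠ 0 := by
  intro hdet
  obtain ⟨c, hc0, hc⟩ := Matrix.exists_vecMul_eq_zero_iff.mpr hdet
  apply hc0
  obtain ⟨k, hk, hk'⟩ : ∃ k : ℤ, Even k ∧ ∀ i, a i + 4 ≤ k := by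
    refine ⟨2 * (∑ i, |a i| + 4), even_two_mul _, fun i ↦ ?_⟩
    have h1 := Finset.single_le_sum (fun j _ ↦ abs_nonneg (a j)) (Finset.mem_univ i)
    have h2 := le_abs_self (a i)
    have h3 := abs_nonneg (a i)
    linarith
  have hxy : ∀ i, ∃ x y : ℕ, (4 * x + 6 * y : ℤ) = k - a i := fun i ↦ by
    obtain ⟨m, hm⟩ := hk.sub (hev i)
    have := hk' i
    rcases Int.even_or_odd m with ⟨r, hr⟩ | ⟨r, hr⟩
    · exact ⟨r.toNat, 0, by omega⟩
    · exact ⟨(r - 1).toNat, 1, by omega⟩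
  choose x y hxy using hxy
  have hα : ∀ i, c i • EE (x i) (y i) ∈ MF ⊤ (k - a i) := fun i ↦
    Submodule.smul_mem _ _ (EE_mem (hxy i))
  have hf : ∑ i, (c i • EE (x i) (y i)) * e i ∈ MF Γ k := Submodule.sum_mem _ fun i _ ↦
    mul_MF' (MF_top_le (hα i)) (h.mem i) (by ring)
  have hlim : ∀ i, Tendsto (c i • EE (x i) (y i)) atImInfty (𝓝 (c i)) := fun i ↦ by
    have := (EE_tendsto (x i) (y i)).const_smul (c i)
    rw [smul_eq_mul, mul_one] at this
    exact this
  let H : Cos Γ → ℍ → ℂ := fun j z ↦ ∑ i, (c i • EE (x i) (y i)) z * BM Γ a e z i j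
  have hH0 : ∀ j, Tendsto (H j) atImInfty (𝓝 0) := fun j ↦ by
    rw [← show ∑ i, c i * BL Γ a e i j = 0 from congrFun hc j]
    exact tendsto_finsetSum _ fun i _ ↦ (hlim i).mul (BM_tendsto h.mem i j)
  have hHO : ∀ j, H j =O[atImInfty] Dl := fun j ↦ by
    have := sub_val_O_Dl (f := H j) (fun z ↦ by
      refine Finset.sum_congr rfl fun i _ ↦ ?_
      rw [BM_vadd h.mem, vadd_one_top (hα i)])
      (mdiff_fsum _ fun i _ ↦ (hα i).1.mul (BM_mdiff h.mem i j)) ((hH0 j).isBigO_one ℝ)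
    simpa [val_eq (hH0 j)] using this
  have hcomp : ∀ j, comp k (∑ i, (c i • EE (x i) (y i)) * e i) j =O[atImInfty] Dl := fun j ↦ by
    have : comp k (∑ i, (c i • EE (x i) (y i)) * e i) j = fun z ↦ ∑ l, H l z *
        QM (PT Γ) (Complex.exp (2 * Real.pi * Complex.I / NT Γ)) (NT Γ) 1 z l j := by
      ext z
      rw [comp_comb hα, ← BM_mul]
      simp_rw [Matrix.mul_apply, H, Finset.mul_sum, Finset.sum_mul, mul_assoc]
      exact Finset.sum_comm
    rw [this]
    refine Asymptotics.IsBigO.fun_sum fun l _ ↦ ?_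
    have hb : (fun z ↦ QM (PT Γ) (Complex.exp (2 * Real.pi * Complex.I / NT Γ)) (NT Γ) 1 z l j)
        =O[atImInfty] (fun _ ↦ (1 : ℂ)) :=
      (QM_bdd (P := PT Γ) l j).trans (Asymptotics.isBigO_const_const _ one_ne_zero _)
    simpa only [mul_one] using (hHO l).mul hb
  obtain ⟨u, hu, hfu⟩ := exists_div_Dl (m := k - 12) hf (by ring) fun γ ↦ by
    have := hcomp ((γ⁻¹ : SL(2, ℤ)) : Cos Γ)
    rwa [comp_mk hf, inv_inv] at this
  obtain ⟨β, hβ, hβu⟩ := h.gen hu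
  have hβD : ∀ i, β i * Dl ∈ MF ⊤ (k - a i) := fun i ↦ mul_MF' (hβ i) Dl_mem (by ring)
  have hz := h.indep (α := fun i ↦ c i • EE (x i) (y i) - β i * Dl)
    (fun i ↦ Submodule.sub_mem _ (hα i) (hβD i)) (by
      simp_rw [sub_mul]
      rw [Finset.sum_sub_distrib, hfu, hβu, Finset.sum_mul, ← Finset.sum_sub_distrib]
      exact Finset.sum_eq_zero fun i _ ↦ by ring)
  ext i
  have h1 := sub_eq_zero.mp (hz i)
  have h2 : Tendsto (β i * Dl) atImInfty (𝓝 0) := by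
    refine zero_of_bounded_mul ?_ ?_
    · simpa using (hβ i).2.2 1
    · simpa using Dl_memS.2.2 1
  rw [← h1] at h2
  exact tendsto_nhds_unique (hlim i) h2

/-- Elements of the dual basis, before evaluation at the trivial coset. -/
def YD (a : Cos Γ → ℤ) (e : Cos Γ → ℍ → ℂ) (i j : Cos Γ) : ℍ → ℂ :=
  fun z ↦ Dl z * (FM (Γ := Γ) a e z)⁻¹ j i

lemma FB.YD_slash (h : FB Γ a e) (i j : Cos Γ) (γ : SL(2, ℤ)) :
    YD a e i j ∣[12 - a i] γ = YD a e i (γ⁻¹ • j) := by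
  ext z
  have hD : Dl (γ • z) = denom γ z ^ (12 : ℤ) * Dl z := by
    have h1 := congrFun (slash_top Dl_mem γ) z
    rw [SL_slash_apply, zpow_neg] at h1
    rw [← h1, mul_left_comm, mul_inv_cancel₀ (zpow_ne_zero _ (denom_ne γ z)), mul_one]
  have hF : FM (Γ := Γ) a e (γ • z) = Matrix.diagonal (fun i ↦ denom γ z ^ (a i)) *
      (FM (Γ := Γ) a e z).submatrix (Equiv.refl _) (MulAction.toPerm γ⁻¹) := by
    ext i j
    rw [FM_smul h.mem, Matrix.diagonal_mul]
    rfl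
  have hd : (Matrix.diagonal fun i ↦ denom γ z ^ (a i))⁻¹ =
      Matrix.diagonal fun i ↦ (denom γ z ^ (a i))⁻¹ := by
    refine Matrix.inv_eq_right_inv ?_
    rw [Matrix.diagonal_mul_diagonal, ← Matrix.diagonal_one]
    congr 1
    ext i
    exact mul_inv_cancel₀ (zpow_ne_zero _ (denom_ne γ z))
  rw [SL_slash_apply, YD, YD, hF, Matrix.mul_inv_rev, Matrix.inv_submatrix_equiv,
    hd, Matrix.mul_diagonal, hD, Matrix.submatrix_apply]
  have h0 := denom_ne γ z
  change _ * ((FM (Γ := Γ) a e z)⁻¹ (γ⁻¹ • j) i * _) * _ = _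
  rw [neg_sub, zpow_sub₀ h0]
  field_simp

lemma FB.YD_mdiff (h : FB Γ a e) (hg : Sep Γ g) (i j : Cos Γ) : MDiff (YD a e i j) :=
  Dl_mem.1.mul (mdiff_inv (fun i j ↦ comp_mdiff (h.mem i).1 j) (fun z ↦ h.isUnit_det hg z) j i)

lemma FB.YD_zero (h : FB Γ a e) (hev : ∀ i, Even (a i)) (i j : Cos Γ) :
    IsZeroAtImInfty (YD a e i j) := by
  have h1 : YD a e i j = fun z ↦ ∑ l, (Dl z * QM (PT Γ) (Complex.exp (2 * Real.pi * Complex.I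
      / NT Γ)) (NT Γ) (-1) z j l) * (BM Γ a e z)⁻¹ l i := by
    ext z
    have h2 := QM_mul_QM PT_pow (Complex.isPrimitiveRoot_exp _ (NT_ne (Γ := Γ))) NT_ne 1 z
    rw [YD, ← BM_mul, Matrix.mul_inv_rev, Matrix.inv_eq_right_inv h2, Matrix.mul_apply,
      Finset.mul_sum]
    exact Finset.sum_congr rfl fun l _ ↦ by ring
  rw [h1, IsZeroAtImInfty, ZeroAtFilter, show (0 : ℂ) = ∑ l : Cos Γ, 0 * (BL Γ a e)⁻¹ l i by simp]
  refine tendsto_finsetSum _ fun l _ ↦ ?_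
  refine Tendsto.mul ?_ (tendsto_inv (BM_tendsto h.mem) (h.BL_det hev) l i)
  have h3 : (fun z ↦ Dl z * QM (PT Γ) (Complex.exp (2 * Real.pi * Complex.I / NT Γ)) (NT Γ) (-1) z
      j l) =O[atImInfty] fun z ↦ X 1 z * QM (PT Γ) (Complex.exp (2 * Real.pi * Complex.I / NT Γ))
      (NT Γ) (-1) z j l := Dl_O_X.mul (Asymptotics.isBigO_refl _ _)
  exact h3.trans_tendsto (X_QM_zero j l)

/-- The dual basis of cusp forms. -/
structure Dual (Γ : Subgroup SL(2, ℤ)) [Γ.FiniteIndex] (a : Cos Γ → ℤ) (e s : Cos Γ → ℍ → ℂ) :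
    Prop extends FB Γ a e where
  memS : ∀ i, s i ∈ SF Γ (12 - a i)
  inj : ∀ {k x}, x ∈ MF Γ k → (∀ i, tr Γ (k + a i) (x * e i) = 0) → x = 0
  dual : ∀ i j, tr Γ (a i + (12 - a j)) (e i * s j) = if i = j then Dl else 0

theorem FB.exists_dual (h : FB Γ a e) (hg : Sep Γ g) (hev : ∀ i, Even (a i)) :
    ∃ s, Dual Γ a e s := by
  have hs : ∀ i, YD a e i ((1 : SL(2, ℤ)) : Cos Γ) ∈ SF Γ (12 - a i) := fun i ↦ by
    refine ⟨h.YD_mdiff hg _ _, fun γ hγ ↦ ?_, fun γ ↦ ?_⟩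
    · rw [h.YD_slash, MulAction.Quotient.smul_coe, smul_eq_mul, mul_one]
      congr 1
      exact (QuotientGroup.eq.mpr (by simpa using inv_mem hγ)).symm
    · rw [h.YD_slash]; exact h.YD_zero hev _ _
  refine ⟨fun i ↦ YD a e i ((1 : SL(2, ℤ)) : Cos Γ), h, hs, fun {k x} hx h0 ↦ ?_, fun i j ↦ ?_⟩
  · ext z
    have := h.mulVec_inj hg (z := z) (c := fun j ↦ comp k x j z) (by
      ext i
      have h1 := congrFun (h0 i) z
      simp only [tr, Finset.sum_apply, comp_mul, Pi.mul_apply] at h1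
      simp only [Matrix.mulVec, dotProduct, FM]
      refine Eq.trans ?_ h1
      exact Finset.sum_congr rfl fun j _ ↦ mul_comm _ _)
    have h2 := congrFun this ((1 : SL(2, ℤ)) : Cos Γ)
    simpa [comp_one hx] using h2
  · have hc : ∀ c : Cos Γ, comp (12 - a j) (YD a e j ((1 : SL(2, ℤ)) : Cos Γ)) c = YD a e j c := by
      intro c
      rw [comp, h.YD_slash, inv_inv, MulAction.Quotient.smul_coe, smul_eq_mul, mul_one]
      congr 1
      exact QuotientGroup.out_eq' c
    ext z
    simp only [tr, Finset.sum_apply, comp_mul, Pi.mul_apply, hc, YD]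
    have h1 := congrFun (congrFun (Matrix.mul_nonsing_inv _ (h.isUnit_det hg z)) i) j
    rw [Matrix.mul_apply] at h1
    simp only [mul_left_comm _ (Dl z), ← Finset.mul_sum]
    change Dl z * ∑ c, FM (Γ := Γ) a e z i c * _ = _
    rw [h1, Matrix.one_apply]
    split_ifs <;> simp

end

section

variable {Γ : Subgroup SL(2, ℤ)} {k l : ℤ} {f g : ℍ → ℂ}

/-! ### Expansions and dimensions -/

variable [Γ.FiniteIndex] {a : Cos Γ → ℤ} {e s : Cos Γ → ℍ → ℂ}

lemma Dual.tr_comb (h : Dual Γ a e s) {p q m : ℤ} {α φ : Cos Γ → ℍ → ℂ} (hm : q + p = m)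
    (hφ : ∀ i, φ i ∈ MF ⊤ (q - a i)) (hα : ∀ i, α i ∈ MF ⊤ (p - (12 - a i))) :
    tr Γ m ((∑ i, φ i * e i) * ∑ i, α i * s i) = (∑ i, φ i * α i) * Dl := by
  rw [Finset.sum_mul_sum, tr_sum, Finset.sum_mul]
  refine Finset.sum_congr rfl fun i _ ↦ ?_
  rw [tr_sum, Finset.sum_eq_single i]
  · rw [mul_mul_mul_comm, tr_mul_top (k := q - a i + (p - (12 - a i))) (l := a i + (12 - a i))
      (by rw [← hm]; ring) (mul_MF (hφ i) (hα i)), h.dual, if_pos rfl]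
  · intro j _ hj
    rw [mul_mul_mul_comm, tr_mul_top (k := q - a i + (p - (12 - a j))) (l := a i + (12 - a j))
      (by rw [← hm]; ring) (mul_MF (hφ i) (hα j)), h.dual, if_neg hj.symm, mul_zero]
  · simp

lemma Dual.comb_mem (h : Dual Γ a e s) {p : ℤ} {α : Cos Γ → ℍ → ℂ}
    (hα : ∀ i, α i ∈ MF ⊤ (p - (12 - a i))) : ∑ i, α i * s i ∈ SF Γ p :=
  Submodule.sum_mem _ fun i _ ↦ mul_SF' (MF_top_le (hα i)) (h.memS i) (by ring)

lemma Dual.tr_e (h : Dual Γ a e s) {p : ℤ} {α : Cos Γ → ℍ → ℂ}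
    (hα : ∀ i, α i ∈ MF ⊤ (p - (12 - a i))) (i : Cos Γ) {m : ℤ} (hm : p + a i = m) :
    tr Γ m ((∑ i, α i * s i) * e i) = α i * Dl := by
  have := h.tr_comb (m := m) (q := a i) (φ := Pi.single i 1) (by rw [← hm]; ring) (fun j ↦ by
    by_cases hj : j = i
    · subst hj; rw [Pi.single_eq_same, sub_self]; exact one_MF
    · rw [Pi.single_eq_of_ne hj]; exact zero_mem _) hα
  simp only [Pi.single_apply, ite_mul, one_mul, zero_mul, Finset.sum_ite_eq', Finset.mem_univ,
    if_true] at this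
  rw [mul_comm, this]

lemma Dual.expand (h : Dual Γ a e s) {x : ℍ → ℂ} (hx : x ∈ SF Γ k) :
    ∃ β : Cos Γ → ℍ → ℂ, (∀ i, β i ∈ MF ⊤ (k - (12 - a i))) ∧ x = ∑ i, β i * s i := by
  have h1 : ∀ i, ∃ β ∈ MF ⊤ (k - (12 - a i)), tr Γ (k + a i) (x * e i) = β * Dl := fun i ↦ by
    have h2 := tr_memS (mul_SF_MF hx (h.mem i) rfl)
    refine exists_div_Dl_top (SF_le_MF h2) (by ring) ?_
    simpa using (mem_SF_iff (SF_le_MF h2)).mp h2 1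
  choose β hβ hβ' using h1
  refine ⟨β, hβ, sub_eq_zero.mp (h.inj (k := k) ?_ fun i ↦ ?_)⟩
  · exact Submodule.sub_mem _ (SF_le_MF hx) (SF_le_MF (h.comb_mem hβ))
  · have : (x - ∑ i, β i * s i) * e i = x * e i + (-1 : ℂ) • ((∑ i, β i * s i) * e i) := by
      rw [sub_mul, neg_one_smul, sub_eq_add_neg]
    rw [this, tr_add, tr_smul, hβ', h.tr_e hβ i rfl, neg_one_smul, add_neg_cancel]

lemma mul_Dl_cancel {α : ℍ → ℂ} (h : α * Dl = 0) : α = 0 := by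
  ext z
  exact (mul_eq_zero.mp (congrFun h z)).resolve_right (Dl_ne z)

lemma Dual.indepS (h : Dual Γ a e s) {α : Cos Γ → ℍ → ℂ}
    (hα : ∀ i, α i ∈ MF ⊤ (k - (12 - a i))) (h0 : ∑ i, α i * s i = 0) (i : Cos Γ) : α i = 0 := by
  have := h.tr_e hα i rfl
  rw [h0, zero_mul] at this
  refine mul_Dl_cancel (this.symm.trans ?_)
  have := tr_smul (Γ := Γ) (k := k + a i) 0 0
  simpa using this

lemma Dual.s_ne (h : Dual Γ a e s) (i : Cos Γ) : s i ≠ 0 := by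
  intro hi
  have h1 := h.dual i i
  rw [hi, mul_zero, if_pos rfl] at h1
  have h2 := tr_smul (Γ := Γ) (k := a i + (12 - a i)) 0 0
  rw [zero_smul, h1] at h2
  have := congrFun h2 UpperHalfPlane.I
  exact Dl_ne UpperHalfPlane.I (by simpa using this)

lemma SF_nonpos (hk : k ≤ 0) (hf : f ∈ SF Γ k) : f = 0 := by
  rcases hk.lt_or_eq with hk | rfl
  · exact MF_neg hk (SF_le_MF hf)
  · obtain ⟨c, rfl⟩ := MF_zero (SF_le_MF hf)
    have := hf.2.2 1
    rw [SlashAction.slash_one] at this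
    have := tendsto_nhds_unique this tendsto_const_nhds
    ext; simp [← this]

lemma Dual.le_ten (h : Dual Γ a e s) (hev : ∀ i, Even (a i)) (i : Cos Γ) : a i ≤ 10 := by
  by_contra! h1
  refine h.s_ne i (SF_nonpos (k := 12 - a i) ?_ (h.memS i))
  obtain ⟨m, hm⟩ := hev i
  omega

lemma FB.finrank (h : FB Γ a e) (k : ℤ) :
    Module.finrank ℂ (MF Γ k) = ∑ i, Module.finrank ℂ (MF ⊤ (k - a i)) := by
  rw [← Module.finrank_pi_fintype]
  refine (LinearEquiv.finrank_eq (LinearEquiv.ofBijective (lin h.mem k) ⟨?_, ?_⟩)).symm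
  · rw [injective_iff_map_eq_zero]
    intro α hα
    ext1 i
    ext1
    exact h.indep (α := fun i ↦ (α i : ℍ → ℂ)) (fun i ↦ (α i).2) (congrArg Subtype.val hα) i
  · rintro ⟨f, hf⟩
    obtain ⟨α, hα, rfl⟩ := h.gen hf
    exact ⟨fun i ↦ ⟨α i, hα i⟩, rfl⟩

/-- The linear combinations of the dual basis. -/
def linS (h : ∀ i, s i ∈ SF Γ (12 - a i)) (k : ℤ) : (Π i, MF ⊤ (k - (12 - a i))) →ₗ[ℂ] SF Γ k where
  toFun α := ⟨∑ i, (α i : ℍ → ℂ) * s i, Submodule.sum_mem _ fun i _ ↦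
    mul_SF' (MF_top_le (α i).2) (h i) (by ring)⟩
  map_add' α β := by
    ext1
    simp [add_mul, Finset.sum_add_distrib]
  map_smul' c α := by
    ext1
    simp [Finset.smul_sum]

lemma Dual.finrankS (h : Dual Γ a e s) (k : ℤ) :
    Module.finrank ℂ (SF Γ k) = ∑ i, Module.finrank ℂ (MF ⊤ (k - (12 - a i))) := by
  rw [← Module.finrank_pi_fintype]
  refine (LinearEquiv.finrank_eq (LinearEquiv.ofBijective (linS h.memS k) ⟨?_, ?_⟩)).symm
  · rw [injective_iff_map_eq_zero]
    intro α hα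
    ext1 i
    ext1
    exact h.indepS (α := fun i ↦ (α i : ℍ → ℂ)) (fun i ↦ (α i).2) (congrArg Subtype.val hα) i
  · rintro ⟨f, hf⟩
    obtain ⟨α, hα, rfl⟩ := h.expand hf
    exact ⟨fun i ↦ ⟨α i, hα i⟩, rfl⟩

/-- The number of basis elements of weight `m`. -/
def cnt (a : Cos Γ → ℤ) (m : ℤ) : ℕ := (Finset.univ.filter fun i ↦ a i = m).card

lemma sum_cnt {M : Type*} [AddCommMonoid M] (h0 : ∀ i, 0 ≤ a i) (h10 : ∀ i, a i ≤ 10)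
    (hev : ∀ i, Even (a i)) (F : ℤ → M) : ∑ i, F (a i) = cnt a 0 • F 0 + cnt a 2 • F 2 +
      cnt a 4 • F 4 + cnt a 6 • F 6 + cnt a 8 • F 8 + cnt a 10 • F 10 := by
  have h1 : ∀ i ∈ (Finset.univ : Finset (Cos Γ)), a i ∈ ({0, 2, 4, 6, 8, 10} : Finset ℤ) := by
    intro i _
    obtain ⟨m, hm⟩ := hev i
    have := h0 i
    have := h10 i
    simp only [Finset.mem_insert, Finset.mem_singleton]
    omega
  rw [← Finset.sum_fiberwise_of_maps_to h1]
  have h2 : ∀ m, ∑ i with a i = m, F (a i) = cnt a m • F m := fun m ↦ by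
    rw [cnt, ← Finset.sum_const]
    exact Finset.sum_congr rfl fun i hi ↦ by rw [(Finset.mem_filter.mp hi).2]
  simp_rw [h2]
  simp [add_assoc]

lemma top_rank_small (k : ℤ) (hk : k ≤ 10) (hev : Even k) : Module.finrank ℂ (MF ⊤ k) =
    if k < 0 ∨ k = 2 then 0 else 1 := by
  rcases lt_or_ge k 0 with h | h
  · rw [finrank_top_neg h, if_pos (Or.inl h)]
  · lift k to ℕ using h
    rw [finrank_top_nat _ (by exact_mod_cast hev)]
    have hk' : k ≤ 10 := by exact_mod_cast hk
    interval_cases k <;> first | (exfalso; revert hev; decide) | simp [Nat.ModEq]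

/-- The numerical data of a subgroup without elliptic points. -/
structure Num (Γ : Subgroup SL(2, ℤ)) (d g : ℤ) : Prop where
  fin : ∀ k, FiniteDimensional ℂ (MF Γ k)
  r2 : (Module.finrank ℂ (MF Γ 2) : ℤ) = d + 1 - g
  r4 : (Module.finrank ℂ (MF Γ 4) : ℤ) = 2 * d + 1 - g
  r6 : (Module.finrank ℂ (MF Γ 6) : ℤ) = 3 * d + 1 - g
  r8 : (Module.finrank ℂ (MF Γ 8) : ℤ) = 4 * d + 1 - g
  r10 : (Module.finrank ℂ (MF Γ 10) : ℤ) = 5 * d + 1 - g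
  s2 : (Module.finrank ℂ (SF Γ 2) : ℤ) = g
  s4 : (Module.finrank ℂ (SF Γ 4) : ℤ) = d + g - 1
  s6 : (Module.finrank ℂ (SF Γ 6) : ℤ) = 2 * d + g - 1
  s10 : (Module.finrank ℂ (SF Γ 10) : ℤ) = 4 * d + g - 1

lemma finrank_zero : Module.finrank ℂ (MF Γ 0) = 1 := by
  have h1 : (⟨fun _ ↦ 1, by simpa [Pi.one_def] using one_MF (Γ := Γ)⟩ : MF Γ 0) ≠ 0 := by
    intro h
    have := congrFun (congrArg Subtype.val h) UpperHalfPlane.I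
    simp at this
  refine (finrank_eq_one_iff_of_nonzero' _ h1).mpr fun f ↦ ?_
  obtain ⟨c, hc⟩ := MF_zero f.2
  refine ⟨c, ?_⟩
  ext z
  rw [hc]; simp

lemma Dual.num (h : Dual Γ a e s) (fin : ∀ k, FiniteDimensional ℂ (MF Γ k)) (h0 : ∀ i, 0 ≤ a i)
    (hev : ∀ i, Even (a i))
    (hS : cnt a 0 + cnt a 4 + cnt a 8 = cnt a 2 + cnt a 6 + cnt a 10)
    (hR1 : cnt a 0 + cnt a 6 = cnt a 2 + cnt a 8) (hR2 : cnt a 0 + cnt a 6 = cnt a 4 + cnt a 10) :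
    ∃ d g, Num Γ d g := by
  have hc : ∀ F : ℤ → ℕ, _ := fun F ↦ sum_cnt (M := ℕ) h0 (h.le_ten hev) hev F
  obtain ⟨G, hG⟩ : ∃ G : ℤ → ℤ → ℕ, ∀ k m, G k m = if k - m < 0 ∨ k - m = 2 then 0 else 1 :=
    ⟨_, fun _ _ ↦ rfl⟩
  have hr : ∀ k : ℤ, k ≤ 10 → Even k → Module.finrank ℂ (MF Γ k) =
      cnt a 0 • G k 0 + cnt a 2 • G k 2 + cnt a 4 • G k 4 + cnt a 6 • G k 6 +
      cnt a 8 • G k 8 + cnt a 10 • G k 10 := fun k hk hke ↦ by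
    rw [h.toFB.finrank, ← hc (G k)]
    refine Finset.sum_congr rfl fun i _ ↦ ?_
    rw [hG]
    exact top_rank_small _ (by linarith [h0 i]) (hke.sub (hev i))
  have hs : ∀ k : ℤ, k ≤ 10 → Even k → Module.finrank ℂ (SF Γ k) =
      cnt a 0 • G k 12 + cnt a 2 • G k 10 + cnt a 4 • G k 8 + cnt a 6 • G k 6 +
      cnt a 8 • G k 4 + cnt a 10 • G k 2 := fun k hk hke ↦ by
    rw [h.finrankS]
    refine Eq.trans (Finset.sum_congr rfl fun i _ ↦ ?_) (hc fun m ↦ G k (12 - m))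
    rw [hG]
    exact top_rank_small _ (by linarith [h.le_ten hev i]) (hke.sub (Even.sub (by decide) (hev i)))
  have e0 := hr 0 (by norm_num) (by decide)
  rw [finrank_zero] at e0
  have e2 := hr 2 (by norm_num) (by decide)
  have e4 := hr 4 (by norm_num) (by decide)
  have e6 := hr 6 (by norm_num) (by decide)
  have e8 := hr 8 (by norm_num) (by decide)
  have e10 := hr 10 (by norm_num) (by decide)
  have f2 := hs 2 (by norm_num) (by decide)
  have f4 := hs 4 (by norm_num) (by decide)
  have f6 := hs 6 (by norm_num) (by decide)
  have f10 := hs 10 (by norm_num) (by decide)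
  norm_num [hG] at e0 e2 e4 e6 e8 e10 f2 f4 f6 f10
  refine ⟨cnt a 10 + cnt a 2 - 1, cnt a 10, fin, ?_, ?_, ?_, ?_, ?_, ?_, ?_, ?_, ?_⟩ <;> omega

end

section

variable {Γ : Subgroup SL(2, ℤ)} {k l : ℤ} {f g : ℍ → ℂ}

/-! ### Elliptic points -/

lemma top_smul (hf : f ∈ MF ⊤ k) (γ : SL(2, ℤ)) (z : ℍ) : f (γ • z) = denom γ z ^ k * f z := by
  have h1 := congrFun (slash_top hf γ) z
  rw [SL_slash_apply, zpow_neg] at h1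
  rw [← h1, mul_left_comm, mul_inv_cancel₀ (zpow_ne_zero _ (denom_ne γ z)), mul_one]

lemma fix_conj {γ : SL(2, ℤ)} (h : ∀ δ : SL(2, ℤ), δ⁻¹ * γ * δ ∉ Γ) (j : Cos Γ) : γ • j ≠ j := by
  induction j using QuotientGroup.induction_on with
  | H δ =>
    intro hj
    rw [MulAction.Quotient.smul_coe, smul_eq_mul] at hj
    exact h δ (by have := QuotientGroup.eq.mp hj.symm; rwa [← mul_assoc] at this)

section

variable [Γ.FiniteIndex] {a : Cos Γ → ℤ} {e s : Cos Γ → ℍ → ℂ}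

lemma FB.sum_denom (h : FB Γ a e) (hg : Sep Γ g) {γ : SL(2, ℤ)} {z : ℍ} (hz : γ • z = z)
    (hfix : ∀ j : Cos Γ, γ • j ≠ j) : ∑ i, denom γ z ^ a i = 0 := by
  set F := FM (Γ := Γ) a e z with hF
  set Q : Matrix (Cos Γ) (Cos Γ) ℂ := fun l j ↦ if l = γ • j then 1 else 0 with hQ
  set D : Matrix (Cos Γ) (Cos Γ) ℂ := Matrix.diagonal fun i ↦ denom γ z ^ a i with hD
  have h1 : F * Q = D * F := by
    ext i j
    have h2 := FM_smul h.mem γ z i (γ • j)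
    rw [hz, inv_smul_smul] at h2
    rw [hD, Matrix.diagonal_mul, Matrix.mul_apply]
    simp only [hQ, mul_ite, mul_one, mul_zero, Finset.sum_ite_eq', Finset.mem_univ, if_true]
    exact h2
  have hu := h.isUnit_det hg z
  have h3 : D = F * Q * F⁻¹ := by
    rw [h1, Matrix.mul_assoc, Matrix.mul_nonsing_inv _ hu, Matrix.mul_one]
  have h4 : D.trace = Q.trace := by
    rw [h3, Matrix.trace_mul_cycle, Matrix.nonsing_inv_mul _ hu, Matrix.one_mul]
  rw [hD, Matrix.trace_diagonal] at h4
  rw [h4, Matrix.trace]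
  exact Finset.sum_eq_zero fun j _ ↦ if_neg (hfix j).symm

lemma FB.elliptic_S (h : FB Γ a e) (hg : Sep Γ g) (h0 : ∀ i, 0 ≤ a i) (h10 : ∀ i, a i ≤ 10)
    (hev : ∀ i, Even (a i)) (hS : ∀ δ : SL(2, ℤ), δ⁻¹ * ModularGroup.S * δ ∉ Γ) :
    cnt a 0 + cnt a 4 + cnt a 8 = cnt a 2 + cnt a 6 + cnt a 10 := by
  have hz : ModularGroup.S • UpperHalfPlane.I = UpperHalfPlane.I := by
    rw [modular_S_smul]; ext; simp
  have h1 := h.sum_denom hg hz (fix_conj hS)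
  rw [ModularGroup.denom_S, sum_cnt h0 h10 hev (fun m ↦ (UpperHalfPlane.I : ℂ) ^ m)] at h1
  have hI : (UpperHalfPlane.I : ℂ) = Complex.I := rfl
  have e2 : Complex.I ^ (2 : ℤ) = -1 := by
    rw [show (2 : ℤ) = (2 : ℕ) by rfl, zpow_natCast]; exact Complex.I_sq
  have e4 : Complex.I ^ (4 : ℤ) = 1 := by
    rw [show (4 : ℤ) = 2 + 2 by rfl, zpow_add₀ Complex.I_ne_zero, e2]; ring
  have e6 : Complex.I ^ (6 : ℤ) = -1 := by
    rw [show (6 : ℤ) = 4 + 2 by rfl, zpow_add₀ Complex.I_ne_zero, e2, e4]; ring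
  have e8 : Complex.I ^ (8 : ℤ) = 1 := by
    rw [show (8 : ℤ) = 4 + 4 by rfl, zpow_add₀ Complex.I_ne_zero, e4]; ring
  have e10 : Complex.I ^ (10 : ℤ) = -1 := by
    rw [show (10 : ℤ) = 8 + 2 by rfl, zpow_add₀ Complex.I_ne_zero, e8, e2]; ring
  rw [hI, e2, e4, e6, e8, e10, zpow_zero] at h1
  simp only [nsmul_eq_mul, mul_one, mul_neg] at h1
  have : ((cnt a 0 + cnt a 4 + cnt a 8 : ℕ) : ℂ) = (cnt a 2 + cnt a 6 + cnt a 10 : ℕ) := by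
    push_cast; linear_combination h1
  exact_mod_cast this

lemma ST_rho : (ModularGroup.S * ModularGroup.T) • ρ = ρ := by
  have h : (1 : ℂ) + ρ ≠ 0 := by
    intro h
    have := UpperHalfPlane.ρ_sq
    rw [show (ρ : ℂ) = -1 by linear_combination h] at this
    norm_num at this
  rw [mul_smul, modular_T_smul, modular_S_smul, UpperHalfPlane.ext_iff, UpperHalfPlane.coe_mk,
    coe_vadd, Complex.ofReal_one, inv_neg, neg_eq_iff_eq_neg, inv_eq_iff_eq_inv,
    eq_comm, inv_eq_iff_eq_inv, ← mul_right_inj' h, mul_inv_cancel₀ h]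
  linear_combination -UpperHalfPlane.ρ_sq

lemma denom_ST : denom (ModularGroup.S * ModularGroup.T : SL(2, ℤ)) ρ =
    (ρ : ℂ) + 1 := by
  rw [ModularGroup.denom_apply]
  rw [Matrix.SpecialLinearGroup.coe_mul]
  simp [ModularGroup.S, ModularGroup.T]

lemma FB.elliptic_R (h : FB Γ a e) (hg : Sep Γ g) (h0 : ∀ i, 0 ≤ a i) (h10 : ∀ i, a i ≤ 10)
    (hev : ∀ i, Even (a i))
    (hR : ∀ δ : SL(2, ℤ), δ⁻¹ * (ModularGroup.S * ModularGroup.T) * δ ∉ Γ) :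
    cnt a 0 + cnt a 6 = cnt a 2 + cnt a 8 ∧ cnt a 0 + cnt a 6 = cnt a 4 + cnt a 10 := by
  have h1 := h.sum_denom hg ST_rho (fix_conj hR)
  rw [denom_ST, sum_cnt h0 h10 hev (fun m ↦ ((ρ : ℂ) + 1) ^ m)] at h1
  set w : ℂ := (ρ : ℂ) + 1 with hw
  have hρ := UpperHalfPlane.ρ_sq
  have e2' : w ^ 2 = w - 1 := by rw [hw]; linear_combination hρ
  have hw0 : w ≠ 0 := by
    intro h; rw [h] at e2'; norm_num at e2'
  have e2 : w ^ (2 : ℤ) = w - 1 := by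
    rw [show (2 : ℤ) = (2 : ℕ) by rfl, zpow_natCast]; exact e2'
  have e4 : w ^ (4 : ℤ) = -w := by
    rw [show (4 : ℤ) = 2 + 2 by rfl, zpow_add₀ hw0, e2]; linear_combination e2'
  have e6 : w ^ (6 : ℤ) = 1 := by
    rw [show (6 : ℤ) = 4 + 2 by rfl, zpow_add₀ hw0, e2, e4]; linear_combination -e2'
  have e8 : w ^ (8 : ℤ) = w - 1 := by
    rw [show (8 : ℤ) = 6 + 2 by rfl, zpow_add₀ hw0, e6, e2]; ring
  have e10 : w ^ (10 : ℤ) = -w := by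
    rw [show (10 : ℤ) = 6 + 4 by rfl, zpow_add₀ hw0, e6, e4]; ring
  rw [e2, e4, e6, e8, e10, zpow_zero] at h1
  simp only [nsmul_eq_mul, mul_one, mul_neg] at h1
  have hwi : w.im ≠ 0 := by
    have : w.im = ρ.im := by rw [hw]; simp
    rw [this]; exact (ρ).im_ne_zero
  have him := congrArg Complex.im h1
  have hre := congrArg Complex.re h1
  simp only [Complex.add_im, Complex.add_re, Complex.neg_im, Complex.neg_re, Complex.mul_im,
    Complex.mul_re, Complex.natCast_re, Complex.natCast_im, Complex.sub_im, Complex.sub_re,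
    Complex.one_im, Complex.one_re, Complex.zero_re, Complex.zero_im, zero_mul, add_zero,
    sub_zero, zero_add] at him hre
  have h3 : ((cnt a 2 : ℝ) + cnt a 8) = cnt a 4 + cnt a 10 := by
    have : ((cnt a 2 : ℝ) + cnt a 8 - (cnt a 4 + cnt a 10)) * w.im = 0 := by linear_combination him
    rcases mul_eq_zero.mp this with h | h
    · linarith
    · exact absurd h hwi
  have h4 : (cnt a 0 : ℝ) + cnt a 6 = cnt a 2 + cnt a 8 := by
    have h5 : (cnt a 4 : ℝ) = cnt a 2 + cnt a 8 - cnt a 10 := by linarith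
    rw [h5] at hre
    linear_combination hre
  refine ⟨by exact_mod_cast h4, by exact_mod_cast h4.trans h3⟩

end

/-! ### Level `Γ0(N)` -/

lemma conj_one_zero (γ δ : SL(2, ℤ)) : (δ⁻¹ * γ * δ) 1 0 =
    δ 0 0 * (γ 1 0 * δ 0 0 + γ 1 1 * δ 1 0) - δ 1 0 * (γ 0 0 * δ 0 0 + γ 0 1 * δ 1 0) := by
  rw [Matrix.SpecialLinearGroup.coe_mul, Matrix.SpecialLinearGroup.coe_mul,
    Matrix.SpecialLinearGroup.coe_inv, Matrix.adjugate_fin_two]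
  simp only [Matrix.mul_apply, Fin.sum_univ_two, Matrix.cons_val_zero, Matrix.cons_val_one,
    Matrix.of_apply, Matrix.cons_val', Matrix.cons_val_fin_one]
  ring

lemma no_S {N : ℕ} (h4 : 4 ∣ N ∨ ∃ p : ℕ, p.Prime ∧ p ∣ N ∧ p % 4 = 3) (δ : SL(2, ℤ)) :
    δ⁻¹ * ModularGroup.S * δ ∉ Gamma0 N := by
  intro h
  rw [Gamma0_mem, ZMod.intCast_zmod_eq_zero_iff_dvd] at h
  have hdet : δ 0 0 * δ 1 1 - δ 0 1 * δ 1 0 = 1 := by rw [← Matrix.det_fin_two, δ.det_coe]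
  have he : (δ⁻¹ * ModularGroup.S * δ) 1 0 = δ 0 0 ^ 2 + δ 1 0 ^ 2 := by
    rw [conj_one_zero, ModularGroup.S]
    simp
    ring
  rw [he] at h
  rcases h4 with h4 | ⟨p, hp, hpN, hp4⟩
  · have h1 := (Int.natCast_dvd_natCast.mpr h4).trans h
    rw [← ZMod.intCast_zmod_eq_zero_iff_dvd] at h1
    have h2 := congrArg (Int.cast : ℤ → ZMod 4) hdet
    push_cast at h1 h2
    have key : ∀ x y u v : ZMod 4, x ^ 2 + y ^ 2 = 0 → x * u - v * y ≠ 1 := by decide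
    exact key _ _ _ _ h1 h2
  · have := Fact.mk hp
    have h1 := (Int.natCast_dvd_natCast.mpr hpN).trans h
    rw [← ZMod.intCast_zmod_eq_zero_iff_dvd] at h1
    have h2 := congrArg (Int.cast : ℤ → ZMod p) hdet
    push_cast at h1 h2
    by_cases h3 : (δ 1 0 : ZMod p) = 0
    · have h4 : (δ 0 0 : ZMod p) = 0 := by
        rw [h3] at h1; simpa using h1
      rw [h3, h4] at h2; simp at h2
    · exact ZMod.mod_four_ne_three_of_sq_eq_neg_sq' h3 (eq_neg_of_add_eq_zero_left h1) hp4

lemma eq_of_cube_eq {q : ℕ} [Fact q.Prime] (hq : q % 3 = 2) {x y : ZMod q}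
    (h : x ^ 3 = y ^ 3) : x = y := by
  have key : ∀ x : ZMod q, (x ^ 3) ^ (2 * (q / 3) + 1) = x := by
    intro x
    rw [← pow_mul]
    by_cases hx : x = 0
    · rw [hx, zero_pow (by omega)]
    · rw [show 3 * (2 * (q / 3) + 1) = q + (q - 1) by omega, pow_add, ZMod.pow_card,
        ZMod.pow_card_sub_one_eq_one hx, mul_one]
  rw [← key x, h, key]

lemma no_R {N : ℕ} (h9 : 9 ∣ N ∨ ∃ p : ℕ, p.Prime ∧ p ∣ N ∧ p % 3 = 2) (δ : SL(2, ℤ)) :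
    δ⁻¹ * (ModularGroup.S * ModularGroup.T) * δ ∉ Gamma0 N := by
  intro h
  rw [Gamma0_mem, ZMod.intCast_zmod_eq_zero_iff_dvd] at h
  have hdet : δ 0 0 * δ 1 1 - δ 0 1 * δ 1 0 = 1 := by rw [← Matrix.det_fin_two, δ.det_coe]
  have he : (δ⁻¹ * (ModularGroup.S * ModularGroup.T) * δ) 1 0 =
      δ 0 0 ^ 2 + δ 0 0 * δ 1 0 + δ 1 0 ^ 2 := by
    rw [conj_one_zero, Matrix.SpecialLinearGroup.coe_mul, ModularGroup.S, ModularGroup.T]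
    simp
    ring
  rw [he] at h
  rcases h9 with h4 | ⟨p, hp, hpN, hp3⟩
  · have h1 := (Int.natCast_dvd_natCast.mpr h4).trans h
    rw [← ZMod.intCast_zmod_eq_zero_iff_dvd] at h1
    have h2 := congrArg (Int.cast : ℤ → ZMod 9) hdet
    push_cast at h1 h2
    have key : ∀ x y : ZMod 9, x ^ 2 + x * y + y ^ 2 = 0 → 3 * x = 0 ∧ 3 * y = 0 := by decide
    obtain ⟨h5, h6⟩ := key _ _ h1
    have h7 : (3 : ZMod 9) = 0 := by linear_combination -3 * h2 + δ 1 1 * h5 - δ 0 1 * h6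
    exact absurd h7 (by decide)
  · have := Fact.mk hp
    have h1 := (Int.natCast_dvd_natCast.mpr hpN).trans h
    rw [← ZMod.intCast_zmod_eq_zero_iff_dvd] at h1
    have h2 := congrArg (Int.cast : ℤ → ZMod p) hdet
    push_cast at h1 h2
    have h3 : (δ 0 0 : ZMod p) = δ 1 0 := eq_of_cube_eq hp3 (by
      linear_combination ((δ 0 0 : ZMod p) - δ 1 0) * h1)
    rw [h3] at h1 h2
    have h4 : ((3 : ℕ) : ZMod p) ≠ 0 := by
      rw [Ne, ZMod.natCast_eq_zero_iff]
      intro hd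
      rw [(Nat.prime_dvd_prime_iff_eq hp Nat.prime_three).mp hd] at hp3
      omega
    have h5 : (δ 1 0 : ZMod p) ^ 2 = 0 := by
      refine (mul_eq_zero.mp (?_ : ((3 : ℕ) : ZMod p) * _ = 0)).resolve_left h4
      push_cast; linear_combination h1
    rw [pow_eq_zero_iff two_ne_zero] at h5
    rw [h5] at h2; simp at h2

end

section

variable {Γ : Subgroup SL(2, ℤ)} {k l : ℤ} {f g : ℍ → ℂ}

/-! ### Eisenstein series of level `N` -/

/-- The function `z ↦ E₄(n z)`. -/
def Ed (n : ℕ) (z : ℍ) : ℂ := E4 (ofComplex (n * z))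

lemma Ed_mdiff {n : ℕ} (hn : 0 < n) : MDiff (Ed n) := by
  have h1 := UpperHalfPlane.mdifferentiable_iff.mp E4_mem.1
  rw [UpperHalfPlane.mdifferentiable_iff]
  have him : ∀ z : ℂ, ((n : ℂ) * z).im = n * z.im := fun z ↦ by simp [Complex.mul_im]
  have h2 : DifferentiableOn ℂ (fun z : ℂ ↦ (E4 ∘ ofComplex) (n * z)) {z | 0 < z.im} := by
    refine h1.comp (f := fun z : ℂ ↦ (n : ℂ) * z) (by fun_prop) fun z hz ↦ ?_
    simp only [Set.mem_ofPred_eq] at hz ⊢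
    rw [him]; positivity
  refine h2.congr fun z hz ↦ ?_
  simp only [Function.comp, Ed]
  rw [ofComplex_apply_of_im_pos hz]

lemma Ed_slash {n : ℕ} (hn : 0 < n) (γ : SL(2, ℤ)) : ∃ b : ℤ, ∀ z : ℍ,
    (Ed n ∣[(4 : ℤ)] γ) z = ((n / n.gcd (γ 1 0).natAbs : ℕ) : ℂ) ^ (-4 : ℤ) *
      E4 (ofComplex (((n.gcd (γ 1 0).natAbs : ℕ) * z + b) / (n / n.gcd (γ 1 0).natAbs : ℕ))) := by
  set a := n.gcd (γ 1 0).natAbs with ha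
  have ha0 : 0 < a := Nat.gcd_pos_of_pos_left _ hn
  obtain ⟨d, hd⟩ : a ∣ n := Nat.gcd_dvd_left _ _
  obtain ⟨v, hv⟩ : (a : ℤ) ∣ γ 1 0 := Int.natCast_dvd.mpr (Nat.gcd_dvd_right _ _)
  have hd0 : 0 < d := by
    rcases Nat.eq_zero_or_pos d with h | h
    · rw [h] at hd; omega
    · exact h
  have hnd : n / a = d := by rw [hd]; exact Nat.mul_div_cancel_left _ ha0
  rw [hnd]
  have hdet : γ 0 0 * γ 1 1 - γ 0 1 * γ 1 0 = 1 := by rw [← Matrix.det_fin_two, γ.det_coe]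
  have hdv : IsCoprime (d : ℤ) v := by
    rw [Int.isCoprime_iff_gcd_eq_one, Int.gcd_eq_natAbs, Int.natAbs_natCast]
    have h1 : (γ 1 0).natAbs = a * v.natAbs := by rw [hv, Int.natAbs_mul, Int.natAbs_natCast]
    have h2 : a * (d.gcd v.natAbs) = a * 1 := by rw [← Nat.gcd_mul_left, ← hd, ← h1, mul_one]
    exact Nat.eq_of_mul_eq_mul_left ha0 h2
  have hpv : IsCoprime (γ 0 0) v := ⟨γ 1 1, -γ 0 1 * a, by rw [hv] at hdet; linear_combination hdet⟩
  obtain ⟨x, y, hxy⟩ : IsCoprime ((d : ℤ) * γ 0 0) v := hdv.mul_left hpv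
  obtain ⟨δ, hδ⟩ : ∃ δ : SL(2, ℤ), (δ : Matrix (Fin 2) (Fin 2) ℤ) = !![d * γ 0 0, -y; v, x] :=
    ⟨⟨!![d * γ 0 0, -y; v, x], by rw [Matrix.det_fin_two_of]; linear_combination hxy⟩, rfl⟩
  refine ⟨x * n * γ 0 1 + y * γ 1 1, fun z ↦ ?_⟩
  set b : ℤ := x * n * γ 0 1 + y * γ 1 1 with hb
  have hdC : (d : ℂ) ≠ 0 := by exact_mod_cast hd0.ne'
  have hw : 0 < (((a : ℂ) * z + b) / d).im := by
    have h1 : (((a : ℂ) * z + b) / d) = ((a : ℝ) / d : ℝ) * z + ((b : ℝ) / d : ℝ) := by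
      push_cast; field_simp
    rw [h1, Complex.add_im, Complex.im_ofReal_mul, Complex.ofReal_im, add_zero]
    have := z.im_pos
    positivity
  rw [ofComplex_apply_of_im_pos hw]
  set w : ℍ := ⟨((a : ℂ) * z + b) / d, hw⟩ with hwdef
  have hwc : (w : ℂ) = ((a : ℂ) * z + b) / d := rfl
  have hnz := denom_ne γ z
  have hnC : (n : ℂ) = a * d := by exact_mod_cast hd
  have hrC : ((γ 1 0 : ℤ) : ℂ) = a * v := by exact_mod_cast hv
  have hdC' := congrArg (Int.cast : ℤ → ℂ) hdet
  have hxC := congrArg (Int.cast : ℤ → ℂ) hxy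
  push_cast at hdC' hxC
  have hbC : (b : ℂ) = x * n * γ 0 1 + y * γ 1 1 := by rw [hb]; push_cast; ring
  have hden : denom δ w = denom γ z / d := by
    rw [ModularGroup.denom_apply, ModularGroup.denom_apply, hδ, hwc, eq_div_iff hdC]
    simp only [Matrix.of_apply, Matrix.cons_val', Matrix.cons_val_zero, Matrix.cons_val_one,
      Matrix.cons_val_fin_one]
    field_simp
    rw [hbC, hnC, hrC]
    rw [hrC] at hdC'
    linear_combination (γ 1 1 : ℂ) * hxC - d * x * hdC'
  have hsm : ofComplex (n * (γ • z : ℍ)) = δ • w := by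
    have h1 : ((δ • w : ℍ) : ℂ) = n * (γ • z : ℍ) := by
      rw [coe_specialLinearGroup_apply, coe_specialLinearGroup_apply]
      have e1 := hden
      rw [ModularGroup.denom_apply, ModularGroup.denom_apply] at e1
      rw [ModularGroup.denom_apply] at hnz
      simp only [algebraMap_int_eq, eq_intCast, Complex.ofReal_intCast]
      rw [e1, hδ, hwc]
      simp only [Matrix.of_apply, Matrix.cons_val', Matrix.cons_val_zero, Matrix.cons_val_one,
        Matrix.cons_val_fin_one]
      rw [div_eq_iff (div_ne_zero hnz hdC), mul_assoc, div_mul_div_cancel₀ hnz]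
      field_simp
      push_cast
      rw [hbC, hnC]
      rw [hrC] at hdC'
      linear_combination d * a * γ 0 1 * hxC + d * y * hdC'
    rw [← h1, ofComplex_apply]
  rw [SL_slash_apply, Ed, hsm, top_smul E4_mem, hden, div_zpow, zpow_neg, zpow_neg]
  have := zpow_ne_zero 4 hnz
  have := zpow_ne_zero 4 hdC
  field_simp

lemma Ed_slash_tendsto {n : ℕ} (hn : 0 < n) (γ : SL(2, ℤ)) : Tendsto (Ed n ∣[(4 : ℤ)] γ) atImInfty
    (𝓝 (((n / n.gcd (γ 1 0).natAbs : ℕ) : ℂ) ^ (-4 : ℤ))) := by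
  obtain ⟨b, hb⟩ := Ed_slash hn γ
  set a := n.gcd (γ 1 0).natAbs with ha
  have ha0 : 0 < a := Nat.gcd_pos_of_pos_left _ hn
  have hd0 : 0 < n / a := Nat.div_pos (Nat.gcd_le_left _ hn) ha0
  set d := n / a
  have h1 : Tendsto (fun z : ℍ ↦ ofComplex (((a : ℂ) * z + b) / d)) atImInfty atImInfty := by
    rw [atImInfty, tendsto_comap_iff]
    have h2 : ∀ z : ℍ, (((a : ℂ) * z + b) / d).im = (a : ℝ) / d * z.im := fun z ↦ by
      have h1 : (((a : ℂ) * z + b) / d) = ((a : ℝ) / d : ℝ) * z + ((b : ℝ) / d : ℝ) := by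
        push_cast
        have : (d : ℂ) ≠ 0 := by exact_mod_cast hd0.ne'
        field_simp
      rw [h1, Complex.add_im, Complex.im_ofReal_mul, Complex.ofReal_im, add_zero]
      rfl
    have h3 : (UpperHalfPlane.im ∘ fun z : ℍ ↦ ofComplex (((a : ℂ) * z + b) / d)) =
        fun z ↦ (a : ℝ) / d * z.im := by
      ext z
      have hz := z.im_pos
      have h4 : 0 < (((a : ℂ) * z + b) / d).im := by rw [h2]; positivity
      rw [Function.comp, ofComplex_apply_of_im_pos h4]
      exact h2 z
    rw [h3]
    exact (tendsto_comap).const_mul_atTop (by positivity)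
  have h2 := (E4_tendsto.comp h1).const_mul ((d : ℂ) ^ (-4 : ℤ))
  rw [mul_one] at h2
  exact h2.congr fun z ↦ (hb z).symm

lemma E4_int_periodic (b : ℤ) (w : ℍ) : E4 ((b : ℝ) +ᵥ w) = E4 w := by
  rw [← modular_T_zpow_smul, top_smul E4_mem, ModularGroup.denom_apply, ModularGroup.coe_T_zpow]
  simp

lemma Ed_mem {n : ℕ} (hn : 0 < n) : Ed n ∈ MF (Gamma0 n) 4 := by
  refine ⟨Ed_mdiff hn, fun γ hγ ↦ ?_, fun γ ↦ (Ed_slash_tendsto hn γ).isBigO_one ℝ⟩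
  rw [Gamma0_mem, ZMod.intCast_zmod_eq_zero_iff_dvd] at hγ
  obtain ⟨b, hb⟩ := Ed_slash hn γ
  have h1 : n.gcd (γ 1 0).natAbs = n := Nat.gcd_eq_left (Int.natCast_dvd.mp hγ)
  rw [h1, Nat.div_self hn] at hb
  ext z
  have h2 : 0 < ((n : ℂ) * z).im := by
    have := z.im_pos
    rw [← Complex.ofReal_natCast, Complex.im_ofReal_mul]; positivity
  have h3 : ((n : ℂ) * z + b) = ((b : ℝ) +ᵥ (⟨n * z, h2⟩ : ℍ) : ℍ) := by
    rw [coe_vadd]; simp [add_comm]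
  rw [hb, Nat.cast_one, div_one, one_zpow, one_mul, h3, ofComplex_apply, E4_int_periodic, Ed,
    ofComplex_apply_of_im_pos h2]

lemma Gamma0_le {m n : ℕ} (h : m ∣ n) : Gamma0 n ≤ Gamma0 m := fun γ hγ ↦ by
  rw [Gamma0_mem, ZMod.intCast_zmod_eq_zero_iff_dvd] at hγ ⊢
  exact (Int.natCast_dvd_natCast.mpr h).trans hγ

lemma Ed_sep {n : ℕ} (hn : 0 < n) : Sep (Gamma0 n) (Ed n) := by
  refine ⟨Ed_mem hn, fun i j hij ↦ ?_⟩
  have h1 : Ed n ∣[(4 : ℤ)] (i.out⁻¹ * j.out) = Ed n := by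
    rw [SlashAction.slash_mul, show Ed n ∣[(4 : ℤ)] i.out⁻¹ = Ed n ∣[(4 : ℤ)] j.out⁻¹ from hij,
      ← SlashAction.slash_mul, inv_mul_cancel, SlashAction.slash_one]
  have h2 := Ed_slash_tendsto hn (i.out⁻¹ * j.out)
  have h3 := Ed_slash_tendsto hn 1
  rw [SlashAction.slash_one] at h3
  rw [h1] at h2
  have h4 := tendsto_nhds_unique h2 h3
  rw [← QuotientGroup.out_eq' i, ← QuotientGroup.out_eq' j]
  refine QuotientGroup.eq.mpr ?_
  rw [Gamma0_mem, ZMod.intCast_zmod_eq_zero_iff_dvd]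
  simp only [Matrix.SpecialLinearGroup.coe_one, ne_eq, one_ne_zero, not_false_eq_true,
    Matrix.one_apply_ne, Int.natAbs_zero, Nat.gcd_zero_right, Nat.div_self hn, Nat.cast_one,
    one_zpow] at h4
  set a := n.gcd ((i.out⁻¹ * j.out) 1 0).natAbs with ha
  have h5 : (n / a) ^ 4 = 1 := by
    rw [zpow_neg, inv_eq_one] at h4
    exact_mod_cast h4
  have h6 : n / a = 1 := by
    simpa using h5
  have h7 : a = n := by
    rw [← Nat.div_mul_cancel (Nat.gcd_dvd_left n _ : a ∣ n), h6, one_mul]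
  rw [Int.natCast_dvd]
  exact h7.symm.dvd.trans (Nat.gcd_dvd_right _ _)

/-- Three Eisenstein series of weight four at composite level. -/
lemma rank_three {n : ℕ} (hn1 : 1 < n) (hn : ¬ n.Prime)
    (fin : FiniteDimensional ℂ (MF (Gamma0 n) 4)) :
    3 + Module.finrank ℂ (SF (Gamma0 n) 4) ≤ Module.finrank ℂ (MF (Gamma0 n) 4) := by
  obtain ⟨p, hp, hpn⟩ := Nat.exists_prime_and_dvd hn1.ne'
  have hn0 : 0 < n := by omega
  have hpne : p ≠ n := fun h ↦ hn (h ▸ hp)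
  have hp2 := hp.two_le
  have hmem : ∀ (c : Fin 3 → ℂ) (φ : SF (Gamma0 n) 4),
      c 0 • E4 + c 1 • Ed p + c 2 • Ed n + (φ : ℍ → ℂ) ∈ MF (Gamma0 n) 4 := fun c φ ↦
    add_mem (add_mem (add_mem (Submodule.smul_mem _ _ E4_mem')
      (Submodule.smul_mem _ _ (MF_mono (Gamma0_le hpn) (Ed_mem hp.pos))))
      (Submodule.smul_mem _ _ (Ed_mem hn0))) (SF_le_MF φ.2)
  let L : ((Fin 3 → ℂ) × SF (Gamma0 n) 4) →ₗ[ℂ] MF (Gamma0 n) 4 :=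
    { toFun := fun x ↦ ⟨_, hmem x.1 x.2⟩
      map_add' := fun x y ↦ by
        ext z
        simp only [Prod.fst_add, Prod.snd_add, Submodule.coe_add, Pi.add_apply, Pi.smul_apply,
          smul_eq_mul]
        ring
      map_smul' := fun c x ↦ by
        ext z
        simp only [Prod.smul_fst, Prod.smul_snd, Submodule.coe_smul, Pi.add_apply, Pi.smul_apply,
          smul_eq_mul, RingHom.id_apply]
        ring }
  have hinj : Function.Injective L := by
    rw [injective_iff_map_eq_zero]
    rintro ⟨c, φ⟩ hx
    have hx' : c 0 • E4 + c 1 • Ed p + c 2 • Ed n + (φ : ℍ → ℂ) = 0 := congrArg Subtype.val hx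
    have hlim : ∀ γ : SL(2, ℤ), c 0 + c 1 * ((p / p.gcd (γ 1 0).natAbs : ℕ) : ℂ) ^ (-4 : ℤ) +
        c 2 * ((n / n.gcd (γ 1 0).natAbs : ℕ) : ℂ) ^ (-4 : ℤ) = 0 := by
      intro γ
      have h1 := ((E4_tendsto.const_mul (c 0)).add ((Ed_slash_tendsto hp.pos γ).const_mul (c 1))).add
        ((Ed_slash_tendsto hn0 γ).const_mul (c 2)) |>.add (φ.2.2.2 γ)
      rw [mul_one, add_zero] at h1
      refine tendsto_nhds_unique h1 ((tendsto_const_nhds (x := (0 : ℂ))).congr fun z ↦ ?_)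
      have h2 := congrFun (congrArg (fun F ↦ F ∣[(4 : ℤ)] γ) hx') z
      simp only [SlashAction.add_slash, ModularForm.SL_smul_slash, SlashAction.zero_slash,
        slash_top E4_mem] at h2
      exact h2.symm
    have hc1 := hlim 1
    have hcS := hlim ModularGroup.S
    obtain ⟨δ, hδ⟩ : ∃ δ : SL(2, ℤ), δ 1 0 = p :=
      ⟨⟨!![1, 0; p, 1], by rw [Matrix.det_fin_two_of]; ring⟩, rfl⟩
    have hcδ := hlim δ
    simp only [Matrix.SpecialLinearGroup.coe_one, ne_eq, one_ne_zero, not_false_eq_true,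
      Matrix.one_apply_ne, Int.natAbs_zero, Nat.gcd_zero_right, Nat.div_self hn0, Nat.cast_one,
      one_zpow, Nat.div_self hp.pos, mul_one] at hc1
    rw [hδ, Int.natAbs_natCast, Nat.gcd_self, Nat.div_self hp.pos, Nat.gcd_eq_right hpn,
      Nat.cast_one, one_zpow, mul_one] at hcδ
    have hS : ModularGroup.S 1 0 = 1 := by simp [ModularGroup.S]
    rw [hS, Int.natAbs_one, Nat.gcd_one_right, Nat.gcd_one_right, Nat.div_one, Nat.div_one] at hcS
    have hq : ∀ m : ℕ, 1 < m → ((m : ℂ) ^ (-4 : ℤ)) ≠ 1 := by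
      intro m hm h
      rw [zpow_neg, inv_eq_one] at h
      have h5 : m ^ 4 = 1 := by exact_mod_cast h
      simp at h5; omega
    have h2 : c 2 = 0 := by
      have h3 : c 2 * (((n / p : ℕ) : ℂ) ^ (-4 : ℤ) - 1) = 0 := by linear_combination hcδ - hc1
      refine (mul_eq_zero.mp h3).resolve_right (sub_ne_zero.mpr (hq _ ?_))
      obtain ⟨m, rfl⟩ := hpn
      rw [Nat.mul_div_cancel_left _ hp.pos]
      rcases m with _ | _ | m
      · simp at hn0
      · simp at hpne
      · omega
    have h1 : c 1 = 0 := by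
      rw [h2] at hc1 hcS
      have h3 : c 1 * ((p : ℂ) ^ (-4 : ℤ) - 1) = 0 := by linear_combination hcS - hc1
      exact (mul_eq_zero.mp h3).resolve_right (sub_ne_zero.mpr (hq _ hp.one_lt))
    have h0 : c 0 = 0 := by rw [h2, h1] at hc1; simpa using hc1
    rw [h0, h1, h2] at hx'
    simp only [zero_smul, zero_add] at hx'
    refine Prod.ext ?_ (Subtype.ext hx')
    ext i
    fin_cases i
    exacts [h0, h1, h2]
  have h1 := LinearMap.finrank_le_finrank_of_injective hinj
  have hfs : FiniteDimensional ℂ (SF (Gamma0 n) 4) :=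
    Submodule.finiteDimensional_of_le SF_le_MF
  rwa [Module.finrank_prod, Module.finrank_pi, Fintype.card_fin] at h1

/-- The numerical input: a pair of dual bases, together with the dimensions of the spaces of
modular forms of small weight. -/
structure Level (Γ : Subgroup SL(2, ℤ)) [Γ.FiniteIndex] (a : Cos Γ → ℤ) (e s : Cos Γ → ℍ → ℂ)
    (d g : ℤ) : Prop extends Dual Γ a e s where
  sep : ∃ E, Sep Γ E
  nonneg : ∀ i, 0 ≤ a i
  even : ∀ i, Even (a i)
  cntS : cnt a 0 + cnt a 4 + cnt a 8 = cnt a 2 + cnt a 6 + cnt a 10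
  cntR : cnt a 0 + cnt a 6 = cnt a 4 + cnt a 10
  num : Num Γ d g
  ineq : 2 * g + 1 ≤ d

theorem Gamma0_level {n : ℕ} [NeZero n] (hn1 : 1 < n) (hn : ¬ n.Prime)
    (h4 : 4 ∣ n ∨ ∃ p : ℕ, p.Prime ∧ p ∣ n ∧ p % 4 = 3)
    (h9 : 9 ∣ n ∨ ∃ p : ℕ, p.Prime ∧ p ∣ n ∧ p % 3 = 2) :
    ∃ (a : Cos (Gamma0 n) → ℤ) (e s : Cos (Gamma0 n) → ℍ → ℂ) (d g : ℤ),
      Level (Gamma0 n) a e s d g := by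
  have hn0 : 0 < n := by omega
  have hneg : -1 ∈ Gamma0 n := by simp [Gamma0_mem]
  have hs := Ed_sep hn0
  obtain ⟨a, e, h, hne⟩ := exists_FB hneg hs
  have hev : ∀ i, Even (a i) := fun i ↦ by
    by_contra hi
    exact hne i (odd_MF hneg (Int.not_even_iff_odd.mp hi) (h.mem i))
  have h0 : ∀ i, 0 ≤ a i := fun i ↦ by
    by_contra! hi
    exact hne i (MF_neg hi (h.mem i))
  obtain ⟨s, hD⟩ := h.exists_dual hs hev
  obtain ⟨hR1, hR2⟩ := h.elliptic_R hs h0 (hD.le_ten hev) hev (no_R h9)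
  have hS := h.elliptic_S hs h0 (hD.le_ten hev) hev (no_S h4)
  obtain ⟨d, g, hN⟩ := hD.num (finite_MF hs) h0 hev hS hR1 hR2
  refine ⟨a, e, s, d, g, hD, ⟨_, hs⟩, h0, hev, hS, hR2, hN, ?_⟩
  have h3 := rank_three hn1 hn (hN.fin 4)
  have := hN.r4
  have := hN.s4
  omega

end

section

variable {Γ : Subgroup SL(2, ℤ)} {k l : ℤ} {f g : ℍ → ℂ}

/-! ### Generic vectors -/

lemma exists_generic_pi {n : ℕ} {ι : Type*} [Countable ι] (L : ι → (Fin n → ℂ) →ₗ[ℂ] ℂ)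
    (hL : ∀ i, L i ≠ 0) : ∃ v, ∀ i, L i v ≠ 0 := by
  by_contra! h
  have h1 : (⋃ i, ((LinearMap.ker (L i)).restrictScalars ℝ : Set (Fin n → ℂ))) = Set.univ := by
    refine Set.eq_univ_of_forall fun v ↦ ?_
    obtain ⟨i, hi⟩ := h v
    exact Set.mem_iUnion.mpr ⟨i, hi⟩
  have h2 : (MeasureTheory.volume : MeasureTheory.Measure (Fin n → ℂ))
      (⋃ i, ((LinearMap.ker (L i)).restrictScalars ℝ : Set (Fin n → ℂ))) = 0 := by
    refine MeasureTheory.measure_iUnion_null fun i ↦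
      MeasureTheory.Measure.addHaar_submodule _ _ fun ht ↦ hL i ?_
    rw [Submodule.restrictScalars_eq_top_iff] at ht
    exact LinearMap.ker_eq_top.mp ht
  rw [h1] at h2
  exact (MeasureTheory.Measure.measure_univ_pos.mpr (NeZero.ne _)).ne' h2

lemma exists_generic {V : Type*} [AddCommGroup V] [Module ℂ V] [FiniteDimensional ℂ V]
    {ι : Type*} [Countable ι] (L : ι → V →ₗ[ℂ] ℂ) (hL : ∀ i, ∃ v, L i v ≠ 0) :
    ∃ v, ∀ i, L i v ≠ 0 := by
  let b := (Module.finBasis ℂ V).equivFun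
  obtain ⟨v, hv⟩ := exists_generic_pi (fun i ↦ (L i).comp b.symm.toLinearMap) fun i h0 ↦ by
    obtain ⟨v, hv⟩ := hL i
    refine hv ?_
    simpa using LinearMap.congr_fun h0 (b v)
  exact ⟨b.symm v, hv⟩

/-! ### Evaluation functionals -/

/-- The laws of an evaluation of modular forms at a point or at a cusp. -/
structure Pt (Γ : Subgroup SL(2, ℤ)) (ev : ℤ → (ℍ → ℂ) → ℂ) : Prop where
  one : ev 0 1 = 1
  add : ∀ {k f g}, f ∈ MF Γ k → g ∈ MF Γ k → ev k (f + g) = ev k f + ev k g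
  smul : ∀ {k f} (c : ℂ), f ∈ MF Γ k → ev k (c • f) = c * ev k f
  mul : ∀ {k l m f g}, k + l = m → f ∈ MF Γ k → g ∈ MF Γ l → ev m (f * g) = ev k f * ev l g

lemma Pt.zero {ev} (h : Pt Γ ev) (k : ℤ) : ev k 0 = 0 := by
  have := h.smul (k := k) 0 (zero_mem _)
  simpa using this

lemma Pt.sum {ev} (h : Pt Γ ev) {ι : Type*} (t : Finset ι) {F : ι → ℍ → ℂ}
    (hF : ∀ i ∈ t, F i ∈ MF Γ k) : ev k (∑ i ∈ t, F i) = ∑ i ∈ t, ev k (F i) := by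
  classical
  induction t using Finset.induction_on with
  | empty => simpa using h.zero k
  | insert x t hx ih =>
    rw [Finset.sum_insert hx, Finset.sum_insert hx, h.add (hF x (Finset.mem_insert_self _ _))
      (sum_mem fun i hi ↦ hF i (Finset.mem_insert_of_mem hi)),
      ih fun i hi ↦ hF i (Finset.mem_insert_of_mem hi)]

lemma pt_point (z : ℍ) : Pt Γ fun _ f ↦ f z :=
  ⟨rfl, fun _ _ ↦ rfl, fun _ _ ↦ rfl, fun _ _ _ ↦ rfl⟩

/-! ### Base point freeness -/

lemma no_embed {d g : ℤ} (hN : Num Γ d g) (hdg : 2 * g + 1 ≤ d) {w : ℤ} {n P : ℍ → ℂ}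
    (hn : n ∈ MF Γ w) (hn0 : n ≠ 0) (hP : P ∈ MF Γ w) (hP0 : P ≠ 0)
    (h : ∀ b ∈ MF Γ 2, ∃ c ∈ SF Γ 2, n * b = P * c) : False := by
  choose F hF hF' using fun b : MF Γ 2 ↦ h b b.2
  have huniq : ∀ {x y : ℍ → ℂ}, x ∈ SF Γ 2 → y ∈ SF Γ 2 → P * x = P * y → x = y :=
    fun hx hy ↦ mul_cancel_MF hP.1 hx.1 hy.1 hP0
  let L : MF Γ 2 →ₗ[ℂ] SF Γ 2 :=
    { toFun := fun b ↦ ⟨F b, hF b⟩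
      map_add' := fun x y ↦ Subtype.ext (huniq (hF _) (add_mem (hF _) (hF _)) (by
        rw [← hF', Submodule.coe_add, Submodule.coe_add, mul_add, mul_add, hF', hF']))
      map_smul' := fun c x ↦ Subtype.ext (huniq (hF _) (Submodule.smul_mem _ _ (hF _)) (by
        rw [← hF', RingHom.id_apply, Submodule.coe_smul, Submodule.coe_smul, mul_smul_comm,
          mul_smul_comm, hF'])) }
  have hinj : Function.Injective L := by
    rw [injective_iff_map_eq_zero]
    intro b hb
    have h1 : F b = 0 := congrArg Subtype.val hb
    have h2 := hF' b
    rw [h1, mul_zero] at h2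
    exact Subtype.ext (mul_cancel_MF hn.1 b.2.1 mdifferentiable_const hn0
      (h2.trans (mul_zero n).symm))
  have := hN.fin 2
  have : FiniteDimensional ℂ (SF Γ 2) := Submodule.finiteDimensional_of_le SF_le_MF
  have h3 := LinearMap.finrank_le_finrank_of_injective hinj
  have := hN.r2
  have := hN.s2
  omega

section

variable [Γ.FiniteIndex] {a : Cos Γ → ℤ} {e s : Cos Γ → ℍ → ℂ}

lemma pt_cusp (γ : SL(2, ℤ)) : Pt Γ fun k f ↦ valueAtInfty (f ∣[k] γ) := by
  refine ⟨?_, fun {k f g} hf hg ↦ val_eq ?_, fun {k f} c hf ↦ val_eq ?_,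
    fun {k l m f g} hm hf hg ↦ val_eq ?_⟩
  · rw [show (1 : ℍ → ℂ) ∣[(0 : ℤ)] γ = 1 from slash_top one_MF γ]
    exact val_eq tendsto_const_nhds
  · rw [SlashAction.add_slash]
    exact (tendsto_slash hf γ).add (tendsto_slash hg γ)
  · rw [SL_smul_slash]
    exact (tendsto_slash hf γ).const_smul c
  · subst hm
    rw [mul_slash_SL2]
    exact (tendsto_slash hf γ).mul (tendsto_slash hg γ)

lemma bpf_core (hD : Dual Γ a e s) {d g : ℤ} (hN : Num Γ d g) (hdg : 2 * g + 1 ≤ d) {ev}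
    (hev : Pt Γ ev) (h2 : ∀ b ∈ MF Γ 2, ev 2 b = 0) {w : ℤ} {α : Cos Γ → ℍ → ℂ}
    (hα : ∀ j, α j ∈ MF ⊤ (w - (12 - a j))) {C : ℤ → Prop}
    (hC : ∀ k, C k → ∀ j, ∀ φ ∈ MF ⊤ (k - a j),
      ev (k - a j) φ * ev (w - (12 - a j)) (α j) = ev (k - a j) φ * ev (a j) (e j))
    {k₀ : ℤ} (hk₀ : C k₀) {f₀ : ℍ → ℂ} (hf₀ : f₀ ∈ MF Γ k₀) (hne : ev k₀ f₀ ≠ 0)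
    {P : ℍ → ℂ} (hP : P ∈ MF ⊤ w) (hP0 : P ≠ 0)
    (hdiv : ∀ i, ∀ β ∈ MF ⊤ (w + 2 - (12 - a i)),
      (C (2 + a i) → ev (w + 2 - (12 - a i)) β = 0) → ∃ β' ∈ MF ⊤ (2 - (12 - a i)), β = P * β') :
    False := by
  set n := ∑ j, α j * s j with hn
  have hnS : n ∈ SF Γ w := hD.comb_mem hα
  have htr : ∀ {k m : ℤ} {f : ℍ → ℂ}, f ∈ MF Γ k → k + w = m → ∃ θ ∈ MF ⊤ (k + w - 12),
      tr Γ m (f * n) = θ * Dl ∧ (C k → ev (k + w - 12) θ = ev k f) := by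
    intro k m f hf hm
    obtain ⟨φ, hφ, rfl⟩ := hD.gen hf
    have hmem : ∀ j, φ j * α j ∈ MF ⊤ (k + w - 12) := fun j ↦
      mul_MF' (hφ j) (hα j) (by ring)
    refine ⟨∑ j, φ j * α j, sum_mem fun j _ ↦ hmem j, hD.tr_comb hm hφ hα, fun hk ↦ ?_⟩
    rw [hev.sum _ fun j _ ↦ MF_top_le (hmem j), hev.sum _ fun j _ ↦
      mul_MF' (m := k) (MF_top_le (hφ j)) (hD.mem j) (by ring)]
    refine Finset.sum_congr rfl fun j _ ↦ ?_
    rw [hev.mul (by ring) (MF_top_le (hφ j)) (MF_top_le (hα j)), hC k hk j _ (hφ j),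
      ← hev.mul (by ring) (MF_top_le (hφ j)) (hD.mem j)]
  have hn0 : n ≠ 0 := by
    intro h0
    obtain ⟨θ, hθ, h1, h2⟩ := htr hf₀ rfl
    rw [h0, mul_zero, show tr Γ (k₀ + w) (0 : ℍ → ℂ) = 0 by simp [tr, comp_zero]] at h1
    rw [mul_Dl_cancel h1.symm, hev.zero] at h2
    exact hne (h2 hk₀).symm
  refine no_embed hN hdg (SF_le_MF hnS) hn0 (MF_top_le hP) hP0 fun b hb ↦ ?_
  obtain ⟨β, hβ, hβ'⟩ := hD.expand (mul_SF_MF hnS hb rfl)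
  have hβd : ∀ i, ∃ β' ∈ MF ⊤ (2 - (12 - a i)), β i = P * β' := by
    intro i
    refine hdiv i _ (hβ i) fun hc ↦ ?_
    have h1 := hD.tr_e hβ i (m := w + 2 + a i) rfl
    rw [← hβ', mul_assoc, mul_comm] at h1
    obtain ⟨θ, hθ, h3, h4⟩ := htr (mul_MF' hb (hD.mem i) rfl)
      (show 2 + a i + w = w + 2 + a i by ring)
    have h5 : (θ - β i) * Dl = 0 := by rw [sub_mul, ← h3, ← h1, sub_self]
    rw [← sub_eq_zero.mp (mul_Dl_cancel h5), show w + 2 - (12 - a i) = 2 + a i + w - 12 by ring,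
      h4 hc, hev.mul rfl hb (hD.mem i), h2 b hb, zero_mul]
  choose β' hβm hβe using hβd
  refine ⟨∑ i, β' i * s i, hD.comb_mem hβm, ?_⟩
  rw [hβ', Finset.mul_sum]
  exact Finset.sum_congr rfl fun i _ ↦ by rw [hβe, mul_assoc]

end

end

section

variable {Γ : Subgroup SL(2, ℤ)} {k l : ℤ} {f g : ℍ → ℂ}

lemma exists_four_six {n : ℕ} (h : Even n) (h2 : n ≠ 2) : ∃ x y : ℕ, 4 * x + 6 * y = n := by
  obtain ⟨m, rfl⟩ := h
  rcases Nat.even_or_odd m with ⟨r, rfl⟩ | ⟨r, rfl⟩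
  · exact ⟨r, 0, by ring⟩
  · exact ⟨r - 1, 1, by omega⟩

lemma top_vanish {q : ℤ} {z : ℍ} (hq : q ∣ 12)
    (h : ∀ x y : ℕ, ¬ q ∣ 4 * x + 6 * y → EE x y z = 0) {m : ℤ} {φ : ℍ → ℂ} (hφ : φ ∈ MF ⊤ m)
    (hm : ¬ q ∣ m) : φ z = 0 := by
  rcases lt_or_ge m 0 with hneg | hpos
  · rw [MF_top_neg hneg hφ]; rfl
  lift m to ℕ using hpos
  induction m using Nat.strong_induction_on generalizing φ with
  | _ m ih =>
    rcases Nat.even_or_odd m with he | ho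
    · by_cases h2 : m = 2
      · subst h2
        rw [MF_top_two hφ]; rfl
      obtain ⟨x, y, hxy⟩ := exists_four_six he h2
      have hxy' : (4 * x + 6 * y : ℤ) = m := by exact_mod_cast hxy
      have h0 := h x y (by rwa [hxy'])
      rcases lt_or_ge m 12 with hlt | hge
      · rw [top_small hxy' (by exact_mod_cast hlt) hφ, Pi.smul_apply, h0, smul_zero]
      · obtain ⟨G, hG, hG'⟩ := top_decomp (m := (m - 12 : ℕ)) hxy'
          (by push_cast [hge]; ring) hφ
        rw [hG', Pi.add_apply, Pi.smul_apply, Pi.mul_apply, h0, ih (m - 12) (by omega) hG ?_]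
        · simp
        · push_cast [hge]
          intro hd
          exact hm (by simpa using dvd_add hd hq)
    · rw [MF_top_odd (by exact_mod_cast ho) hφ]; rfl

lemma vanish_four {z : ℍ} (hz : E6 z = 0) {m : ℤ} {φ : ℍ → ℂ} (hφ : φ ∈ MF ⊤ m)
    (hm : ¬ (4 : ℤ) ∣ m) : φ z = 0 :=
  top_vanish (by norm_num) (fun x y hxy ↦ by
    have : y ≠ 0 := by rintro rfl; simp at hxy
    simp [EE, hz, this]) hφ hm

lemma vanish_six {z : ℍ} (hz : E4 z = 0) {m : ℤ} {φ : ℍ → ℂ} (hφ : φ ∈ MF ⊤ m)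
    (hm : ¬ (6 : ℤ) ∣ m) : φ z = 0 :=
  top_vanish (by norm_num) (fun x y hxy ↦ by
    have : x ≠ 0 := by rintro rfl; simp at hxy
    simp [EE, hz, this]) hφ hm

section

variable [Γ.FiniteIndex] {a : Cos Γ → ℤ} {e s : Cos Γ → ℍ → ℂ}

/-- The span of the values over `z` of the generators of weight congruent to `c` modulo `q`. -/
def valSpan (a : Cos Γ → ℤ) (e : Cos Γ → ℍ → ℂ) (z : ℍ) (q c : ℤ) : Submodule ℂ (Cos Γ → ℂ) :=
  Submodule.span ℂ (Set.range fun i : {i // a i ≡ c [ZMOD q]} ↦ FM (Γ := Γ) a e z i)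

lemma mem_valSpan (hF : FB Γ a e) {z : ℍ} {q c : ℤ}
    (hq : ∀ {m : ℤ} {φ : ℍ → ℂ}, φ ∈ MF ⊤ m → ¬ q ∣ m → φ z = 0) (hf : f ∈ MF Γ k)
    (hk : k ≡ c [ZMOD q]) : (fun j : Cos Γ ↦ comp k f j z) ∈ valSpan a e z q c := by
  obtain ⟨α, hα, rfl⟩ := hF.gen hf
  have : (fun j : Cos Γ ↦ comp k (∑ i, α i * e i) j z) = ∑ i, α i z • FM (Γ := Γ) a e z i := by
    ext j
    rw [comp_comb hα, Finset.sum_apply]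
    rfl
  rw [this]
  refine sum_mem fun i _ ↦ ?_
  by_cases hi : a i ≡ c [ZMOD q]
  · exact Submodule.smul_mem _ _ (Submodule.subset_span ⟨⟨i, hi⟩, rfl⟩)
  · rw [hq (hα i) fun hd ↦ hi (((Int.modEq_iff_dvd).mpr hd).trans hk), zero_smul]
    exact zero_mem _

lemma mul_mem_valSpan (hF : FB Γ a e) {z : ℍ} {q c c' c'' : ℤ}
    (hq : ∀ {m : ℤ} {φ : ℍ → ℂ}, φ ∈ MF ⊤ m → ¬ q ∣ m → φ z = 0)
    (hc : c + c' ≡ c'' [ZMOD q]) {u v : Cos Γ → ℂ} (hu : u ∈ valSpan a e z q c)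
    (hv : v ∈ valSpan a e z q c') : u * v ∈ valSpan a e z q c'' := by
  have h := Submodule.mul_mem_mul hu hv
  rw [valSpan, valSpan, Submodule.span_mul_span] at h
  refine Submodule.span_le.mpr ?_ h
  rintro _ ⟨_, ⟨i, rfl⟩, _, ⟨i', rfl⟩, rfl⟩
  have := mem_valSpan hF hq (mul_MF' (hF.mem i) (hF.mem i') rfl)
    ((i.2.add i'.2).trans hc)
  have h2 : (fun j : Cos Γ ↦ comp (a i + a i') (e i * e i') j z) =
      FM (Γ := Γ) a e z i * FM (Γ := Γ) a e z i' := by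
    ext j
    rw [comp_mul]
    rfl
  rw [h2] at this
  exact this

lemma finrank_valSpan (hF : FB Γ a e) (hE : ∃ E, Sep Γ E) (z : ℍ) (q c : ℤ) :
    Module.finrank ℂ (valSpan a e z q c) = ∑ i, if a i ≡ c [ZMOD q] then 1 else 0 := by
  classical
  obtain ⟨E, hE⟩ := hE
  have h := Matrix.linearIndependent_rows_of_isUnit
    ((Matrix.isUnit_iff_isUnit_det _).mpr (hF.isUnit_det hE z))
  have h' := h.comp (fun i : {i // a i ≡ c [ZMOD q]} ↦ (i : Cos Γ)) Subtype.val_injective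
  have := finrank_span_eq_card h'
  rw [← Finset.card_filter, ← Fintype.card_subtype]
  refine (this : Module.finrank ℂ (valSpan a e z q c) = _).trans (Fintype.card_congr (Equiv.refl _))

lemma exists_e_ne (hF : FB Γ a e) (hE : ∃ E, Sep Γ E) {z : ℍ} {q c : ℤ}
    (hq : ∀ {m : ℤ} {φ : ℍ → ℂ}, φ ∈ MF ⊤ m → ¬ q ∣ m → φ z = 0)
    (hc : 2 + c ≡ 0 [ZMOD q])
    (hcard : (∑ i, if a i ≡ c [ZMOD q] then 1 else 0) = ∑ i, if a i ≡ 0 [ZMOD q] then 1 else 0)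
    (hsq : ∀ x ∈ valSpan a e z q c, ∀ j, (∀ u ∈ valSpan a e z q 2, u j = 0) → x j = 0) :
    ∃ i, a i ≡ 2 [ZMOD q] ∧ e i z ≠ 0 := by
  by_contra! hno
  have h1 : ∀ u ∈ valSpan a e z q 2, u ((1 : SL(2, ℤ)) : Cos Γ) = 0 := by
    intro u hu
    induction hu using Submodule.span_induction with
    | mem x hx =>
      obtain ⟨i, rfl⟩ := hx
      change comp (a i) (e i) _ z = 0
      rw [comp_one (hF.mem _), hno i i.2]
    | zero => rfl
    | add x y _ _ hx hy => rw [Pi.add_apply, hx, hy, add_zero]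
    | smul c x _ hx => rw [Pi.smul_apply, hx, smul_zero]
  obtain ⟨u, hu⟩ := exists_generic (V := valSpan a e z q 2)
    (ι := {j : Cos Γ // ∃ u ∈ valSpan a e z q 2, u j ≠ 0})
    (fun j ↦ (LinearMap.proj (R := ℂ) (φ := fun _ : Cos Γ ↦ ℂ) (j : Cos Γ)) ∘ₗ
      (valSpan a e z q 2).subtype) (fun j ↦ by
        obtain ⟨u, hu, hj⟩ := j.2
        exact ⟨⟨u, hu⟩, hj⟩)
  let T : valSpan a e z q c →ₗ[ℂ] valSpan a e z q 0 :=
    { toFun := fun x ↦ ⟨u * x, mul_mem_valSpan hF hq hc u.2 x.2⟩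
      map_add' := fun x y ↦ Subtype.ext (mul_add _ _ _)
      map_smul' := fun r x ↦ Subtype.ext (mul_smul_comm _ _ _) }
  have hT : Function.Injective T := by
    rw [injective_iff_map_eq_zero]
    intro x hx
    refine Subtype.ext (funext fun j ↦ ?_)
    have hj : (u : Cos Γ → ℂ) j * (x : Cos Γ → ℂ) j = 0 := congrFun (congrArg Subtype.val hx) j
    by_contra hxj
    have huj : (u : Cos Γ → ℂ) j = 0 := (mul_eq_zero.mp hj).resolve_right hxj
    refine hxj (hsq x x.2 j ?_)
    by_contra! h
    exact hu ⟨j, h⟩ huj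
  have hS := (LinearMap.injective_iff_surjective_of_finrank_eq_finrank
    (by rw [finrank_valSpan hF hE, finrank_valSpan hF hE, hcard])).mp hT
  have hone : (1 : Cos Γ → ℂ) ∈ valSpan a e z q 0 := by
    have := mem_valSpan hF hq (one_MF (Γ := Γ)) (Int.ModEq.refl 0)
    convert this using 1
    ext j
    rw [comp_top one_MF]
    rfl
  obtain ⟨x, hx⟩ := hS ⟨1, hone⟩
  have hx' : (u : Cos Γ → ℂ) * x = 1 := congrArg Subtype.val hx
  have := congrFun hx' ((1 : SL(2, ℤ)) : Cos Γ)
  rw [Pi.mul_apply, h1 u u.2, zero_mul] at this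
  exact zero_ne_one this

variable {d g : ℤ}

lemma Level.mem_weights (h : Level Γ a e s d g) (i : Cos Γ) :
    a i = 0 ∨ a i = 2 ∨ a i = 4 ∨ a i = 6 ∨ a i = 8 ∨ a i = 10 := by
  have h1 := h.nonneg i
  have h2 := h.le_ten h.even i
  obtain ⟨r, hr⟩ := h.even i
  omega

lemma Level.card_modEq (h : Level Γ a e s d g) (q c : ℤ) :
    (∑ i, if a i ≡ c [ZMOD q] then 1 else 0) =
      cnt a 0 • (if (0 : ℤ) ≡ c [ZMOD q] then 1 else 0) +
      cnt a 2 • (if (2 : ℤ) ≡ c [ZMOD q] then 1 else 0) +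
      cnt a 4 • (if (4 : ℤ) ≡ c [ZMOD q] then 1 else 0) +
      cnt a 6 • (if (6 : ℤ) ≡ c [ZMOD q] then 1 else 0) +
      cnt a 8 • (if (8 : ℤ) ≡ c [ZMOD q] then 1 else 0) +
      cnt a 10 • (if (10 : ℤ) ≡ c [ZMOD q] then 1 else 0) :=
  sum_cnt h.nonneg (h.le_ten h.even) h.even (fun m ↦ if m ≡ c [ZMOD q] then 1 else 0)

lemma Level.exists_four (h : Level Γ a e s d g) {z : ℍ} (hz : E6 z = 0) :
    ∃ i, a i ≡ 2 [ZMOD 4] ∧ e i z ≠ 0 := by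
  refine exists_e_ne h.toFB h.sep (vanish_four hz) (c := 2) (by decide) ?_
    fun x hx j hj ↦ hj x hx
  rw [h.card_modEq, h.card_modEq]
  simp only [show (0 : ℤ) ≡ 0 [ZMOD 4] by decide, show ¬ (2 : ℤ) ≡ 0 [ZMOD 4] by decide, show (4 : ℤ) ≡ 0 [ZMOD 4] by decide,
    show ¬ (6 : ℤ) ≡ 0 [ZMOD 4] by decide, show (8 : ℤ) ≡ 0 [ZMOD 4] by decide, show ¬ (10 : ℤ) ≡ 0 [ZMOD 4] by decide,
    show ¬ (0 : ℤ) ≡ 2 [ZMOD 4] by decide, show (2 : ℤ) ≡ 2 [ZMOD 4] by decide, show ¬ (4 : ℤ) ≡ 2 [ZMOD 4] by decide,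
    show (6 : ℤ) ≡ 2 [ZMOD 4] by decide, show ¬ (8 : ℤ) ≡ 2 [ZMOD 4] by decide, show (10 : ℤ) ≡ 2 [ZMOD 4] by decide,
    if_true, if_false, smul_eq_mul, mul_one, mul_zero]
  have := h.cntS
  omega

lemma Level.exists_six (h : Level Γ a e s d g) {z : ℍ} (hz : E4 z = 0) :
    ∃ i, a i ≡ 2 [ZMOD 6] ∧ e i z ≠ 0 := by
  refine exists_e_ne h.toFB h.sep (vanish_six hz) (c := 4) (by decide) ?_
    fun x hx j hj ↦ mul_self_eq_zero.mp
      (hj _ (mul_mem_valSpan h.toFB (vanish_six hz) (by decide) hx hx))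
  rw [h.card_modEq, h.card_modEq]
  simp only [show (0 : ℤ) ≡ 0 [ZMOD 6] by decide, show ¬ (2 : ℤ) ≡ 0 [ZMOD 6] by decide, show ¬ (4 : ℤ) ≡ 0 [ZMOD 6] by decide,
    show (6 : ℤ) ≡ 0 [ZMOD 6] by decide, show ¬ (8 : ℤ) ≡ 0 [ZMOD 6] by decide, show ¬ (10 : ℤ) ≡ 0 [ZMOD 6] by decide,
    show ¬ (0 : ℤ) ≡ 4 [ZMOD 6] by decide, show ¬ (2 : ℤ) ≡ 4 [ZMOD 6] by decide, show (4 : ℤ) ≡ 4 [ZMOD 6] by decide,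
    show ¬ (6 : ℤ) ≡ 4 [ZMOD 6] by decide, show ¬ (8 : ℤ) ≡ 4 [ZMOD 6] by decide, show (10 : ℤ) ≡ 4 [ZMOD 6] by decide,
    if_true, if_false, smul_eq_mul, mul_one, mul_zero]
  have := h.cntR
  omega

end

end

section

variable {Γ : Subgroup SL(2, ℤ)} {k l : ℤ} {f g : ℍ → ℂ}

lemma Pt.pow {ev} (h : Pt Γ ev) (hf : f ∈ MF Γ k) (n : ℕ) : ev (n * k) (f ^ n) = ev k f ^ n := by
  induction n with
  | zero => simpa using h.one
  | succ n ih =>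
    rw [pow_succ, pow_succ, h.mul (by push_cast; ring) (pow_MF hf n) hf, ih]

lemma Pt.EE {ev} (h : Pt Γ ev) {x y : ℕ} (hk : 4 * x + 6 * y = k) :
    ev k (EE x y) = ev 4 E4 ^ x * ev 6 E6 ^ y := by
  rw [WeightTwo.EE, h.mul (by linarith) (pow_MF (MF_top_le E4_mem) x) (pow_MF (MF_top_le E6_mem) y),
    h.pow (MF_top_le E4_mem), h.pow (MF_top_le E6_mem)]

lemma MF_const [Γ.FiniteIndex] (hf : f ∈ MF Γ 0) : ∃ c : ℂ, f = c • (1 : ℍ → ℂ) := by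
  obtain ⟨c, hc⟩ := MF_zero hf
  exact ⟨c, by rw [hc]; ext; simp⟩

section

variable [Γ.FiniteIndex] {a : Cos Γ → ℤ} {e s : Cos Γ → ℍ → ℂ} {d g : ℤ}

lemma Level.exists_ne_of_ne (h : Level Γ a e s d g) {ev} (hev : Pt Γ ev) (h4 : ev 4 E4 ≠ 0)
    (h6 : ev 6 E6 ≠ 0) : ∃ f ∈ MF Γ 2, ev 2 f ≠ 0 := by
  by_contra! h2
  have hEE : ∀ {x y : ℕ} {k : ℤ}, 4 * x + 6 * y = k → ev k (EE x y) ≠ 0 := fun hk ↦ by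
    rw [hev.EE hk]
    exact mul_ne_zero (pow_ne_zero _ h4) (pow_ne_zero _ h6)
  have hex : ∀ j, ∃ α ∈ MF ⊤ (12 - (12 - a j)), ev (12 - (12 - a j)) α = ev (a j) (e j) := by
    intro j
    rw [sub_sub_cancel]
    have key : ∀ x y : ℕ, 4 * x + 6 * y = a j → ∃ α ∈ MF ⊤ (a j), ev (a j) α = ev (a j) (e j) :=
      fun x y hxy ↦ ⟨(ev (a j) (e j) / ev (a j) (EE x y)) • EE x y,
        Submodule.smul_mem _ _ (EE_mem hxy), by
          rw [hev.smul _ (MF_top_le (EE_mem hxy)), div_mul_cancel₀ _ (hEE hxy)]⟩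
    have hj := h.mem j
    rcases h.mem_weights j with h0 | h0 | h0 | h0 | h0 | h0
    · exact key 0 0 (by rw [h0]; rfl)
    · rw [h0] at hj ⊢
      exact ⟨0, zero_mem _, by rw [h2 _ hj, hev.zero]⟩
    · exact key 1 0 (by rw [h0]; rfl)
    · exact key 0 1 (by rw [h0]; rfl)
    · exact key 2 0 (by rw [h0]; rfl)
    · exact key 1 1 (by rw [h0]; rfl)
  choose α hα hα' using hex
  have hE : EE 3 0 ∈ MF ⊤ 12 := EE_mem (by norm_num)
  have hX : ev 12 (EE 3 0) ≠ 0 := hEE (by norm_num)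
  refine bpf_core h.toDual h.num h.ineq hev h2 hα (C := fun _ ↦ True)
    (fun k _ j φ _ ↦ by rw [hα']) (k₀ := 0) trivial one_MF (by rw [hev.one]; exact one_ne_zero)
    (P := ev 12 Dl • EE 3 0 - ev 12 (EE 3 0) • Dl)
    (sub_mem (Submodule.smul_mem _ _ hE) (Submodule.smul_mem _ _ Dl_mem)) ?_ ?_
  · intro h0
    have hD : Tendsto Dl atImInfty (𝓝 0) := by
      have : IsZeroAtImInfty Dl := by simpa using Dl_memS.2.2 1
      exact this
    have h1 : Tendsto (ev 12 Dl • EE 3 0 - ev 12 (EE 3 0) • Dl) atImInfty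
        (𝓝 (ev 12 Dl • 1 - ev 12 (EE 3 0) • 0)) :=
      ((EE_tendsto 3 0).const_smul _).sub (hD.const_smul _)
    rw [h0] at h1
    have h3 : ev 12 Dl • (1 : ℂ) - ev 12 (EE 3 0) • (0 : ℂ) = 0 :=
      tendsto_nhds_unique h1 tendsto_const_nhds
    simp only [smul_eq_mul, mul_one, mul_zero, sub_zero] at h3
    rw [h3, zero_smul, zero_sub, neg_eq_zero, smul_eq_zero] at h0
    exact Dl_ne UpperHalfPlane.I (congrFun (h0.resolve_left hX) _)
  · intro i β hβ hβ0
    have hβ0 := hβ0 trivial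
    have key : ∀ x y : ℕ, 4 * x + 6 * y = 12 + 2 - (12 - a i) → a i < 10 →
        ∃ β' ∈ MF ⊤ (2 - (12 - a i)),
          β = (ev 12 Dl • EE 3 0 - ev 12 (EE 3 0) • Dl) * β' := by
      intro x y hxy hlt
      have h3 := top_small hxy (by linarith) hβ
      rw [h3, hev.smul _ (MF_top_le (EE_mem hxy))] at hβ0
      rw [(mul_eq_zero.mp hβ0).resolve_right (hEE hxy), zero_smul] at h3
      exact ⟨0, zero_mem _, by rw [h3, mul_zero]⟩
    rcases h.mem_weights i with h0 | h0 | h0 | h0 | h0 | h0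
    · rw [h0] at hβ
      exact ⟨0, zero_mem _, by rw [mul_zero]; exact MF_top_two hβ⟩
    · exact key 1 0 (by rw [h0]; norm_num) (by rw [h0]; norm_num)
    · exact key 0 1 (by rw [h0]; norm_num) (by rw [h0]; norm_num)
    · exact key 2 0 (by rw [h0]; norm_num) (by rw [h0]; norm_num)
    · exact key 1 1 (by rw [h0]; norm_num) (by rw [h0]; norm_num)
    · rw [h0] at hβ hβ0 ⊢
      norm_num at hβ hβ0 ⊢
      obtain ⟨G, hG, hG'⟩ := top_decomp (x := 3) (y := 0) (m := 0) (by norm_num) (by norm_num) hβ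
      obtain ⟨c, rfl⟩ := MF_const hG
      rw [smul_mul_assoc, one_mul] at hG'
      rw [hG', hev.add (Submodule.smul_mem _ _ (MF_top_le hE))
        (Submodule.smul_mem _ _ (MF_top_le Dl_mem)), hev.smul _ (MF_top_le hE),
        hev.smul _ (MF_top_le Dl_mem)] at hβ0
      refine ⟨(-c / ev 12 (EE 3 0)) • 1, Submodule.smul_mem _ _ one_MF, ?_⟩
      rw [hG', mul_smul_comm, mul_one, smul_sub, smul_smul, smul_smul, div_mul_cancel₀ _ hX,
        _root_.neg_smul, sub_neg_eq_add]
      congr 2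
      field_simp
      linear_combination hβ0

lemma Level.exists_ne_of_E4 (h : Level Γ a e s d g) {z : ℍ} (hz : E4 z = 0) :
    ∃ f ∈ MF Γ 2, f z ≠ 0 := by
  by_contra! h2
  have hex : ∀ j, ∃ α ∈ MF ⊤ (4 - (12 - a j)), a j ≡ 2 [ZMOD 6] → α z = e j z := by
    intro j
    by_cases h0 : a j = 8
    · refine ⟨e j z • 1, ?_, fun _ ↦ by simp⟩
      rw [h0]
      exact Submodule.smul_mem _ _ one_MF
    · refine ⟨0, zero_mem _, fun h3 ↦ ?_⟩
      have : a j = 2 := by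
        rcases h.mem_weights j with h1 | h1 | h1 | h1 | h1 | h1 <;> rw [h1] at h3 ⊢ <;>
          first | rfl | exact absurd h1 h0 | exact absurd h3 (by decide)
      have hj := h.mem j
      rw [this] at hj
      rw [h2 _ hj]; rfl
  choose α hα hα' using hex
  obtain ⟨i₀, hi₀, hi₀'⟩ := h.exists_six hz
  refine bpf_core h.toDual h.num h.ineq (pt_point z) h2 hα (C := fun k ↦ k ≡ 2 [ZMOD 6])
    (fun k hk j φ hφ ↦ ?_) hi₀ (h.mem i₀) hi₀' (P := E4) E4_mem
    E4_ne fun i β hβ hβ0 ↦ ?_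
  · by_cases hj : a j ≡ 2 [ZMOD 6]
    · rw [hα' j hj]
    · rw [vanish_six hz hφ fun hd ↦ hj (((Int.modEq_iff_dvd).mpr hd).trans hk), zero_mul, zero_mul]
  · rcases h.mem_weights i with h0 | h0 | h0 | h0 | h0 | h0 <;> rw [h0] at hβ hβ0 ⊢ <;>
      norm_num at hβ hβ0 ⊢
    · exact ⟨0, zero_mem _, by rw [mul_zero]; exact MF_top_neg (by norm_num) hβ⟩
    · exact ⟨0, zero_mem _, by rw [mul_zero]; exact MF_top_neg (by norm_num) hβ⟩
    · exact ⟨0, zero_mem _, by rw [mul_zero]; exact MF_top_neg (by norm_num) hβ⟩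
    · obtain ⟨c, rfl⟩ := MF_const hβ
      have := hβ0
      simp only [Pi.smul_apply, Pi.one_apply, smul_eq_mul, mul_one] at this
      exact ⟨0, zero_mem _, by rw [mul_zero, this, zero_smul]⟩
    · exact ⟨0, zero_mem _, by rw [mul_zero]; exact MF_top_two hβ⟩
    · refine ⟨valueAtInfty β • 1, Submodule.smul_mem _ _ one_MF, ?_⟩
      have h3 := top_small (x := 1) (y := 0) (by norm_num) (by norm_num) hβ
      rw [mul_smul_comm, mul_one]
      simpa [EE] using h3

lemma Level.exists_ne_of_E6 (h : Level Γ a e s d g) {z : ℍ} (hz : E6 z = 0) :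
    ∃ f ∈ MF Γ 2, f z ≠ 0 := by
  by_contra! h2
  have hz4 : E4 z ≠ 0 := fun h0 ↦ by
    rcases E4_E6_ne z with h1 | h1
    exacts [h1 h0, h1 hz]
  have hex : ∀ j, ∃ α ∈ MF ⊤ (6 - (12 - a j)), a j ≡ 2 [ZMOD 4] → α z = e j z := by
    intro j
    by_cases h0 : a j = 6
    · refine ⟨e j z • 1, ?_, fun _ ↦ by simp⟩
      rw [h0]
      exact Submodule.smul_mem _ _ one_MF
    by_cases h0' : a j = 10
    · refine ⟨(e j z / E4 z) • E4, ?_, fun _ ↦ by simp [hz4]⟩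
      rw [h0']
      exact Submodule.smul_mem _ _ E4_mem
    · refine ⟨0, zero_mem _, fun h3 ↦ ?_⟩
      have : a j = 2 := by
        rcases h.mem_weights j with h1 | h1 | h1 | h1 | h1 | h1 <;> rw [h1] at h3 ⊢ <;>
          first | rfl | exact absurd h1 h0 | exact absurd h1 h0' | exact absurd h3 (by decide)
      have hj := h.mem j
      rw [this] at hj
      rw [h2 _ hj]; rfl
  choose α hα hα' using hex
  obtain ⟨i₀, hi₀, hi₀'⟩ := h.exists_four hz
  refine bpf_core h.toDual h.num h.ineq (pt_point z) h2 hα (C := fun k ↦ k ≡ 2 [ZMOD 4])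
    (fun k hk j φ hφ ↦ ?_) hi₀ (h.mem i₀) hi₀' (P := E6) E6_mem
    E6_ne fun i β hβ hβ0 ↦ ?_
  · by_cases hj : a j ≡ 2 [ZMOD 4]
    · rw [hα' j hj]
    · rw [vanish_four hz hφ fun hd ↦ hj (((Int.modEq_iff_dvd).mpr hd).trans hk), zero_mul, zero_mul]
  · rcases h.mem_weights i with h0 | h0 | h0 | h0 | h0 | h0 <;> rw [h0] at hβ hβ0 ⊢ <;>
      norm_num at hβ hβ0 ⊢
    · exact ⟨0, zero_mem _, by rw [mul_zero]; exact MF_top_neg (by norm_num) hβ⟩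
    · exact ⟨0, zero_mem _, by rw [mul_zero]; exact MF_top_neg (by norm_num) hβ⟩
    · obtain ⟨c, rfl⟩ := MF_const hβ
      have := hβ0
      simp only [Pi.smul_apply, Pi.one_apply, smul_eq_mul, mul_one] at this
      exact ⟨0, zero_mem _, by rw [mul_zero, this, zero_smul]⟩
    · exact ⟨0, zero_mem _, by rw [mul_zero]; exact MF_top_two hβ⟩
    · have h3 := top_small (x := 1) (y := 0) (by norm_num) (by norm_num) hβ
      have := hβ0
      rw [h3] at this
      simp only [EE, pow_one, pow_zero, mul_one, Pi.smul_apply, smul_eq_mul, mul_eq_zero, hz4,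
        or_false] at this
      rw [this, zero_smul] at h3
      exact ⟨0, zero_mem _, by rw [mul_zero, h3]⟩
    · refine ⟨valueAtInfty β • 1, Submodule.smul_mem _ _ one_MF, ?_⟩
      have h3 := top_small (x := 0) (y := 1) (by norm_num) (by norm_num) hβ
      rw [mul_smul_comm, mul_one]
      simpa [EE] using h3

lemma Level.exists_ne (h : Level Γ a e s d g) (z : ℍ) : ∃ f ∈ MF Γ 2, f z ≠ 0 := by
  by_cases h4 : E4 z = 0
  · exact h.exists_ne_of_E4 h4
  by_cases h6 : E6 z = 0
  · exact h.exists_ne_of_E6 h6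
  exact h.exists_ne_of_ne (pt_point z) h4 h6

lemma Level.exists_cusp_ne (h : Level Γ a e s d g) (γ : SL(2, ℤ)) :
    ∃ f ∈ MF Γ 2, valueAtInfty (f ∣[(2 : ℤ)] γ) ≠ 0 := by
  refine h.exists_ne_of_ne (pt_cusp γ) ?_ ?_
  · rw [slash_top E4_mem, val_eq E4_tendsto]
    exact one_ne_zero
  · rw [slash_top E6_mem, val_eq E6_tendsto]
    exact one_ne_zero

end

end

section

variable {Γ : Subgroup SL(2, ℤ)} {k l : ℤ} {f g : ℍ → ℂ}

lemma countable_zeros (hf : MDiff f) (h0 : f ≠ 0) : {z | f z = 0}.Countable := by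
  have hd : DiscreteTopology {z | f z = 0} := by
    rw [discreteTopology_subtype_iff]
    intro x hx
    by_contra hne
    refine h0 (UpperHalfPlane.eq_zero_of_frequently hf (τ := x) fun hev ↦ hne ?_)
    rw [← Filter.empty_mem_iff_bot, Filter.mem_inf_principal]
    filter_upwards [hev] with z hz hz' using hz hz'
  exact countable_of_Lindelof_of_discrete (X := {z | f z = 0})

instance : Countable SL(2, ℤ) :=
  Function.Injective.countable (f := fun γ : SL(2, ℤ) ↦ fun i j ↦ γ i j)
    fun x y h ↦ Matrix.SpecialLinearGroup.ext x y fun i j ↦ congrFun (congrFun h i) j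

/-- Two forms without common zeros, the first one not vanishing at any cusp. -/
structure Cop (Γ : Subgroup SL(2, ℤ)) (a : ℤ) (u : ℍ → ℂ) (b : ℤ) (v : ℍ → ℂ) : Prop where
  left : u ∈ MF Γ a
  right : v ∈ MF Γ b
  pt : ∀ z, u z ≠ 0 ∨ v z ≠ 0
  cusp : ∀ γ : SL(2, ℤ), NZ (u ∣[a] γ)

section quot

variable {u v : ℍ → ℂ} {a b m p q : ℤ}

lemma Cop.quotM (h : Cop Γ a u b v) (hf : f ∈ MF Γ p) (hg : g ∈ MF Γ q) (hp : p = m + b)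
    (hq : q = m + a) (he : u * f = v * g) : ∃ φ ∈ MF Γ m, f = φ * v ∧ g = φ * u :=
  exists_quot_MF h.left h.right hf hg hp hq he h.pt fun γ ↦ .inl (h.cusp γ)

lemma Cop.quotS (h : Cop Γ a u b v) (hf : f ∈ SF Γ p) (hg : g ∈ SF Γ q) (hp : p = m + b)
    (hq : q = m + a) (he : u * f = v * g) : ∃ φ ∈ SF Γ m, f = φ * v ∧ g = φ * u :=
  exists_quot_SF h.left h.right hf hg hp hq he h.pt fun γ ↦ .inl (h.cusp γ)

lemma Cop.ne (h : Cop Γ a u b v) : u ≠ 0 := by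
  rintro rfl
  obtain ⟨c, hc, h1⟩ := h.cusp 1
  obtain ⟨z, hz⟩ := h1.exists
  simp only [SlashAction.slash_one, Pi.zero_apply, norm_zero] at hz
  linarith

end quot

/-- Two forms of the same weight without common zeros, the first one not vanishing at any cusp. -/
structure Pencil (Γ : Subgroup SL(2, ℤ)) (w : ℤ) (s t : ℍ → ℂ) : Prop where
  left : s ∈ MF Γ w
  right : t ∈ MF Γ w
  ne : t ≠ 0
  pt : ∀ z, s z ≠ 0 ∨ t z ≠ 0
  cusp : ∀ γ : SL(2, ℤ), valueAtInfty (s ∣[w] γ) ≠ 0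

section

variable [Γ.FiniteIndex] {w b : ℤ} {s t h : ℍ → ℂ}

lemma Pencil.cop (hP : Pencil Γ w s t) : Cop Γ w s w t :=
  ⟨hP.left, hP.right, hP.pt, fun γ ↦ NZ_of_tendsto (hP.cusp γ) (tendsto_slash hP.left γ)⟩

lemma Pencil.sq (hP : Pencil Γ w s t) : Pencil Γ (2 * w) (s ^ 2) (t ^ 2) where
  left := pow_MF hP.left 2
  right := pow_MF hP.right 2
  ne := fun h0 ↦ hP.ne (funext fun z ↦ by simpa using congrFun h0 z)
  pt := fun z ↦ (hP.pt z).imp (pow_ne_zero 2) (pow_ne_zero 2)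
  cusp := fun γ ↦ by
    have := (pt_cusp γ).pow hP.left 2
    exact (this.trans_ne (pow_ne_zero 2 (hP.cusp γ)))

lemma Pencil.exists_cop (hP : Pencil Γ w s t) (hh : h ∈ MF Γ b) (h0 : h ≠ 0) :
    ∃ x y : ℂ, Cop Γ w (x • s + y • t) b h := by
  have : Countable {z | h z = 0} := (countable_zeros hh.1 h0).to_subtype
  have hs := pt_cusp (Γ := Γ)
  obtain ⟨⟨x, y⟩, hv⟩ := exists_generic (V := ℂ × ℂ) (ι := {z | h z = 0} ⊕ SL(2, ℤ))
    (Sum.elim (fun z ↦ s z • LinearMap.fst ℂ ℂ ℂ + t z • LinearMap.snd ℂ ℂ ℂ)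
      (fun γ ↦ valueAtInfty (s ∣[w] γ) • LinearMap.fst ℂ ℂ ℂ +
        valueAtInfty (t ∣[w] γ) • LinearMap.snd ℂ ℂ ℂ)) (by
    rintro (z | γ)
    · rcases hP.pt z with h1 | h1
      · exact ⟨(1, 0), by simpa using h1⟩
      · exact ⟨(0, 1), by simpa using h1⟩
    · exact ⟨(1, 0), by simpa using hP.cusp γ⟩)
  have hm : x • s + y • t ∈ MF Γ w :=
    add_mem (Submodule.smul_mem _ _ hP.left) (Submodule.smul_mem _ _ hP.right)
  refine ⟨x, y, hm, hh, fun z ↦ ?_, fun γ ↦ NZ_of_tendsto ?_ (tendsto_slash hm γ)⟩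
  · by_cases hz : h z = 0
    · left
      have := hv (.inl ⟨z, hz⟩)
      simpa [mul_comm] using this
    · exact .inr hz
  · have := hv (.inr γ)
    rw [(hs γ).add (Submodule.smul_mem _ _ hP.left) (Submodule.smul_mem _ _ hP.right),
      (hs γ).smul _ hP.left, (hs γ).smul _ hP.right]
    simpa [mul_comm] using this

lemma exists_pencil [FiniteDimensional ℂ (MF Γ w)] (hpt : ∀ z, ∃ f ∈ MF Γ w, f z ≠ 0)
    (hc : ∀ γ : SL(2, ℤ), ∃ f ∈ MF Γ w, valueAtInfty (f ∣[w] γ) ≠ 0) :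
    ∃ s t, Pencil Γ w s t := by
  have hs := pt_cusp (Γ := Γ)
  obtain ⟨⟨s, hsm⟩, hs⟩ := exists_generic (V := MF Γ w) (ι := SL(2, ℤ))
    (fun γ ↦
      { toFun := fun f ↦ valueAtInfty ((f : ℍ → ℂ) ∣[w] γ)
        map_add' := fun f g ↦ (hs γ).add f.2 g.2
        map_smul' := fun c f ↦ (hs γ).smul c f.2 })
    (fun γ ↦ by
      obtain ⟨f, hf, h⟩ := hc γ
      exact ⟨⟨f, hf⟩, h⟩)
  have hs0 : s ≠ 0 := by
    rintro rfl
    exact hs 1 ((pt_cusp (1 : SL(2, ℤ))).zero (Γ := Γ) w)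
  have : Countable {z | s z = 0} := (countable_zeros hsm.1 hs0).to_subtype
  obtain ⟨⟨t, htm⟩, ht⟩ := exists_generic (V := MF Γ w) (ι := Option {z | s z = 0})
    (fun z ↦ (LinearMap.proj (R := ℂ) (φ := fun _ : ℍ ↦ ℂ)
      (z.elim UpperHalfPlane.I Subtype.val)) ∘ₗ (MF Γ w).subtype)
    (fun z ↦ by
      obtain ⟨f, hf, h⟩ := hpt (z.elim UpperHalfPlane.I Subtype.val)
      exact ⟨⟨f, hf⟩, h⟩)
  refine ⟨s, t, hsm, htm, ?_, fun z ↦ ?_, hs⟩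
  · rintro rfl
    exact ht none rfl
  · by_cases hz : s z = 0
    · exact .inr (ht (some ⟨z, hz⟩))
    · exact .inl hz

end

/-! ### Combinations `u * x + v * y` -/

/-- The combinations `u * x + v * y` with `x ∈ X` and `y ∈ Y`. -/
def combs (u v : ℍ → ℂ) (X Y : Submodule ℂ (ℍ → ℂ)) : Submodule ℂ (ℍ → ℂ) :=
  X.map (LinearMap.mulLeft ℂ u) ⊔ Y.map (LinearMap.mulLeft ℂ v)

section combs

variable {u v : ℍ → ℂ} {X Y Z W : Submodule ℂ (ℍ → ℂ)}

lemma mem_combs : f ∈ combs u v X Y ↔ ∃ x ∈ X, ∃ y ∈ Y, u * x + v * y = f := by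
  simp [combs, Submodule.mem_sup]

lemma combs_le (h1 : ∀ x ∈ X, u * x ∈ W) (h2 : ∀ y ∈ Y, v * y ∈ W) : combs u v X Y ≤ W := by
  intro f hf
  obtain ⟨x, hx, y, hy, rfl⟩ := mem_combs.mp hf
  exact add_mem (h1 x hx) (h2 y hy)

lemma finrank_map_mul (hu : MDiff u) (h0 : u ≠ 0) (hX : ∀ x ∈ X, MDiff x) :
    Module.finrank ℂ (X.map (LinearMap.mulLeft ℂ u)) = Module.finrank ℂ X := by
  have := LinearMap.finrank_range_of_inj (f := (LinearMap.mulLeft ℂ u).domRestrict X)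
    fun x y hxy ↦ Subtype.ext (mul_cancel_MF hu (hX x x.2) (hX y y.2) h0 hxy)
  rw [← this, LinearMap.range_domRestrict]

variable [FiniteDimensional ℂ X] [FiniteDimensional ℂ Y]

instance : FiniteDimensional ℂ (combs u v X Y) := by
  unfold combs
  infer_instance

lemma le_finrank_combs [FiniteDimensional ℂ Z] (hu : MDiff u) (hu0 : u ≠ 0) (hv : MDiff v)
    (hv0 : v ≠ 0) (hX : ∀ x ∈ X, MDiff x) (hY : ∀ y ∈ Y, MDiff y)
    (hZ : ∀ x ∈ X, ∀ y ∈ Y, u * x = v * y → ∃ φ ∈ Z, x = φ * v) :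
    Module.finrank ℂ X + Module.finrank ℂ Y ≤
      Module.finrank ℂ (combs u v X Y) + Module.finrank ℂ Z := by
  have h := Submodule.finrank_sup_add_finrank_inf_eq (X.map (LinearMap.mulLeft ℂ u))
    (Y.map (LinearMap.mulLeft ℂ v))
  rw [finrank_map_mul hu hu0 hX, finrank_map_mul hv hv0 hY] at h
  rw [← h, combs]
  gcongr
  refine (Submodule.finrank_mono ?_).trans (Submodule.finrank_map_le (LinearMap.mulLeft ℂ (u * v)) Z)
  rintro _ ⟨⟨x, hx, rfl⟩, ⟨y, hy, hxy⟩⟩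
  obtain ⟨φ, hφ, rfl⟩ := hZ x hx y hy hxy.symm
  exact ⟨φ, hφ, by simp only [LinearMap.mulLeft_apply]; ring⟩

lemma finrank_combs_le (hu : MDiff u) (hu0 : u ≠ 0) (hv : MDiff v)
    (hv0 : v ≠ 0) (hX : ∀ x ∈ X, MDiff x) (hY : ∀ y ∈ Y, MDiff y) (hZ : ∀ φ ∈ Z, MDiff φ)
    (hZX : ∀ φ ∈ Z, v * φ ∈ X) (hZY : ∀ φ ∈ Z, u * φ ∈ Y) :
    Module.finrank ℂ (combs u v X Y) + Module.finrank ℂ Z ≤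
      Module.finrank ℂ X + Module.finrank ℂ Y := by
  have h := Submodule.finrank_sup_add_finrank_inf_eq (X.map (LinearMap.mulLeft ℂ u))
    (Y.map (LinearMap.mulLeft ℂ v))
  rw [finrank_map_mul hu hu0 hX, finrank_map_mul hv hv0 hY] at h
  rw [← h, combs]
  gcongr
  have huv : u * v ≠ 0 := fun h0 ↦ by
    rcases (UpperHalfPlane.mul_eq_zero_iff hu hv).mp h0 with h1 | h1
    exacts [hu0 h1, hv0 h1]
  rw [← finrank_map_mul (hu.mul hv) huv hZ]
  refine Submodule.finrank_mono ?_
  rintro _ ⟨φ, hφ, rfl⟩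
  refine ⟨⟨v * φ, hZX φ hφ, ?_⟩, ⟨u * φ, hZY φ hφ, ?_⟩⟩ <;>
    simp only [LinearMap.mulLeft_apply] <;> ring

end combs

/-! ### Duality -/

/-- The pairing of `U` and `V` induced by a functional. -/
def pair (lam : (ℍ → ℂ) →ₗ[ℂ] ℂ) (U V : Submodule ℂ (ℍ → ℂ)) : U →ₗ[ℂ] Module.Dual ℂ V :=
  LinearMap.mk₂ ℂ (fun u v ↦ lam (u * v)) (fun _ _ _ ↦ by simp [add_mul]) (fun _ _ _ ↦ by simp)
    (fun _ _ _ ↦ by simp [mul_add]) (fun _ _ _ ↦ by simp)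

lemma exists_pair_eq {lam ell : (ℍ → ℂ) →ₗ[ℂ] ℂ} {U V K : Submodule ℂ (ℍ → ℂ)}
    [FiniteDimensional ℂ U] [FiniteDimensional ℂ V] (hKV : K ≤ V)
    (hK : ∀ u ∈ U, ∀ v ∈ K, lam (u * v) = 0) (hU : ∀ u ∈ U, (∀ v ∈ V, lam (u * v) = 0) → u = 0)
    (hdim : Module.finrank ℂ V ≤ Module.finrank ℂ K + Module.finrank ℂ U)
    (hell : ∀ v ∈ K, ell v = 0) : ∃ u ∈ U, ∀ v ∈ V, ell v = lam (u * v) := by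
  set K' := K.comap V.subtype
  have hK' : Module.finrank ℂ K' = Module.finrank ℂ K :=
    (Submodule.comapSubtypeEquivOfLe hKV).finrank_eq
  have hinj : Function.Injective (pair lam U V) := by
    rw [injective_iff_map_eq_zero]
    exact fun u hu ↦ Subtype.ext (hU u u.2 fun v hv ↦ LinearMap.congr_fun hu ⟨v, hv⟩)
  have hle : LinearMap.range (pair lam U V) ≤ K'.dualAnnihilator := by
    rintro _ ⟨u, rfl⟩
    rw [Submodule.mem_dualAnnihilator]
    exact fun v hv ↦ hK u u.2 v hv
  have heq := Submodule.eq_of_le_of_finrank_le hle (by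
    rw [LinearMap.finrank_range_of_inj hinj]
    have := Subspace.finrank_add_finrank_dualAnnihilator_eq K'
    omega)
  have : ell ∘ₗ V.subtype ∈ K'.dualAnnihilator := by
    rw [Submodule.mem_dualAnnihilator]
    exact fun v hv ↦ hell v hv
  rw [← heq] at this
  obtain ⟨u, hu⟩ := this
  exact ⟨u, u.2, fun v hv ↦ (LinearMap.congr_fun hu ⟨v, hv⟩).symm⟩

lemma mem_of_pair_eq_zero {lam : (ℍ → ℂ) →ₗ[ℂ] ℂ} {U V K : Submodule ℂ (ℍ → ℂ)}
    [FiniteDimensional ℂ U] [FiniteDimensional ℂ V] (hKV : K ≤ V)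
    (hK : ∀ u ∈ U, ∀ v ∈ K, lam (u * v) = 0) (hU : ∀ u ∈ U, (∀ v ∈ V, lam (u * v) = 0) → u = 0)
    (hdim : Module.finrank ℂ V ≤ Module.finrank ℂ K + Module.finrank ℂ U) {v : ℍ → ℂ}
    (hv : v ∈ V) (hv0 : ∀ u ∈ U, lam (u * v) = 0) : v ∈ K := by
  by_contra hvK
  obtain ⟨ell, h1, h2⟩ := Submodule.exists_le_ker_of_notMem hvK
  obtain ⟨u, hu, h3⟩ := exists_pair_eq (ell := ell) hKV hK hU hdim fun x hx ↦ h2 hx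
  exact h1 ((h3 v hv).trans (hv0 u hu))

lemma finrank_le_of_radical {lam : (ℍ → ℂ) →ₗ[ℂ] ℂ} {U V R : Submodule ℂ (ℍ → ℂ)}
    [FiniteDimensional ℂ U] [FiniteDimensional ℂ V] [FiniteDimensional ℂ R]
    (hR : ∀ u ∈ U, (∀ v ∈ V, lam (u * v) = 0) → u ∈ R) {P : Submodule ℂ (ℍ → ℂ)} (hPV : P ≤ V)
    (hP : ∀ u ∈ U, ∀ v ∈ P, lam (u * v) = 0) :
    Module.finrank ℂ P + Module.finrank ℂ U ≤ Module.finrank ℂ V + Module.finrank ℂ R := by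
  have h1 := LinearMap.finrank_range_add_finrank_ker (pair lam U V)
  have h2 := Subspace.finrank_add_finrank_dualCoannihilator_eq (LinearMap.range (pair lam U V))
  have h3 : Module.finrank ℂ (LinearMap.ker (pair lam U V)) ≤ Module.finrank ℂ R := by
    rw [← Submodule.finrank_map_subtype_eq]
    refine Submodule.finrank_mono ?_
    rintro _ ⟨u, hu, rfl⟩
    exact hR u u.2 fun v hv ↦ LinearMap.congr_fun (LinearMap.mem_ker.mp hu) ⟨v, hv⟩
  have h4 : Module.finrank ℂ P ≤
      Module.finrank ℂ (LinearMap.range (pair lam U V)).dualCoannihilator := by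
    rw [← (Submodule.comapSubtypeEquivOfLe hPV).finrank_eq]
    refine Submodule.finrank_mono fun v hv ↦ ?_
    rw [Submodule.mem_dualCoannihilator]
    rintro _ ⟨u, rfl⟩
    exact hP u u.2 v hv
  omega

end

section

variable {Γ : Subgroup SL(2, ℤ)} {k l : ℤ} {f : ℍ → ℂ}

lemma Num.finS {d g : ℤ} (hN : Num Γ d g) (k : ℤ) : FiniteDimensional ℂ (SF Γ k) :=
  have := hN.fin k
  Submodule.finiteDimensional_of_le SF_le_MF

section

variable [Γ.FiniteIndex] {d g : ℤ} {s t h : ℍ → ℂ}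

lemma finrank_MF_zero_le : Module.finrank ℂ (MF Γ 0) ≤ 1 := by
  refine finrank_le_one ⟨1, one_MF⟩ fun f ↦ ?_
  obtain ⟨c, hc⟩ := MF_zero f.2
  exact ⟨c, Subtype.ext (by rw [hc]; ext; simp)⟩

lemma MF_le_combs (hN : Num Γ d g) (hP : Pencil Γ 2 s t) {k m n : ℤ}
    (hm : k + 2 = m) (hn : n + 2 = k) (hdim : (Module.finrank ℂ (MF Γ m) : ℤ) +
      Module.finrank ℂ (MF Γ n) ≤ 2 * Module.finrank ℂ (MF Γ k)) : MF Γ m ≤ combs s t (MF Γ k) (MF Γ k) := by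
  have := hN.fin
  refine (Submodule.eq_of_le_of_finrank_le (combs_le (fun x hx ↦ mul_MF' hP.left hx (by omega))
    fun x hx ↦ mul_MF' hP.right hx (by omega)) ?_).ge
  have := le_finrank_combs (X := MF Γ k) (Y := MF Γ k) (Z := MF Γ n) hP.left.1 hP.cop.ne
    hP.right.1 hP.ne (fun x hx ↦ hx.1) (fun x hx ↦ hx.1) fun x hx y hy hxy ↦ by
      obtain ⟨φ, hφ, h1, -⟩ := hP.cop.quotM hx hy (m := n) hn.symm hn.symm hxy
      exact ⟨φ, hφ, h1⟩
  omega

/-- Linear functionals on the cusp forms of weight six which annihilate `s * S₄ + t * S₄`. -/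
structure Dualizing (Γ : Subgroup SL(2, ℤ)) (s t : ℍ → ℂ) (lam : (ℍ → ℂ) →ₗ[ℂ] ℂ) : Prop where
  left : ∀ x ∈ SF Γ 4, lam (s * x) = 0
  right : ∀ x ∈ SF Γ 4, lam (t * x) = 0
  ne : ∃ y ∈ SF Γ 6, lam y ≠ 0

lemma exists_dualizing (hN : Num Γ d g) (hP : Pencil Γ 2 s t) : ∃ lam, Dualizing Γ s t lam := by
  have := hN.finS
  have hlt : ¬ SF Γ 6 ≤ combs s t (SF Γ 4) (SF Γ 4) := fun hle ↦ by
    have h1 := Submodule.finrank_mono hle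
    have h2 := finrank_combs_le (X := SF Γ 4) (Y := SF Γ 4) (Z := SF Γ 2) hP.left.1 hP.cop.ne
      hP.right.1 hP.ne (fun x hx ↦ hx.1) (fun x hx ↦ hx.1) (fun x hx ↦ hx.1)
      (fun x hx ↦ mul_SF' hP.right hx rfl) (fun x hx ↦ mul_SF' hP.left hx rfl)
    have := hN.s2
    have := hN.s4
    have := hN.s6
    omega
  obtain ⟨y, hy, hy'⟩ := SetLike.not_le_iff_exists.mp hlt
  obtain ⟨lam, h1, h2⟩ := Submodule.exists_le_ker_of_notMem hy'
  exact ⟨lam, fun x hx ↦ h2 (mem_combs.mpr ⟨x, hx, 0, zero_mem _, by simp⟩),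
    fun x hx ↦ h2 (mem_combs.mpr ⟨0, zero_mem _, x, hx, by simp⟩), y, hy, h1⟩

lemma Dualizing.combs_eq (hN : Num Γ d g) (hP : Pencil Γ 2 s t) {lam} (hl : Dualizing Γ s t lam)
    {y : ℍ → ℂ} (hy : y ∈ SF Γ 6) (h0 : lam y = 0) : y ∈ combs s t (SF Γ 4) (SF Γ 4) := by
  have := hN.finS
  have hle : combs s t (SF Γ 4) (SF Γ 4) ≤ SF Γ 6 ⊓ LinearMap.ker lam :=
    combs_le (fun x hx ↦ ⟨mul_SF' hP.left hx rfl, hl.left x hx⟩)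
      fun x hx ↦ ⟨mul_SF' hP.right hx rfl, hl.right x hx⟩
  have hlt : SF Γ 6 ⊓ LinearMap.ker lam < SF Γ 6 := by
    refine lt_of_le_of_ne inf_le_left fun h ↦ ?_
    obtain ⟨y, hy, hy'⟩ := hl.ne
    rw [← h] at hy
    exact hy' hy.2
  have hlt' := Submodule.finrank_lt_finrank_of_lt hlt
  have h2 := le_finrank_combs (X := SF Γ 4) (Y := SF Γ 4) (Z := SF Γ 2) hP.left.1 hP.cop.ne
    hP.right.1 hP.ne (fun x hx ↦ hx.1) (fun x hx ↦ hx.1) fun x hx y hy hxy ↦ by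
      obtain ⟨φ, hφ, h1, -⟩ := hP.cop.quotS hx hy (m := 2) (by ring) (by ring) hxy
      exact ⟨φ, hφ, h1⟩
  have := hN.s2
  have := hN.s4
  have := hN.s6
  have : FiniteDimensional ℂ (SF Γ 6 ⊓ LinearMap.ker lam : Submodule ℂ (ℍ → ℂ)) :=
    Submodule.finiteDimensional_of_le inf_le_left
  rw [Submodule.eq_of_le_of_finrank_le hle (by omega)]
  exact ⟨hy, h0⟩

/-- Multiplication by a nonzero cusp form of weight two does not map into the kernel. -/
lemma Dualizing.nondeg (hN : Num Γ d g) (hP : Pencil Γ 2 s t) {lam} (hl : Dualizing Γ s t lam)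
    (hh : h ∈ SF Γ 2) (h0 : ∀ v ∈ MF Γ 4, lam (h * v) = 0) : h = 0 := by
  have := hN.finS
  have := hN.fin
  by_contra hne
  obtain ⟨x, y, hc⟩ := hP.exists_cop (SF_le_MF hh) hne
  have h2 := le_finrank_combs (X := SF Γ 4) (Y := MF Γ 4) (Z := MF Γ 2) hc.left.1 hc.ne
    hh.1 hne (fun x hx ↦ hx.1) (fun x hx ↦ hx.1) fun x hx y hy hxy ↦ by
      obtain ⟨φ, hφ, h1, -⟩ := hc.quotM (SF_le_MF hx) hy (m := 2) (by ring) (by ring) hxy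
      exact ⟨φ, hφ, h1⟩
  have hle : combs (x • s + y • t) h (SF Γ 4) (MF Γ 4) ≤ SF Γ 6 :=
    combs_le (fun f hf ↦ mul_SF' hc.left hf rfl) fun f hf ↦ mul_SF_MF hh hf rfl
  have h3 : combs (x • s + y • t) h (SF Γ 4) (MF Γ 4) = SF Γ 6 := by
    refine Submodule.eq_of_le_of_finrank_le hle ?_
    have := hN.s4
    have := hN.s6
    have := hN.r2
    have := hN.r4
    omega
  obtain ⟨z, hz, hz'⟩ := hl.ne
  rw [← h3] at hz
  refine hz' ((show combs (x • s + y • t) h (SF Γ 4) (MF Γ 4) ≤ LinearMap.ker lam from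
    combs_le (fun f hf ↦ ?_) fun f hf ↦ h0 f hf) hz)
  rw [LinearMap.mem_ker, add_mul, smul_mul_assoc, smul_mul_assoc, map_add, map_smul, map_smul,
    hl.left f hf, hl.right f hf, smul_zero, smul_zero, add_zero]

lemma Dualizing.exists_eq (hN : Num Γ d g) (hP : Pencil Γ 2 s t) {lam} (hl : Dualizing Γ s t lam)
    {ell : (ℍ → ℂ) →ₗ[ℂ] ℂ} (hs : ∀ x ∈ MF Γ 2, ell (s * x) = 0)
    (ht : ∀ x ∈ MF Γ 2, ell (t * x) = 0) : ∃ h ∈ SF Γ 2, ∀ v ∈ MF Γ 4, ell v = lam (h * v) := by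
  have := hN.finS
  have := hN.fin
  have hle : combs s t (MF Γ 2) (MF Γ 2) ≤ MF Γ 4 :=
    combs_le (fun f hf ↦ mul_MF' hP.left hf rfl) fun f hf ↦ mul_MF' hP.right hf rfl
  refine exists_pair_eq hle (fun u hu v hv ↦ ?_) (fun u hu ↦ hl.nondeg hN hP hu) ?_ fun v hv ↦ ?_
  · obtain ⟨x, hx, y, hy, rfl⟩ := mem_combs.mp hv
    rw [show u * (s * x + t * y) = s * (u * x) + t * (u * y) by ring, map_add,
      hl.left _ (mul_SF_MF hu hx rfl), hl.right _ (mul_SF_MF hu hy rfl), add_zero]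
  · have h2 := le_finrank_combs (X := MF Γ 2) (Y := MF Γ 2) (Z := MF Γ 0) hP.left.1 hP.cop.ne
      hP.right.1 hP.ne (fun x hx ↦ hx.1) (fun x hx ↦ hx.1) fun x hx y hy hxy ↦ by
        obtain ⟨φ, hφ, h1, -⟩ := hP.cop.quotM hx hy (m := 0) (by ring) (by ring) hxy
        exact ⟨φ, hφ, h1⟩
    have := finrank_MF_zero_le (Γ := Γ)
    have := hN.s2
    have := hN.r2
    have := hN.r4
    omega
  · obtain ⟨x, hx, y, hy, rfl⟩ := mem_combs.mp hv
    rw [map_add, hs x hx, ht y hy, add_zero]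

/-- A form of weight six annihilated by all cusp forms of weight four lies in `s²R₂ + t²R₂`. -/
lemma mem_combs_sq (hN : Num Γ d g) (hP : Pencil Γ 2 s t) {v : ℍ → ℂ} (hv : v ∈ MF Γ 6)
    (hv0 : ∀ x ∈ SF Γ 4, x * v ∈ combs (s ^ 2) (t ^ 2) (SF Γ 6) (SF Γ 6)) :
    v ∈ combs (s ^ 2) (t ^ 2) (MF Γ 2) (MF Γ 2) := by
  have := hN.finS
  have := hN.fin
  have hQ : Pencil Γ 4 (s ^ 2) (t ^ 2) := hP.sq
  have hlt : ¬ SF Γ 10 ≤ combs (s ^ 2) (t ^ 2) (SF Γ 6) (SF Γ 6) := fun hle ↦ by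
    have h1 := Submodule.finrank_mono hle
    have h2 := finrank_combs_le (X := SF Γ 6) (Y := SF Γ 6) (Z := SF Γ 2) hQ.left.1 hQ.cop.ne
      hQ.right.1 hQ.ne (fun x hx ↦ hx.1) (fun x hx ↦ hx.1) (fun x hx ↦ hx.1)
      (fun x hx ↦ mul_SF' hQ.right hx rfl) (fun x hx ↦ mul_SF' hQ.left hx rfl)
    have := hN.s2
    have := hN.s6
    have := hN.s10
    omega
  obtain ⟨y₀, hy₀, hy₀'⟩ := SetLike.not_le_iff_exists.mp hlt
  obtain ⟨lam, h1, h2⟩ := Submodule.exists_le_ker_of_notMem hy₀'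
  have hl : ∀ x ∈ SF Γ 6, lam (s ^ 2 * x) = 0 := fun x hx ↦
    h2 (mem_combs.mpr ⟨x, hx, 0, zero_mem _, by simp⟩)
  have hr : ∀ x ∈ SF Γ 6, lam (t ^ 2 * x) = 0 := fun x hx ↦
    h2 (mem_combs.mpr ⟨0, zero_mem _, x, hx, by simp⟩)
  have hle : combs (s ^ 2) (t ^ 2) (MF Γ 2) (MF Γ 2) ≤ MF Γ 6 :=
    combs_le (fun f hf ↦ mul_MF' hQ.left hf rfl) fun f hf ↦ mul_MF' hQ.right hf rfl
  refine mem_of_pair_eq_zero (lam := lam) (U := SF Γ 4) hle (fun u hu v hv ↦ ?_)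
    (fun u hu hu0 ↦ ?_) ?_ hv fun u hu ↦ h2 (hv0 u hu)
  · obtain ⟨x, hx, y, hy, rfl⟩ := mem_combs.mp hv
    rw [show u * (s ^ 2 * x + t ^ 2 * y) = s ^ 2 * (u * x) + t ^ 2 * (u * y) by ring, map_add,
      hl _ (mul_SF_MF hu hx rfl), hr _ (mul_SF_MF hu hy rfl), add_zero]
  · by_contra hne
    obtain ⟨x, y, hc⟩ := hQ.exists_cop (SF_le_MF hu) hne
    have h3 := le_finrank_combs (X := SF Γ 6) (Y := MF Γ 6) (Z := MF Γ 2) hc.left.1 hc.ne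
      hu.1 hne (fun x hx ↦ hx.1) (fun x hx ↦ hx.1) fun x hx y hy hxy ↦ by
        obtain ⟨φ, hφ, h1, -⟩ := hc.quotM (SF_le_MF hx) hy (m := 2) (by ring) (by ring) hxy
        exact ⟨φ, hφ, h1⟩
    have hle' : combs (x • s ^ 2 + y • t ^ 2) u (SF Γ 6) (MF Γ 6) ≤ SF Γ 10 :=
      combs_le (fun f hf ↦ mul_SF' hc.left hf rfl) fun f hf ↦ mul_SF_MF hu hf rfl
    have h4 : combs (x • s ^ 2 + y • t ^ 2) u (SF Γ 6) (MF Γ 6) = SF Γ 10 := by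
      refine Submodule.eq_of_le_of_finrank_le hle' ?_
      have := hN.s6
      have := hN.s10
      have := hN.r2
      have := hN.r6
      omega
    rw [← h4] at hy₀
    refine h1 ((show combs (x • s ^ 2 + y • t ^ 2) u (SF Γ 6) (MF Γ 6) ≤ LinearMap.ker lam from
      combs_le (fun f hf ↦ ?_) fun f hf ↦ hu0 f hf) hy₀)
    rw [LinearMap.mem_ker, add_mul, smul_mul_assoc, smul_mul_assoc, map_add, map_smul, map_smul,
      hl f hf, hr f hf, smul_zero, smul_zero, add_zero]
  · have h3 := le_finrank_combs (X := MF Γ 2) (Y := MF Γ 2) (Z := ⊥) hQ.left.1 hQ.cop.ne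
      hQ.right.1 hQ.ne (fun x hx ↦ hx.1) (fun x hx ↦ hx.1) fun x hx y hy hxy ↦ by
        obtain ⟨φ, hφ, h1, -⟩ := hQ.cop.quotM hx hy (m := -2) (by ring) (by ring) hxy
        exact ⟨φ, (Submodule.mem_bot ℂ).mpr (MF_neg (by norm_num) hφ), h1⟩
    rw [finrank_bot] at h3
    have := hN.s4
    have := hN.r2
    have := hN.r6
    omega

/-- The radical of the pairing of `R₂` with `S₄` is spanned by the pencil. -/
lemma Dualizing.radical (hN : Num Γ d g) (hP : Pencil Γ 2 s t) {lam} (hl : Dualizing Γ s t lam)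
    {b : ℍ → ℂ} (hb : b ∈ MF Γ 2) (h0 : ∀ x ∈ SF Γ 4, lam (b * x) = 0) :
    b ∈ Submodule.span ℂ {s, t} := by
  have hbx : ∀ x ∈ SF Γ 4, b * x ∈ combs s t (SF Γ 4) (SF Γ 4) := fun x hx ↦
    hl.combs_eq hN hP (mul_SF' hb hx rfl) (h0 x hx)
  have h1 := mem_combs_sq hN hP (v := s * t * b)
    (mul_MF' (mul_MF' hP.left hP.right rfl) hb rfl) fun x hx ↦ by
      obtain ⟨p, hp, q, hq, hpq⟩ := mem_combs.mp (hbx x hx)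
      refine mem_combs.mpr ⟨t * p, mul_SF' hP.right hp rfl, s * q, mul_SF' hP.left hq rfl, ?_⟩
      linear_combination (s * t) * hpq
  obtain ⟨a, ha, c, hc, hac⟩ := mem_combs.mp h1
  have hcop : Cop Γ 2 s 4 (t ^ 2) := ⟨hP.left, pow_MF hP.right 2,
    fun z ↦ (hP.pt z).imp_right (pow_ne_zero 2), hP.cop.cusp⟩
  obtain ⟨φ, hφ, h2, -⟩ := hcop.quotM (f := t * b - s * a) (g := c) (m := 0)
    (sub_mem (mul_MF' hP.right hb rfl) (mul_MF' hP.left ha rfl)) hc (by ring) (by ring)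
    (by linear_combination -hac)
  obtain ⟨κ, rfl⟩ := MF_const hφ
  obtain ⟨ψ, hψ, -, h3⟩ := hP.cop.quotM (f := a) (g := b - κ • t) (m := 0) ha
    (sub_mem hb (Submodule.smul_mem _ _ hP.right)) (by ring) (by ring) (by
      rw [smul_mul_assoc, one_mul] at h2
      rw [pow_two] at h2
      rw [mul_sub, mul_smul_comm]
      linear_combination -h2)
  obtain ⟨κ', rfl⟩ := MF_const hψ
  rw [smul_mul_assoc, one_mul] at h3
  exact Submodule.mem_span_pair.mpr ⟨κ', κ, by rw [← h3]; ring⟩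

theorem MF_four_le (hN : Num Γ d g) (hP : Pencil Γ 2 s t) (hdg : 2 * g + 1 ≤ d) :
    MF Γ 4 ≤ MF Γ 2 * MF Γ 2 := by
  have := hN.finS
  have := hN.fin
  by_contra hnot
  obtain ⟨x₀, hx₀, hx₀'⟩ := SetLike.not_le_iff_exists.mp hnot
  obtain ⟨ell, h1, h2⟩ := Submodule.exists_le_ker_of_notMem hx₀'
  have hell : ∀ x ∈ MF Γ 2, ∀ y ∈ MF Γ 2, ell (x * y) = 0 := fun x hx y hy ↦
    h2 (Submodule.mul_mem_mul hx hy)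
  obtain ⟨lam, hl⟩ := exists_dualizing hN hP
  obtain ⟨h, hh, hlam⟩ := hl.exists_eq hN hP (hell s hP.left) (hell t hP.right)
  have hne : h ≠ 0 := by
    rintro rfl
    exact h1 (by rw [hlam x₀ hx₀, zero_mul, map_zero])
  obtain ⟨x, y, hc⟩ := hP.exists_cop (SF_le_MF hh) hne
  have h3 := le_finrank_combs (X := SF Γ 2) (Y := MF Γ 2) (Z := MF Γ 0) hc.left.1 hc.ne
    hh.1 hne (fun x hx ↦ hx.1) (fun x hx ↦ hx.1) fun x hx y hy hxy ↦ by
      obtain ⟨φ, hφ, h1, -⟩ := hc.quotM (SF_le_MF hx) hy (m := 0) (by ring) (by ring) hxy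
      exact ⟨φ, hφ, h1⟩
  have hst : FiniteDimensional ℂ (Submodule.span ℂ {s, t}) :=
    FiniteDimensional.span_of_finite ℂ (Set.toFinite _)
  have h4 := finrank_le_of_radical (lam := lam) (U := MF Γ 2) (V := SF Γ 4)
    (R := Submodule.span ℂ {s, t}) (P := combs (x • s + y • t) h (SF Γ 2) (MF Γ 2))
    (fun b hb hb0 ↦ hl.radical hN hP hb hb0)
    (combs_le (fun f hf ↦ mul_SF' hc.left hf rfl) fun f hf ↦ mul_SF_MF hh hf rfl)
    (fun b hb v hv ↦ by
      refine (show combs (x • s + y • t) h (SF Γ 2) (MF Γ 2) ≤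
        LinearMap.ker (lam ∘ₗ LinearMap.mulLeft ℂ b) from
        combs_le (fun f hf ↦ ?_) fun f hf ↦ ?_) hv
      · rw [LinearMap.mem_ker, LinearMap.comp_apply, LinearMap.mulLeft_apply,
          show b * ((x • s + y • t) * f) = x • (s * (b * f)) + y • (t * (b * f)) by
            simp only [← smul_mul_assoc]; ring, map_add, map_smul, map_smul,
          hl.left _ (mul_SF' hb hf rfl), hl.right _ (mul_SF' hb hf rfl), smul_zero, smul_zero,
          add_zero]
      · rw [LinearMap.mem_ker, LinearMap.comp_apply, LinearMap.mulLeft_apply,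
          show b * (h * f) = h * (b * f) by ring, ← hlam _ (mul_MF' hb hf rfl), hell b hb f hf])
  have h5 : Module.finrank ℂ (Submodule.span ℂ {s, t}) ≤ 2 := by
    classical
    refine (finrank_span_le_card _).trans ?_
    rw [Set.toFinset_insert, Set.toFinset_singleton]
    exact Finset.card_le_two
  have := finrank_MF_zero_le (Γ := Γ)
  have := hN.s2
  have := hN.s4
  have := hN.r2
  omega

end

/-! ### Generation -/

section

variable [Γ.FiniteIndex] {a : Cos Γ → ℤ} {e s : Cos Γ → ℍ → ℂ} {d g : ℤ}

lemma Level.le_E4_E6 (h : Level Γ a e s d g) (hk : 12 ≤ k) :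
    MF Γ k ≤ combs E4 E6 (MF Γ (k - 4)) (MF Γ (k - 6)) := by
  intro f hf
  obtain ⟨α, hα, rfl⟩ := h.gen hf
  refine sum_mem fun i _ ↦ ?_
  have h10 := h.le_ten h.even i
  obtain ⟨n, hn⟩ := Int.eq_ofNat_of_zero_le (show 0 ≤ k - a i by omega)
  have hi := hα i
  rw [hn] at hi
  obtain ⟨β, hβ, c, m, h1, h2⟩ := top_mod_E4 n _ hi
  rw [h1]
  refine mem_combs.mpr ⟨β * e i, mul_MF' (MF_top_le hβ) (h.mem i) (by omega),
    (c • E6 ^ (m - 1)) * e i, ?_, ?_⟩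
  · by_cases hc : c = 0
    · rw [hc, zero_smul, zero_mul]; exact zero_mem _
    · have h3 := h2 hc
      have h4 : 1 ≤ m := by omega
      refine mul_MF' (Submodule.smul_mem _ _ (pow_MF (MF_top_le E6_mem) (m - 1))) (h.mem i) ?_
      push_cast [h4]
      omega
  · by_cases hc : c = 0
    · rw [hc, zero_smul, zero_smul]; ring
    · have h3 := h2 hc
      obtain ⟨m, rfl⟩ : ∃ r, m = r + 1 := ⟨m - 1, by omega⟩
      rw [Nat.add_sub_cancel, pow_succ, smul_mul_assoc, mul_smul_comm, add_mul, smul_mul_assoc]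
      congr 1
      · ring
      · congr 1
        ring

theorem Level.le_pow (h : Level Γ a e s d g) (n : ℕ) (hn : 1 ≤ n) :
    MF Γ (2 * n) ≤ MF Γ 2 ^ n := by
  have := h.num.fin
  obtain ⟨s, t, hP⟩ := exists_pencil h.exists_ne h.exists_cusp_ne
  have r2 := h.num.r2
  have r4 := h.num.r4
  have r6 := h.num.r6
  have r8 := h.num.r8
  have r10 := h.num.r10
  have hstep : ∀ {m : ℕ} {k : ℤ}, MF Γ k ≤ MF Γ 2 ^ m →
      combs s t (MF Γ k) (MF Γ k) ≤ MF Γ 2 ^ (m + 1) := fun hm ↦ by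
    rw [pow_succ']
    exact combs_le (fun x hx ↦ Submodule.mul_mem_mul hP.left (hm hx))
      fun x hx ↦ Submodule.mul_mem_mul hP.right (hm hx)
  have h4 : MF Γ 4 ≤ MF Γ 2 ^ 2 := by
    rw [pow_two]
    exact MF_four_le h.num hP h.ineq
  have h6 : MF Γ 6 ≤ MF Γ 2 ^ 3 :=
    (MF_le_combs h.num hP (k := 4) (m := 6) (n := 2) rfl rfl (by omega)).trans (hstep h4)
  have h8 : MF Γ 8 ≤ MF Γ 2 ^ 4 :=
    (MF_le_combs h.num hP (k := 6) (m := 8) (n := 4) rfl rfl (by omega)).trans (hstep h6)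
  have h10 : MF Γ 10 ≤ MF Γ 2 ^ 5 :=
    (MF_le_combs h.num hP (k := 8) (m := 10) (n := 6) rfl rfl (by omega)).trans (hstep h8)
  induction n using Nat.strong_induction_on with
  | _ n ih =>
    rcases lt_or_ge n 6 with hlt | hge
    · interval_cases n
      · simp
      · exact h4
      · exact h6
      · exact h8
      · exact h10
    · refine (h.le_E4_E6 (by omega)).trans (combs_le (fun x hx ↦ ?_) fun x hx ↦ ?_)
      · have hx' := ih (n - 2) (by omega) (by omega)
          (show x ∈ _ by convert hx using 2; push_cast [show 2 ≤ n by omega]; ring)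
        have := Submodule.mul_mem_mul (h4 (MF_top_le E4_mem)) hx'
        rwa [← pow_add, show 2 + (n - 2) = n by omega] at this
      · have hx' := ih (n - 3) (by omega) (by omega)
          (show x ∈ _ by convert hx using 2; push_cast [show 3 ≤ n by omega]; ring)
        have := Submodule.mul_mem_mul (h6 (MF_top_le E6_mem)) hx'
        rwa [← pow_add, show 3 + (n - 3) = n by omega] at this

end

end

end

end WeightTwo

/-- If `N` is composite, and `4 ∣ N` or some prime `p ≡ 3 (mod 4)` divides `N`, and
`9 ∣ N` or some prime `p ≡ 2 (mod 3)` divides `N`, then for every even `k ≥ 2`,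
every weight-`k` modular form on `Γ0(N)` is a `ℂ`-linear combination of products of
`k/2` weight-two modular forms on `Γ0(N)`. -/
theorem weight_two_generation
    (N : ℕ) (hN1 : 1 < N) (hNcomp : ¬ N.Prime)
    (h4 : 4 ∣ N ∨ ∃ p : ℕ, p.Prime ∧ p ∣ N ∧ p % 4 = 3)
    (h9 : 9 ∣ N ∨ ∃ p : ℕ, p.Prime ∧ p ∣ N ∧ p % 3 = 2)
    (k : ℤ) (hk : 2 ≤ k) (hke : Even k)
    (f : ModularForm (Gamma0 N) k) :
    (⇑f : UpperHalfPlane → ℂ) ∈ Submodule.span ℂ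
      {F : UpperHalfPlane → ℂ |
        ∃ g : Fin (k / 2).toNat → ModularForm (Gamma0 N) 2,
          F = fun z => ∏ i, g i z} := by
  have : NeZero N := ⟨by omega⟩
  obtain ⟨a, e, s, d, g, h⟩ := WeightTwo.Gamma0_level hN1 hNcomp h4 h9
  obtain ⟨m, rfl⟩ := hke
  obtain ⟨n, rfl⟩ := Int.eq_ofNat_of_zero_le (show 0 ≤ m by omega)
  have hn : ((n + n : ℤ) / 2).toNat = n := by omega
  rw [hn]
  have hf := h.le_pow n (by omega) (show ⇑f ∈ _ by
    rw [two_mul]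
    exact WeightTwo.coe_mem_MF rfl f)
  rw [← Submodule.span_eq (WeightTwo.MF (Gamma0 N) 2), Submodule.span_pow] at hf
  refine Submodule.span_mono ?_ hf
  intro F hF
  obtain ⟨G, rfl⟩ := Set.mem_pow.mp hF
  choose G' hG' using fun i ↦ WeightTwo.exists_form
    (𝒢 := (Gamma0 N).map (Matrix.SpecialLinearGroup.mapGL ℝ)) rfl (G i).2
  refine ⟨G', ?_⟩
  rw [List.prod_ofFn]
  ext z
  simp [hG']
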